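/- Let E ⊆ Γ be a Carleson set such that J₀⁺(E) is weak-star dense in A⁺. Then I = I^A ∩ S_I·H^∞ for every closed ideal I ≠ {0} of A⁺ such that the perfect part of h(I) ∩ Γ is contained in E. -/

import Mathlib

noncomputable section

/-- An invertible contraction on a (complex) Banach space. -/
structure BanachContraction where
  X : Type
  [grp : NormedAddCommGroup X]
  [mod : NormedSpace ℂ X]
  [cpl : CompleteSpace X]
  T : X →L[ℂ] X
  Tinv : X →L[ℂ] X
  norm_le : ‖T‖ ≤ 1
  mul_inv : T * Tinv = 1
  inv_mul : Tinv * T = 1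

attribute [instance] BanachContraction.grp BanachContraction.mod BanachContraction.cpl

open Complex MeasureTheory Metric Set Filter

/-- The `n`-th Taylor coefficient of `f` at `0`, i.e. `f⁽ⁿ⁾(0)/n!`. -/
def taylorCoeff (f : ℂ → ℂ) (n : ℕ) : ℂ := iteratedDeriv n f 0 / (n.factorial : ℂ)

/-- `A⁺`, the algebra of absolutely convergent Taylor series: functions which, on the
closed unit disk, are sums of a power series with absolutely summable coefficients. -/
def APlus : Set (ℂ → ℂ) :=
  {f | ∃ a : ℕ → ℂ, Summable (fun n => ‖a n‖) ∧
    ∀ z ∈ Metric.closedBall (0 : ℂ) 1, HasSum (fun n => a n * z ^ n) (f z)}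

/-- The norm `‖f‖₁ = ∑ₙ |f⁽ⁿ⁾(0)/n!|` on `A⁺`. -/
def APlusNorm (f : ℂ → ℂ) : ℝ := ∑' n : ℕ, ‖taylorCoeff f n‖

/-- The `n`-th Fourier coefficient of (the boundary values of) `f` on the unit circle. -/
def fcoeff (f : ℂ → ℂ) (n : ℤ) : ℂ :=
  (1 / (2 * Real.pi)) * ∫ θ in (0:ℝ)..(2 * Real.pi),
    f (Complex.exp ((θ : ℂ) * Complex.I)) * Complex.exp (-(n : ℂ) * (θ : ℂ) * Complex.I)

/-- The Wiener algebra `A(Γ)` of absolutely convergent Fourier series on the unit circle,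
viewed as functions `ℂ → ℂ` (only the values on the unit circle are relevant). -/
def WienerAlg : Set (ℂ → ℂ) :=
  {f | Summable (fun n : ℤ => ‖fcoeff f n‖) ∧
    ∀ z ∈ Metric.sphere (0 : ℂ) 1, HasSum (fun n : ℤ => fcoeff f n * z ^ n) (f z)}

/-- The norm `‖f‖₁ = ∑_{n ∈ ℤ} |f̂(n)|` on `A(Γ)`. -/
def WienerNorm (f : ℂ → ℂ) : ℝ := ∑' n : ℤ, ‖fcoeff f n‖

/-- `I` is a closed ideal of `A⁺` (closedness w.r.t. the norm `APlusNorm`). -/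
def IsClosedIdealAPlus (I : Set (ℂ → ℂ)) : Prop :=
  I ⊆ APlus ∧
  (∀ f ∈ I, ∀ g ∈ I, f + g ∈ I) ∧
  (∀ f ∈ APlus, ∀ g ∈ I, f * g ∈ I) ∧
  (∀ f ∈ APlus, (∀ ε > 0, ∃ g ∈ I, APlusNorm (f - g) < ε) → f ∈ I)

/-- `J` is a closed ideal of the Wiener algebra `A(Γ)`. -/
def IsClosedIdealW (J : Set (ℂ → ℂ)) : Prop :=
  J ⊆ WienerAlg ∧
  (∀ f ∈ J, ∀ g ∈ J, f + g ∈ J) ∧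
  (∀ f ∈ WienerAlg, ∀ g ∈ J, f * g ∈ J) ∧
  (∀ f ∈ WienerAlg, (∀ ε > 0, ∃ g ∈ J, WienerNorm (f - g) < ε) → f ∈ J)

/-- `I^A` : the closed ideal generated by `I` in the Wiener algebra `A(Γ)`. -/
def IdealGenW (I : Set (ℂ → ℂ)) : Set (ℂ → ℂ) := ⋂₀ {J | IsClosedIdealW J ∧ I ⊆ J}

/-- The hull `h(I)`: common zeros in the closed unit disk of all elements of `I`. -/
def hull (I : Set (ℂ → ℂ)) : Set ℂ :=
  {z ∈ Metric.closedBall (0 : ℂ) 1 | ∀ f ∈ I, f z = 0}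

/-- `I ≠ {0}`: `I` contains an element not identically zero on the unit disk. -/
def NontrivialIdeal (I : Set (ℂ → ℂ)) : Prop :=
  ∃ f ∈ I, ∃ z ∈ Metric.ball (0 : ℂ) 1, f z ≠ 0

/-- `H^∞(D)`: bounded holomorphic functions on the open unit disk. -/
def Hinf : Set (ℂ → ℂ) :=
  {f | DifferentiableOn ℂ f (Metric.ball (0 : ℂ) 1) ∧
    ∃ C : ℝ, ∀ z ∈ Metric.ball (0 : ℂ) 1, ‖f z‖ ≤ C}

/-- An inner function: a bounded-by-one holomorphic function on the unit disk whose
radial limits have modulus `1` at almost every boundary point. -/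
def IsInnerFunction (u : ℂ → ℂ) : Prop :=
  DifferentiableOn ℂ u (Metric.ball (0 : ℂ) 1) ∧
  (∀ z ∈ Metric.ball (0 : ℂ) 1, ‖u z‖ ≤ 1) ∧
  ∀ᵐ (θ : ℝ) ∂(MeasureTheory.volume.restrict (Set.Ioc (0 : ℝ) (2 * Real.pi))),
    Filter.Tendsto (fun r : ℝ => ‖u ((r : ℂ) * Complex.exp ((θ : ℂ) * Complex.I))‖)
      (nhdsWithin 1 (Set.Iio 1)) (nhds 1)

/-- `S` divides (the inner factor of) `f`, i.e. `f ∈ S·H^∞`. -/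
def InnerDivides (S f : ℂ → ℂ) : Prop :=
  ∃ g ∈ Hinf, ∀ z ∈ Metric.ball (0 : ℂ) 1, f z = S z * g z

/-- `S` is a greatest common divisor of the inner factors of the nonzero elements of `I`:
`S` is inner, divides every nonzero element of `I`, and every inner function with this
property divides `S`. -/
def IsGcdInner (I : Set (ℂ → ℂ)) (S : ℂ → ℂ) : Prop :=
  IsInnerFunction S ∧
  (∀ f ∈ I, (∃ z ∈ Metric.ball (0 : ℂ) 1, f z ≠ 0) → InnerDivides S f) ∧
  ∀ S' : ℂ → ℂ, IsInnerFunction S' →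
    (∀ f ∈ I, (∃ z ∈ Metric.ball (0 : ℂ) 1, f z ≠ 0) → InnerDivides S' f) →
    InnerDivides S' S

/-- The perfect symmetric set `E_ξ` of constant ratio `ξ` on the unit circle. -/
def Eset (ξ : ℝ) : Set ℂ :=
  {z | ∃ ε : ℕ → ℕ, (∀ k, ε k ≤ 1) ∧
    z = Complex.exp (2 * Real.pi * Complex.I *
      (((1 - ξ) * ∑' k : ℕ, (ε k : ℝ) * ξ ^ k : ℝ) : ℂ))}

/-- A Carleson set: a closed subset of the unit circle with
`∫_{-π}^{π} log (2 / dist(e^{iθ}, E)) dθ < ∞`. -/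
def IsCarleson (E : Set ℂ) : Prop :=
  IsClosed E ∧ E ⊆ Metric.sphere (0 : ℂ) 1 ∧
  MeasureTheory.IntegrableOn
    (fun θ : ℝ => Real.log (2 / Metric.infDist (Complex.exp ((θ : ℂ) * Complex.I)) E))
    (Set.Ioc (-Real.pi) Real.pi)

/-- The division ideal `I(f) = {g ∈ A⁺ : fg ∈ I}`. -/
def Idiv (I : Set (ℂ → ℂ)) (f : ℂ → ℂ) : Set (ℂ → ℂ) := {g ∈ APlus | f * g ∈ I}

/-- `f` belongs to `A^∞(D)` and vanishes on `E` together with all its derivatives: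
`f` is holomorphic on the disk, and each derivative extends continuously to the closed
disk with the extension vanishing on `E`. -/
def VanishAllDeriv (E : Set ℂ) (f : ℂ → ℂ) : Prop :=
  ContinuousOn f (Metric.closedBall (0 : ℂ) 1) ∧
  DifferentiableOn ℂ f (Metric.ball (0 : ℂ) 1) ∧
  (∀ z ∈ E, f z = 0) ∧
  ∀ n : ℕ, ∃ g : ℂ → ℂ, ContinuousOn g (Metric.closedBall (0 : ℂ) 1) ∧
    Set.EqOn g (iteratedDeriv n f) (Metric.ball (0 : ℂ) 1) ∧ ∀ z ∈ E, g z = 0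

/-- `J₀⁺(E)`: the closure in `A⁺` of the set of elements of `A^∞(D)` vanishing on `E`
together with all their derivatives. -/
def J0Plus (E : Set ℂ) : Set (ℂ → ℂ) :=
  {f | f ∈ APlus ∧ ∀ ε > 0, ∃ g ∈ APlus, VanishAllDeriv E g ∧ APlusNorm (f - g) < ε}

/-- `I⁺(E) = {f ∈ A⁺ : f ≡ 0 on E}`. -/
def IPlus (E : Set ℂ) : Set (ℂ → ℂ) := {f ∈ APlus | ∀ z ∈ E, f z = 0}

/-- The pairing of `f ∈ A⁺ ≅ ℓ¹(ℕ)` with an element `c ∈ c₀`. -/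
def pairing (f : ℂ → ℂ) (c : ℕ → ℂ) : ℂ := ∑' n : ℕ, taylorCoeff f n * c n

/-- `S` is dense in `A⁺` for the weak-star topology `σ(ℓ¹, c₀)`. -/
def WStarDense (S : Set (ℂ → ℂ)) : Prop :=
  ∀ f ∈ APlus, ∀ (m : ℕ) (c : Fin m → ℕ → ℂ),
    (∀ i, Filter.Tendsto (c i) Filter.atTop (nhds 0)) →
    ∀ ε > 0, ∃ g ∈ S, ∀ i, ‖pairing f (c i) - pairing g (c i)‖ < ε

/-- `S` is closed in `A⁺` for the weak-star topology `σ(ℓ¹, c₀)`. -/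
def WStarClosed (S : Set (ℂ → ℂ)) : Prop :=
  S ⊆ APlus ∧
  ∀ f ∈ APlus,
    (∀ (m : ℕ) (c : Fin m → ℕ → ℂ),
      (∀ i, Filter.Tendsto (c i) Filter.atTop (nhds 0)) →
      ∀ ε > 0, ∃ g ∈ S, ∀ i, ‖pairing f (c i) - pairing g (c i)‖ < ε) → f ∈ S

/-- A Kronecker set: a compact subset of the unit circle on which every continuous
unimodular function is a uniform limit of characters `z ↦ zⁿ`, `n ∈ ℤ`. -/
def IsKronecker (K : Set ℂ) : Prop :=
  IsCompact K ∧ K ⊆ Metric.sphere (0 : ℂ) 1 ∧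
  ∀ f : ℂ → ℂ, ContinuousOn f K → (∀ z ∈ K, ‖f z‖ = 1) →
    ∀ ε > 0, ∃ n : ℤ, ∀ z ∈ K, ‖f z - z ^ n‖ < ε

/-- A Helson set: a compact subset of the unit circle on which every continuous function
is the restriction of an element of the Wiener algebra. -/
def IsHelson (K : Set ℂ) : Prop :=
  IsCompact K ∧ K ⊆ Metric.sphere (0 : ℂ) 1 ∧
  ∀ f : ℂ → ℂ, ContinuousOn f K → ∃ g ∈ WienerAlg, ∀ z ∈ K, f z = g z

/-- The little Lipschitz class `Λ_α(D)`: disc-algebra functions with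
`|f(e^{it₁}) - f(e^{it₂})| / |t₁-t₂|^α → 0` uniformly as `|t₁-t₂| → 0`. -/
def LittleLip (α : ℝ) (f : ℂ → ℂ) : Prop :=
  ContinuousOn f (Metric.closedBall (0 : ℂ) 1) ∧
  DifferentiableOn ℂ f (Metric.ball (0 : ℂ) 1) ∧
  ∀ ε > 0, ∃ δ > 0, ∀ t₁ t₂ : ℝ, t₁ ≠ t₂ → |t₁ - t₂| < δ →
    ‖f (Complex.exp ((t₁ : ℂ) * Complex.I)) - f (Complex.exp ((t₂ : ℂ) * Complex.I))‖ ≤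
      ε * |t₁ - t₂| ^ α

/-- The perfect part of a set: the union of all its perfect subsets. -/
def perfectPart (C : Set ℂ) : Set ℂ := ⋃₀ {P | Perfect P ∧ P ⊆ C}

/-- A distribution on the unit circle, encoded by its sequence of Fourier coefficients
`μ̂(n) = μ(e^{-int})`, which has polynomial growth. -/
structure CircleDistribution where
  coeff : ℤ → ℂ
  growth : ∃ (C : ℝ) (k : ℕ), ∀ n : ℤ, ‖coeff n‖ ≤ C * (1 + (n.natAbs : ℝ)) ^ k

/-- A smooth `2π`-periodic function (test function on the circle). -/
def PeriodicSmooth (φ : ℝ → ℂ) : Prop :=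
  ContDiff ℝ (⊤ : ℕ∞) φ ∧ ∀ θ : ℝ, φ (θ + 2 * Real.pi) = φ θ

/-- Fourier coefficients of a test function. -/
def testCoeff (φ : ℝ → ℂ) (n : ℤ) : ℂ :=
  (1 / (2 * Real.pi)) * ∫ θ in (0:ℝ)..(2 * Real.pi),
    φ θ * Complex.exp (-(n : ℂ) * (θ : ℂ) * Complex.I)

/-- The action of a distribution on a test function: `μ(φ) = ∑ₙ μ̂(n) φ̂(-n)`. -/
def distAct (μ : CircleDistribution) (φ : ℝ → ℂ) : ℂ := ∑' n : ℤ, μ.coeff n * testCoeff φ (-n)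

/-- The support of a distribution on the circle: the points of the circle having no open
neighbourhood `U` such that `μ` kills every test function supported in `U`. -/
def distSupport (μ : CircleDistribution) : Set ℂ :=
  {z ∈ Metric.sphere (0 : ℂ) 1 | ∀ U : Set ℂ, IsOpen U → z ∈ U →
    ∃ φ : ℝ → ℂ, PeriodicSmooth φ ∧
      (∀ θ : ℝ, Complex.exp ((θ : ℂ) * Complex.I) ∉ U → φ θ = 0) ∧ distAct μ φ ≠ 0}

/-- A set of multiplicity: a closed subset of the circle supporting a nonzero
pseudofunction (distribution whose Fourier coefficients tend to `0` as `|n| → ∞`). -/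
def IsMSet (E : Set ℂ) : Prop :=
  IsClosed E ∧ E ⊆ Metric.sphere (0 : ℂ) 1 ∧
  ∃ μ : CircleDistribution, μ.coeff ≠ 0 ∧ distSupport μ ⊆ E ∧
    Filter.Tendsto μ.coeff Filter.cofinite (nhds 0)

/-- A Dirichlet set: `sup_{z ∈ E} |z^{n_k} - 1| → 0` for some sequence `n_k → ∞`. -/
def IsDirichletSet (E : Set ℂ) : Prop :=
  ∃ n : ℕ → ℕ, Filter.Tendsto n Filter.atTop Filter.atTop ∧
    ∀ ε > 0, ∀ᶠ k in Filter.atTop, ∀ z ∈ E, ‖z ^ (n k) - 1‖ < ε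

/-! ### Taylor coefficients -/

lemma taylorCoeff_eq_of_hasSum {f : ℂ → ℂ} {a : ℕ → ℂ}
    (h : ∀ z ∈ ball (0 : ℂ) 1, HasSum (fun n => a n * z ^ n) (f z)) (n : ℕ) :
    taylorCoeff f n = a n := by
  have hp : HasFPowerSeriesOnBall f (FormalMultilinearSeries.ofScalars ℂ a) 0 1 := by
    refine ⟨?_, zero_lt_one, ?_⟩
    · refine ENNReal.le_of_forall_nnreal_lt fun r hr => ?_
      refine FormalMultilinearSeries.le_radius_of_tendsto _ (l := 0) ?_
      have h1 : (r : ℝ) < 1 := by exact_mod_cast hr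
      have h2 := (h (r : ℂ) (by simpa using h1)).summable.tendsto_atTop_zero.norm
      simpa [FormalMultilinearSeries.ofScalars_norm] using h2
    · intro y hy
      have hy' : y ∈ ball (0 : ℂ) 1 := by
        simpa [Metric.eball, edist_zero_right, ← ofReal_norm] using hy
      have := h y hy'
      simpa [FormalMultilinearSeries.ofScalars_apply_eq, mul_comm] using this
  have h3 := hp.factorial_smul 1 n
  rw [taylorCoeff, iteratedDeriv_eq_iteratedFDeriv, ← h3]
  rw [FormalMultilinearSeries.ofScalars_apply_eq]
  have : (n.factorial : ℂ) ≠ 0 := by exact_mod_cast n.factorial_ne_zero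
  simp [nsmul_eq_mul]
  field_simp

lemma hasSum_taylorCoeff {f : ℂ → ℂ} (hf : DifferentiableOn ℂ f (ball 0 1)) {z : ℂ}
    (hz : z ∈ ball (0 : ℂ) 1) : HasSum (fun n => taylorCoeff f n * z ^ n) (f z) := by
  have := Complex.hasSum_taylorSeries_on_ball (r := 1) (c := 0) (f := f) (by simpa using hf)
    (z := z) (by simpa using hz)
  refine this.congr_fun ?_ |> id
  intro n
  simp [taylorCoeff]; ring

/-! ### The space `ℓ¹(ℕ)` with its shift operators -/

/-- The Banach space `ℓ¹(ℕ)`. -/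
def L1 : Type := lp (fun _ : ℕ => ℂ) 1

namespace L1

instance : NormedAddCommGroup L1 := inferInstanceAs (NormedAddCommGroup (lp (fun _ : ℕ => ℂ) 1))
instance : NormedSpace ℂ L1 := inferInstanceAs (NormedSpace ℂ (lp (fun _ : ℕ => ℂ) 1))
instance : CompleteSpace L1 := inferInstanceAs (CompleteSpace (lp (fun _ : ℕ => ℂ) 1))

/-- The underlying sequence. -/
def seq (a : L1) : ℕ → ℂ := (show lp (fun _ : ℕ => ℂ) 1 from a).1

instance : CoeFun L1 (fun _ => ℕ → ℂ) := ⟨seq⟩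

@[simp] lemma add_apply (a b : L1) (n : ℕ) : (a + b) n = a n + b n := rfl
@[simp] lemma sub_apply (a b : L1) (n : ℕ) : (a - b) n = a n - b n := rfl
@[simp] lemma zero_apply (n : ℕ) : (0 : L1) n = 0 := rfl
@[simp] lemma smul_apply (c : ℂ) (a : L1) (n : ℕ) : (c • a) n = c * a n := rfl

lemma norm_eq (a : L1) : ‖a‖ = ∑' n, ‖a n‖ := by
  have h := lp.norm_eq_tsum_rpow (E := fun _ : ℕ => ℂ) (p := 1) (by simp) a
  simp only [ENNReal.toReal_one, Real.rpow_one, div_one] at h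
  exact h

lemma summable_norm (a : L1) : Summable (fun n => ‖a n‖) := by
  have h := (lp.memℓp (E := fun _ : ℕ => ℂ) (p := 1) a).summable (by simp)
  simp only [ENNReal.toReal_one, Real.rpow_one] at h
  exact h

/-- The element of `ℓ¹` given by an absolutely summable sequence. -/
def ofSummable (a : ℕ → ℂ) (h : Summable (fun n => ‖a n‖)) : L1 :=
  (⟨a, memℓp_gen (by simpa using h)⟩ : lp (fun _ : ℕ => ℂ) 1)

@[simp] lemma ofSummable_apply (a : ℕ → ℂ) (h : Summable (fun n => ‖a n‖)) (n : ℕ) :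
    ofSummable a h n = a n := rfl

lemma ext' {a b : L1} (h : ∀ n, a n = b n) : a = b :=
  lp.ext (E := fun _ : ℕ => ℂ) (p := 1) (funext h)

/-- The unit vector at `k`. -/
def unit (k : ℕ) : L1 := (lp.single 1 k (1 : ℂ) : lp (fun _ : ℕ => ℂ) 1)

lemma unit_apply (k n : ℕ) : unit k n = if n = k then 1 else 0 := by
  have : unit k n = (Pi.single k (1 : ℂ) : ℕ → ℂ) n :=
    lp.single_apply (E := fun _ : ℕ => ℂ) 1 k 1 n
  rw [this, Pi.single_apply]

lemma hasSum_unit (a : L1) : HasSum (fun n => a n • unit n) a := by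
  have h := lp.hasSum_single (E := fun _ : ℕ => ℂ) (p := 1) (by simp) a
  have e : (fun n => a n • unit n) =
      fun n => (lp.single 1 n (seq a n) : lp (fun _ : ℕ => ℂ) 1) := by
    funext n
    refine ext' fun m => ?_
    have : seq (lp.single 1 n (seq a n) : lp (fun _ : ℕ => ℂ) 1) m
        = (Pi.single n (seq a n) : ℕ → ℂ) m :=
      lp.single_apply (E := fun _ : ℕ => ℂ) 1 n _ m
    rw [this, smul_apply, unit_apply, Pi.single_apply]; simp
  rw [e]
  exact h

def backFun (a : L1) : L1 :=
  ofSummable (fun n => a (n + 1)) ((summable_nat_add_iff 1).2 a.summable_norm)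

def shiftFun (a : L1) : L1 :=
  ofSummable (fun n => if n = 0 then 0 else a (n - 1))
    ((summable_nat_add_iff 1).1 (by simpa using a.summable_norm))

/-- The forward shift. -/
def shift : L1 →L[ℂ] L1 :=
  LinearMap.mkContinuous
    { toFun := shiftFun
      map_add' := fun a b => ext' fun n => by by_cases h : n = 0 <;> simp [shiftFun, h]
      map_smul' := fun c a => ext' fun n => by by_cases h : n = 0 <;> simp [shiftFun, h] } 1 (by
    intro a
    simp only [LinearMap.coe_mk, AddHom.coe_mk, one_mul, norm_eq]
    rw [(shiftFun a).summable_norm.tsum_eq_zero_add]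
    simp [shiftFun])

/-- The backward shift. -/
def back : L1 →L[ℂ] L1 :=
  LinearMap.mkContinuous
    { toFun := backFun
      map_add' := fun a b => ext' fun n => by simp [backFun]
      map_smul' := fun c a => ext' fun n => by simp [backFun] } 1 (by
    intro a
    simp only [LinearMap.coe_mk, AddHom.coe_mk, one_mul, norm_eq]
    rw [a.summable_norm.tsum_eq_zero_add]
    simp [backFun])

lemma norm_shift_le : ‖shift‖ ≤ 1 := LinearMap.mkContinuous_norm_le _ zero_le_one _
lemma norm_back_le : ‖back‖ ≤ 1 := LinearMap.mkContinuous_norm_le _ zero_le_one _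

@[simp] lemma shift_zero (a : L1) : shift a 0 = 0 := by
  change shiftFun a 0 = 0
  simp [shiftFun]
@[simp] lemma shift_succ (a : L1) (n : ℕ) : shift a (n + 1) = a n := by
  change shiftFun a (n + 1) = a n
  simp [shiftFun]
@[simp] lemma back_apply (a : L1) (n : ℕ) : back a n = a (n + 1) := rfl

lemma norm_pow_le {V : Type*} [NormedAddCommGroup V] [NormedSpace ℂ V] {A : V →L[ℂ] V}
    (hA : ‖A‖ ≤ 1) (n : ℕ) : ‖A ^ n‖ ≤ 1 := by
  induction n with
  | zero => simpa [ContinuousLinearMap.one_def] using ContinuousLinearMap.norm_id_le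
  | succ n ih =>
    rw [pow_succ]
    exact (norm_mul_le _ _).trans (mul_le_one₀ ih (norm_nonneg _) hA)

lemma back_pow_apply (a : L1) (k n : ℕ) : (back ^ k) a n = a (n + k) := by
  induction k generalizing n with
  | zero => simp
  | succ k ih => rw [pow_succ', mul_apply_eq_comp, back_apply, ih]; congr 1; omega

lemma shift_pow_apply_add (a : L1) (k n : ℕ) : (shift ^ k) a (n + k) = a n := by
  induction k generalizing n with
  | zero => simp
  | succ k ih =>
    rw [pow_succ', mul_apply_eq_comp, ← add_assoc, shift_succ, ih]

lemma shift_pow_apply_of_lt (a : L1) {k n : ℕ} (h : n < k) : (shift ^ k) a n = 0 := by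
  induction k generalizing n with
  | zero => omega
  | succ k ih =>
    rw [pow_succ', mul_apply_eq_comp]
    cases n with
    | zero => simp
    | succ n => rw [shift_succ, ih (by omega)]

/-- The unit of the convolution product. -/
def one : L1 := unit 0

lemma shift_pow_one (k n : ℕ) : (shift ^ k) one n = if n = k then 1 else 0 := by
  rcases lt_or_ge n k with h | h
  · rw [shift_pow_apply_of_lt _ h, if_neg h.ne]
  · obtain ⟨m, rfl⟩ := Nat.exists_eq_add_of_le' h
    rw [shift_pow_apply_add, one, unit_apply]; simp

lemma hasSum_shift_one (a : L1) : HasSum (fun n => a n • (shift ^ n) one) a := by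
  convert hasSum_unit a using 3 with n
  exact ext' fun m => by rw [shift_pow_one, unit_apply]

lemma summable_smul_pow {V : Type*} [NormedAddCommGroup V] [NormedSpace ℂ V] [CompleteSpace V]
    {A : V →L[ℂ] V} (hA : ‖A‖ ≤ 1) (a : L1) : Summable (fun n => a n • A ^ n) := by
  refine Summable.of_norm_bounded a.summable_norm fun n => ?_
  rw [norm_smul]
  exact mul_le_of_le_one_right (norm_nonneg _) (norm_pow_le hA n)

/-- Multiplication by the power series with coefficients `a`. -/
def mul (a : L1) : L1 →L[ℂ] L1 := ∑' n, a n • shift ^ n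

lemma hasSum_mul (a b : L1) : HasSum (fun n => a n • (shift ^ n) b) (mul a b) := by
  have := (summable_smul_pow norm_shift_le a).hasSum
  exact this.mapL (ContinuousLinearMap.apply ℂ L1 b)

lemma mul_shift_pow (a b : L1) (k : ℕ) : mul a ((shift ^ k) b) = (shift ^ k) (mul a b) := by
  refine (hasSum_mul a _).unique ?_
  convert (hasSum_mul a b).mapL (shift ^ k) using 2 with n
  rw [map_smul, ← mul_apply_eq_comp, ← mul_apply_eq_comp, ← pow_add,
    ← pow_add, add_comm]

lemma mul_one_right (a : L1) : mul a one = a := (hasSum_mul a one).unique (hasSum_shift_one a)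

lemma mul_comm' (a b : L1) : mul a b = mul b a := by
  have h := (hasSum_shift_one b).mapL (mul a)
  simp only [map_smul, mul_shift_pow, mul_one_right] at h
  exact h.unique (hasSum_mul b a)

lemma mul_shift (a b : L1) : mul a (shift b) = shift (mul a b) := by
  simpa using mul_shift_pow a b 1

/-- The value at `z` of the power series with coefficients `a`. -/
def val (a : L1) (z : ℂ) : ℂ := ∑' n, a n * z ^ n

lemma norm_term_le (a : L1) {z : ℂ} (hz : z ∈ closedBall (0 : ℂ) 1) (n : ℕ) :
    ‖a n * z ^ n‖ ≤ ‖a n‖ := by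
  rw [norm_mul, norm_pow]
  exact mul_le_of_le_one_right (norm_nonneg _) (pow_le_one₀ (norm_nonneg _) (by simpa using hz))

lemma hasSum_val (a : L1) {z : ℂ} (hz : z ∈ closedBall (0 : ℂ) 1) :
    HasSum (fun n => a n * z ^ n) (val a z) :=
  (Summable.of_norm_bounded a.summable_norm (a.norm_term_le hz)).hasSum

lemma norm_val_le (a : L1) {z : ℂ} (hz : z ∈ closedBall (0 : ℂ) 1) : ‖val a z‖ ≤ ‖a‖ := by
  rw [norm_eq]
  exact tsum_of_norm_bounded a.summable_norm.hasSum (a.norm_term_le hz)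

lemma continuousOn_val (a : L1) : ContinuousOn (val a) (closedBall 0 1) :=
  continuousOn_tsum (fun n => by fun_prop) a.summable_norm fun n _ hz => a.norm_term_le hz n

lemma differentiableOn_val (a : L1) : DifferentiableOn ℂ (val a) (ball 0 1) :=
  Complex.differentiableOn_tsum_of_summable_norm a.summable_norm (fun n => by fun_prop) isOpen_ball
    fun n _ hz => a.norm_term_le (ball_subset_closedBall hz) n

lemma taylorCoeff_val (a : L1) (n : ℕ) : taylorCoeff (val a) n = a n :=
  taylorCoeff_eq_of_hasSum (fun _ hz => a.hasSum_val (ball_subset_closedBall hz)) n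

/-- Evaluation as a continuous linear map. -/
def valL (z : ℂ) (hz : z ∈ closedBall (0 : ℂ) 1) : L1 →L[ℂ] ℂ :=
  LinearMap.mkContinuous
    { toFun := fun a => val a z
      map_add' := fun a b => (((a.hasSum_val hz).add (b.hasSum_val hz)).congr_fun
          (fun n => by simp [add_mul])).tsum_eq
      map_smul' := fun c a => (((a.hasSum_val hz).mul_left c).congr_fun
          (fun n => by simp [mul_assoc])).tsum_eq } 1 (by
    intro a; rw [one_mul]; exact a.norm_val_le hz)

lemma valL_apply (z : ℂ) (hz : z ∈ closedBall (0 : ℂ) 1) (a : L1) : valL z hz a = val a z := rfl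

lemma val_shift (a : L1) {z : ℂ} (hz : z ∈ closedBall (0 : ℂ) 1) :
    val (shift a) z = z * val a z := by
  rw [val, ((shift a).hasSum_val hz).summable.tsum_eq_zero_add, val, ← tsum_mul_left]
  simp [pow_succ', mul_left_comm]

lemma val_shift_pow (a : L1) {z : ℂ} (hz : z ∈ closedBall (0 : ℂ) 1) (k : ℕ) :
    val ((shift ^ k) a) z = z ^ k * val a z := by
  induction k with
  | zero => simp
  | succ k ih => rw [pow_succ', mul_apply_eq_comp, val_shift _ hz, ih]; ring

lemma val_mul (a b : L1) {z : ℂ} (hz : z ∈ closedBall (0 : ℂ) 1) :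
    val (mul a b) z = val a z * val b z := by
  have h := (hasSum_mul a b).mapL (valL z hz)
  simp only [map_smul, valL_apply, val_shift_pow _ hz, smul_eq_mul] at h
  refine h.unique ?_
  simpa only [mul_assoc] using (a.hasSum_val hz).mul_right (val b z)

lemma shift_sub_injective {z : ℂ} {a : L1} (h : shift a = z • a) : a = 0 := by
  have h' : ∀ n, shift a n = z * a n := fun n => by rw [h]; simp
  have key : ∀ n, a n = 0 := by
    rcases eq_or_ne z 0 with rfl | hz
    · intro n; simpa using h' (n + 1)
    · intro n
      induction n with
      | zero => simpa [hz] using h' 0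
      | succ n ih => simpa [hz, ih] using h' (n + 1)
  exact ext' (by simpa using key)

end L1

namespace L1

lemma shift_back (g : L1) : shift (back g) = g - g 0 • one := by
  refine ext' fun n => ?_
  cases n with
  | zero => simp [one, unit_apply]
  | succ n => simp [one, unit_apply]

/-- The quotient of `g - g(z)` by the coordinate function minus `z`. -/
def dq (g : L1) (z : ℂ) : L1 := ∑' j : ℕ, z ^ j • (back ^ (j + 1)) g

lemma norm_dq_term_le (g : L1) (z : ℂ) (j : ℕ) :
    ‖z ^ j • (back ^ (j + 1)) g‖ ≤ ‖z‖ ^ j * ‖g‖ := by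
  rw [norm_smul, norm_pow]
  gcongr
  exact ((back ^ (j + 1)).le_opNorm g).trans
    (mul_le_of_le_one_left (norm_nonneg _) (norm_pow_le norm_back_le _))

lemma hasSum_dq (g : L1) {z : ℂ} (hz : ‖z‖ < 1) :
    HasSum (fun j : ℕ => z ^ j • (back ^ (j + 1)) g) (dq g z) :=
  (Summable.of_norm_bounded ((summable_geometric_of_lt_one (norm_nonneg _) hz).mul_right _)
    (norm_dq_term_le g z)).hasSum

lemma norm_dq_le (g : L1) {z : ℂ} (hz : ‖z‖ < 1) : ‖dq g z‖ ≤ ‖g‖ / (1 - ‖z‖) := by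
  rw [div_eq_inv_mul]
  exact tsum_of_norm_bounded ((hasSum_geometric_of_lt_one (norm_nonneg _) hz).mul_right _)
    (norm_dq_term_le g z)

lemma shift_dq (g : L1) {z : ℂ} (hz : ‖z‖ < 1) :
    shift (dq g z) = z • dq g z + g - val g z • one := by
  have h1 := (hasSum_dq g hz).mapL shift
  have hv := (hasSum_val g (z := z) (by simpa using hz.le)).smul_const one
  have h2 := (hasSum_dq g hz).const_smul z
  have h4 : HasSum (fun j : ℕ => z ^ j • (back ^ j) g) (g + z • dq g z) := by
    rw [← hasSum_nat_add_iff' 1]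
    simp only [Finset.sum_range_one, pow_zero, one_smul, one_apply_eq_self,
      add_sub_cancel_left]
    refine h2.congr_fun fun j => ?_
    rw [smul_smul, pow_succ']
  have h5 := h4.sub hv
  refine h1.unique ?_
  rw [add_comm (z • dq g z)]
  refine h5.congr_fun fun j => ?_
  rw [map_smul, pow_succ', mul_apply_eq_comp, shift_back, back_pow_apply, zero_add, smul_sub,
    smul_smul, mul_comm (z ^ j)]

lemma differentiableOn_dq (Φ : L1 →L[ℂ] ℂ) (g : L1) :
    DifferentiableOn ℂ (fun z => Φ (dq g z)) (ball 0 1) := by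
  intro z hz
  obtain ⟨r, hr, hr1⟩ := exists_between (show ‖z‖ < 1 by simpa using hz)
  have hr0 : 0 ≤ r := (norm_nonneg z).trans hr.le
  have h := Complex.differentiableOn_tsum_of_summable_norm (U := ball (0 : ℂ) r)
    (F := fun (j : ℕ) (z : ℂ) => Φ (z ^ j • (back ^ (j + 1)) g))
    (u := fun j => ‖Φ‖ * (r ^ j * ‖g‖))
    (((summable_geometric_of_lt_one hr0 hr1).mul_right _).mul_left _)
    (fun j => by simp only [map_smul]; fun_prop) isOpen_ball (fun j w hw => by
      refine (Φ.le_opNorm _).trans ?_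
      gcongr
      refine (norm_dq_term_le g w j).trans ?_
      gcongr
      exact (show ‖w‖ < r by simpa using hw).le)
  have h' := (h z (by simpa using hr)).differentiableAt (isOpen_ball.mem_nhds (by simpa using hr))
  refine (h'.congr_of_eventuallyEq ?_).differentiableWithinAt
  filter_upwards [isOpen_ball.mem_nhds hz] with w hw
  exact ((hasSum_dq g (by simpa using hw)).mapL Φ).tsum_eq.symm

lemma mul_dq_sub (f g : L1) {z : ℂ} (hz : ‖z‖ < 1) :
    mul f (dq g z) - mul g (dq f z) = val f z • dq g z - val g z • dq f z := by
  rw [← sub_eq_zero]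
  refine shift_sub_injective (z := z) ?_
  simp only [map_sub, map_smul, ← mul_shift, shift_dq _ hz, map_add, mul_one_right,
    smul_sub, smul_add, mul_comm' f g, smul_smul, mul_comm z]
  rw [mul_comm (val f z) (val g z)]
  abel

variable (N : Submodule ℂ L1)

lemma shift_pow_mem {N : Submodule ℂ L1} (hT : ∀ a ∈ N, shift a ∈ N) {a : L1} (ha : a ∈ N) (n : ℕ) :
    (shift ^ n) a ∈ N := by
  induction n with
  | zero => simpa
  | succ n ih => rw [pow_succ', mul_apply_eq_comp]; exact hT _ ih

lemma mul_mem {N : Submodule ℂ L1} (hc : IsClosed (N : Set L1)) (hT : ∀ a ∈ N, shift a ∈ N)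
    {a : L1} (ha : a ∈ N) (b : L1) : mul b a ∈ N :=
  hc.mem_of_tendsto (hasSum_mul b a) (Eventually.of_forall fun _ =>
    N.sum_mem fun i _ => N.smul_mem _ (shift_pow_mem hT ha i))

/-- The operator induced by the shift on the quotient by an invariant subspace. -/
def quotShift (hT : ∀ a ∈ N, shift a ∈ N) : (L1 ⧸ N) →L[ℂ] (L1 ⧸ N) :=
  N.liftQL (N.mkQL ∘L shift) (fun a ha => by
    simpa [Submodule.Quotient.mk_eq_zero] using hT a ha)

lemma quotShift_mk (hT : ∀ a ∈ N, shift a ∈ N) (a : L1) :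
    quotShift N hT (N.mkQL a) = N.mkQL (shift a) := by
  simp [quotShift]

lemma norm_quotShift_le (hc : IsClosed (N : Set L1)) (hT : ∀ a ∈ N, shift a ∈ N) :
    have := hc
    ‖quotShift N hT‖ ≤ 1 := by
  have := hc
  refine ContinuousLinearMap.opNorm_le_bound _ zero_le_one fun x => ?_
  refine le_of_forall_pos_lt_add fun ε hε => ?_
  obtain ⟨a, rfl, ha⟩ := Submodule.Quotient.norm_mk_lt x hε
  have h1 : quotShift N hT (Submodule.Quotient.mk a) = Submodule.Quotient.mk (shift a) :=
    quotShift_mk N hT a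
  rw [h1, one_mul]
  refine ((Submodule.Quotient.norm_mk_le (S := N) (shift a)).trans ?_).trans_lt ha
  exact (shift.le_opNorm a).trans (mul_le_of_le_one_left (norm_nonneg _) norm_shift_le)

section Quotient

variable {V : Type*} [NormedAddCommGroup V] [NormedSpace ℂ V]
  {π : L1 →L[ℂ] V} {T : V →L[ℂ] V}

lemma pow_apply_of_semiconj (hTπ : ∀ b, T (π b) = π (shift b)) (b : L1) (n : ℕ) :
    (T ^ n) (π b) = π ((shift ^ n) b) := by
  induction n with
  | zero => simp
  | succ n ih => rw [pow_succ', mul_apply_eq_comp, ih, hTπ, pow_succ', mul_apply_eq_comp]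

lemma resolvent_apply_eq {z : ℂ} (hz : z ∈ resolventSet ℂ T) {x y : V} (hxy : z • y - T y = x) :
    resolvent T z x = y := by
  have h1 : resolvent T z * (algebraMap ℂ _ z - T) = 1 := by
    rw [spectrum.resolvent_eq hz]; exact hz.unit.inv_mul
  have h2 := congrArg (fun A : V →L[ℂ] V => A y) h1
  rw [Algebra.algebraMap_eq_smul_one] at h2
  rw [← hxy]
  exact h2

lemma resolvent_mul_val (hTπ : ∀ b, T (π b) = π (shift b)) (Ψ : V →L[ℂ] ℂ) (a : L1) {z : ℂ}
    (hz : z ∈ resolventSet ℂ T) (hz1 : ‖z‖ < 1) {g : L1} (hg : ∀ b, π (mul b g) = 0) :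
    Ψ (resolvent T z (π a)) * val g z
      = val a z * Ψ (π (dq g z)) - val g z * Ψ (π (dq a z)) := by
  have h1 : resolvent T z (val g z • π a) = π (mul a (dq g z)) := by
    refine resolvent_apply_eq hz ?_
    rw [hTπ, ← sub_eq_zero, ← map_smul π, ← map_smul π, ← map_sub π, ← map_sub π, ← mul_shift,
      shift_dq _ hz1]
    have : z • mul a (dq g z) - mul a (z • dq g z + g - val g z • one) - val g z • a
        = - mul a g := by
      simp only [map_sub, map_add, map_smul, mul_one_right]; abel
    rw [this, map_neg, hg, neg_zero]
  have h2 := congrArg Ψ h1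
  rw [map_smul, map_smul] at h2
  have h3 := congrArg (fun b => Ψ (π b)) (mul_dq_sub a g hz1)
  simp only [map_sub, map_smul, mul_comm' g, hg, map_zero, smul_eq_mul] at h2 h3
  linear_combination h2 + h3

variable [CompleteSpace V]

lemma mem_resolventSet_of_val_ne_zero (hTn : ‖T‖ ≤ 1) (hTπ : ∀ b, T (π b) = π (shift b))
    (hπ : Function.Surjective π) {z : ℂ} (hz : z ∈ closedBall (0 : ℂ) 1) {g : L1}
    (hg : ∀ b, π (mul b g) = 0) (hgz : val g z ≠ 0) :
    z ∈ resolventSet ℂ T := by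
  by_contra hmem
  have hspec : z ∈ spectrum ℂ T := hmem
  let p : ℕ → Polynomial ℂ := fun n => ∑ i ∈ Finset.range n, Polynomial.C (g i) * Polynomial.X ^ i
  have hbound : ∀ n, ‖(p n).eval z‖ ≤ ‖Polynomial.aeval T (p n)‖ * ‖(1 : V →L[ℂ] V)‖ :=
    fun n => spectrum.norm_le_norm_mul_of_mem
      (spectrum.subset_polynomial_aeval T (p n) ⟨z, hspec, rfl⟩)
  have h1 : Tendsto (fun n => (p n).eval z) atTop (nhds (val g z)) := by
    simpa [p, Polynomial.eval_finsetSum] using (hasSum_val g hz).tendsto_sum_nat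
  have h0 : ∑' n, g n • T ^ n = 0 := by
    refine ContinuousLinearMap.ext fun x => ?_
    obtain ⟨a, rfl⟩ := hπ x
    have e1 := (summable_smul_pow hTn g).hasSum.mapL (ContinuousLinearMap.apply ℂ _ (π a))
    have e2 := (hasSum_mul g a).mapL π
    have e3 := e1.unique (e2.congr_fun fun n => by
      simp only [ContinuousLinearMap.apply_apply, map_smul]
      rw [pow_apply_of_semiconj hTπ])
    rw [mul_comm', hg] at e3
    exact e3
  have h2 : Tendsto (fun n => Polynomial.aeval T (p n)) atTop (nhds 0) := by
    rw [← h0]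
    refine (summable_smul_pow hTn g).hasSum.tendsto_sum_nat.congr fun n => ?_
    simp [p, map_sum, Algebra.smul_def]
  have h3 := le_of_tendsto_of_tendsto' h1.norm (h2.norm.mul_const _) hbound
  rw [norm_zero, zero_mul] at h3
  exact hgz (norm_le_zero_iff.1 h3)

lemma mem_resolventSet_of_one_lt_norm (hTn : ‖T‖ ≤ 1) {z : ℂ} (hz : 1 < ‖z‖) :
    z ∈ resolventSet ℂ T := by
  refine spectrum.mem_resolventSet_of_norm_lt_mul (lt_of_le_of_lt ?_ hz)
  exact mul_le_one₀ hTn (norm_nonneg _) ContinuousLinearMap.norm_id_le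

lemma hasSum_resolvent_apply (hTn : ‖T‖ ≤ 1) {z : ℂ} (hz : 1 < ‖z‖) (x : V) :
    HasSum (fun n : ℕ => (z ^ (n + 1))⁻¹ • (T ^ n) x) (resolvent T z x) := by
  have hz0 : z ≠ 0 := norm_pos_iff.1 (zero_lt_one.trans hz)
  have hs : Summable (fun n : ℕ => (z ^ (n + 1))⁻¹ • (T ^ n) x) := by
    refine Summable.of_norm_bounded ((summable_geometric_of_lt_one (r := ‖z‖⁻¹) (by positivity)
      (inv_lt_one_of_one_lt₀ hz)).mul_right (‖z‖⁻¹ * ‖x‖)) fun n => ?_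
    rw [norm_smul, norm_inv, norm_pow, pow_succ, mul_inv, ← inv_pow, mul_assoc]
    gcongr
    exact ((T ^ n).le_opNorm _).trans (mul_le_of_le_one_left (norm_nonneg _) (norm_pow_le hTn n))
  rw [resolvent_apply_eq (mem_resolventSet_of_one_lt_norm hTn hz) (y := ∑' n : ℕ,
    (z ^ (n + 1))⁻¹ • (T ^ n) x)]
  · exact hs.hasSum
  have e1 := hs.hasSum.const_smul z
  have e2 := hs.hasSum.mapL T
  rw [← hasSum_nat_add_iff' 1] at e1
  simp only [Finset.sum_range_one, zero_add, pow_one, pow_zero, one_apply_eq_self,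
    smul_smul, mul_inv_cancel₀ hz0, one_smul] at e1
  have e3 := e1.unique (e2.congr_fun fun n => by
    rw [map_smul, ← mul_apply_eq_comp, ← pow_succ']
    congr 1
    field_simp
    ring)
  rw [← e3]; abel

lemma exists_resolvent_aux (hTn : ‖T‖ ≤ 1) (hTπ : ∀ b, T (π b) = π (shift b))
    (hπ : Function.Surjective π) (Ψ : V →L[ℂ] ℂ) (a : L1) :
    ∃ (U : Set ℂ) (F : ℂ → ℂ), IsOpen U ∧ DifferentiableOn ℂ F U ∧ (∀ z, 1 < ‖z‖ → z ∈ U) ∧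
      (∀ z, ‖z‖ = 1 → (∃ g, (∀ b, π (mul b g) = 0) ∧ val g z ≠ 0) → z ∈ U) ∧
      (∀ z, 1 < ‖z‖ → HasSum (fun n => Ψ (π ((shift ^ n) a)) / z ^ (n + 1)) (F z)) ∧
      ∀ z ∈ U, ‖z‖ < 1 → ∀ g, (∀ b, π (mul b g) = 0) →
        F z * val g z = val a z * Ψ (π (dq g z)) - val g z * Ψ (π (dq a z)) := by
  refine ⟨resolventSet ℂ T, fun z => Ψ (resolvent T z (π a)), spectrum.isOpen_resolventSet T,
    ?_, fun z => mem_resolventSet_of_one_lt_norm hTn, ?_, ?_, ?_⟩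
  · intro z hz
    have h := (spectrum.hasDerivAt_resolvent_const_left hz).differentiableAt
    have h2 := ((Ψ ∘L ContinuousLinearMap.apply ℂ _ (π a)).differentiableAt.comp z h)
    exact h2.differentiableWithinAt
  · rintro z hz ⟨g, hg, hgz⟩
    exact mem_resolventSet_of_val_ne_zero hTn hTπ hπ (by simp [hz]) hg hgz
  · intro z hz
    refine ((hasSum_resolvent_apply hTn hz (π a)).mapL Ψ).congr_fun fun n => ?_
    rw [map_smul, pow_apply_of_semiconj hTπ, smul_eq_mul, div_eq_inv_mul]
  · intro z hz hz1 g hg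
    exact resolvent_mul_val hTπ Ψ a hz hz1 hg

end Quotient

lemma exists_resolvent (hc : IsClosed (N : Set L1)) (hT : ∀ a ∈ N, shift a ∈ N) (Φ : L1 →L[ℂ] ℂ)
    (hΦ : ∀ a ∈ N, Φ a = 0) (a : L1) :
    ∃ (U : Set ℂ) (F : ℂ → ℂ), IsOpen U ∧ DifferentiableOn ℂ F U ∧ (∀ z, 1 < ‖z‖ → z ∈ U) ∧
      (∀ z, ‖z‖ = 1 → (∃ g ∈ N, val g z ≠ 0) → z ∈ U) ∧
      (∀ z, 1 < ‖z‖ → HasSum (fun n => Φ ((shift ^ n) a) / z ^ (n + 1)) (F z)) ∧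
      ∀ z ∈ U, ‖z‖ < 1 → ∀ g ∈ N,
        F z * val g z = val a z * Φ (dq g z) - val g z * Φ (dq a z) := by
  have := hc
  have hN : ∀ g ∈ N, ∀ b, N.mkQL (mul b g) = 0 := fun g hg b => by
    rw [Submodule.mkQL_apply, Submodule.mkQ_apply, Submodule.Quotient.mk_eq_zero]
    exact mul_mem hc hT hg b
  have hΨ : ∀ b, N.liftQL Φ (fun b hb => hΦ b hb) (N.mkQL b) = Φ b := fun b => by
    exact Submodule.liftQ_apply N (Φ : L1 →ₗ[ℂ] ℂ) b
  obtain ⟨U, F, h1, h2, h3, h4, h5, h6⟩ := exists_resolvent_aux (norm_quotShift_le N hc hT)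
    (quotShift_mk N hT) N.mkQ_surjective (N.liftQL Φ (fun b hb => hΦ b hb)) a
  simp only [hΨ] at h5 h6
  exact ⟨U, F, h1, h2, h3, fun z hz ⟨g, hg, hgz⟩ => h4 z hz ⟨g, hN g hg, hgz⟩, h5,
    fun z hz hz1 g hg => h6 z hz hz1 g (hN g hg)⟩

end L1

/-! ### The Wiener algebra -/

lemma norm_zpow_of_mem_sphere {z : ℂ} (hz : z ∈ sphere (0 : ℂ) 1) (n : ℤ) : ‖z ^ n‖ = 1 := by
  rw [norm_zpow, show ‖z‖ = 1 by simpa using hz, one_zpow]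

lemma integral_exp_int_mul (n : ℤ) :
    ∫ θ in (0:ℝ)..(2 * Real.pi), Complex.exp ((n : ℂ) * (θ : ℂ) * Complex.I) =
      if n = 0 then (2 * Real.pi : ℂ) else 0 := by
  split_ifs with h
  · simp [h]
  · have hn : (n : ℂ) * Complex.I ≠ 0 := by simp [h]
    have e : ∀ θ : ℝ, (n : ℂ) * (θ : ℂ) * Complex.I = ((n : ℂ) * Complex.I) * θ := fun θ => by ring
    simp only [e]
    rw [integral_exp_mul_complex hn]
    have : (n : ℂ) * Complex.I * ((2 * Real.pi : ℝ) : ℂ) = (n : ℂ) * (2 * Real.pi * Complex.I) := by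
      push_cast; ring
    rw [this, Complex.exp_int_mul_two_pi_mul_I]
    simp

lemma fcoeff_eq_of_hasSum {f : ℂ → ℂ} {c : ℤ → ℂ} (hc : Summable (fun n => ‖c n‖))
    (h : ∀ z ∈ sphere (0 : ℂ) 1, HasSum (fun n => c n * z ^ n) (f z)) (n : ℤ) :
    fcoeff f n = c n := by
  have hs : ∀ θ : ℝ, Complex.exp ((θ : ℂ) * Complex.I) ∈ sphere (0 : ℂ) 1 := fun θ => by
    simp [Complex.norm_exp_ofReal_mul_I]
  have h1 : HasSum (fun m : ℤ => ∫ θ in (0:ℝ)..(2 * Real.pi),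
      c m * Complex.exp (((m - n : ℤ) : ℂ) * (θ : ℂ) * Complex.I))
      (∫ θ in (0:ℝ)..(2 * Real.pi), f (Complex.exp ((θ : ℂ) * Complex.I)) *
        Complex.exp (-(n : ℂ) * (θ : ℂ) * Complex.I)) := by
    refine intervalIntegral.hasSum_integral_of_dominated_convergence (fun m _ => ‖c m‖)
      (fun m => (by fun_prop : Continuous _).aestronglyMeasurable)
      (fun m => Eventually.of_forall fun θ _ => ?_) (Eventually.of_forall fun θ _ => hc)
      (by simp) (Eventually.of_forall fun θ _ => ?_)
    · have : ((m - n : ℤ) : ℂ) * (θ : ℂ) * Complex.I =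
          ((((m - n : ℤ) : ℝ) * θ : ℝ) : ℂ) * Complex.I := by
        push_cast; ring
      rw [norm_mul, this, Complex.norm_exp_ofReal_mul_I, mul_one]
    · refine ((h _ (hs θ)).mul_right _).congr_fun fun m => ?_
      rw [← Complex.exp_int_mul, mul_assoc (c m), ← Complex.exp_add]
      congr 2
      push_cast; ring
  have h2 : ∀ m : ℤ, (∫ θ in (0:ℝ)..(2 * Real.pi),
      c m * Complex.exp (((m - n : ℤ) : ℂ) * (θ : ℂ) * Complex.I))
      = if m = n then c n * (2 * Real.pi) else 0 := fun m => by
    rw [intervalIntegral.integral_const_mul, integral_exp_int_mul]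
    simp only [sub_eq_zero]
    split_ifs with hmn <;> simp [hmn]
  simp only [h2] at h1
  have h3 := h1.unique (hasSum_ite_eq n _)
  rw [fcoeff, h3]
  have : (Real.pi : ℂ) ≠ 0 := by exact_mod_cast Real.pi_ne_zero
  field_simp

/-- Being represented on the circle by an absolutely convergent Fourier series. -/
def HasFSeries (f : ℂ → ℂ) (c : ℤ → ℂ) : Prop :=
  Summable (fun n => ‖c n‖) ∧ ∀ z ∈ sphere (0 : ℂ) 1, HasSum (fun n => c n * z ^ n) (f z)

namespace HasFSeries

variable {f g : ℂ → ℂ} {c d : ℤ → ℂ}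

lemma fcoeff_eq (h : HasFSeries f c) : fcoeff f = c := funext (fcoeff_eq_of_hasSum h.1 h.2)

lemma mem (h : HasFSeries f c) : f ∈ WienerAlg := by
  change HasFSeries f (fcoeff f)
  rwa [h.fcoeff_eq]

lemma add (hf : HasFSeries f c) (hg : HasFSeries g d) : HasFSeries (f + g) (c + d) :=
  ⟨(hf.1.add hg.1).of_nonneg_of_le (fun _ => norm_nonneg _) fun _ => norm_add_le _ _,
    fun z hz => ((hf.2 z hz).add (hg.2 z hz)).congr_fun fun n => by simp [add_mul]⟩

lemma sub (hf : HasFSeries f c) (hg : HasFSeries g d) : HasFSeries (f - g) (c - d) :=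
  ⟨(hf.1.add hg.1).of_nonneg_of_le (fun _ => norm_nonneg _) fun _ => norm_sub_le _ _,
    fun z hz => ((hf.2 z hz).sub (hg.2 z hz)).congr_fun fun n => by simp [sub_mul]⟩

/-- The reindexing `(k, m) ↦ (m, k - m)`. -/
def shear : ℤ × ℤ ≃ ℤ × ℤ where
  toFun p := (p.2, p.1 - p.2)
  invFun p := (p.1 + p.2, p.1)
  left_inv p := by ext <;> simp
  right_inv p := by ext <;> simp

lemma shear_apply (p : ℤ × ℤ) : shear p = (p.2, p.1 - p.2) := rfl

lemma mul (hf : HasFSeries f c) (hg : HasFSeries g d) :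
    HasFSeries (f * g) (fun k => ∑' m, c m * d (k - m)) := by
  have h0' : Summable (fun p : ℤ × ℤ => ‖c p.1‖ * ‖d p.2‖) := by
    have := summable_mul_of_summable_norm (f := fun n => ‖c n‖) (g := fun n => ‖d n‖)
      (by simpa using hf.1) (by simpa using hg.1)
    exact this
  have h0 : Summable (fun p : ℤ × ℤ => ‖c p.2‖ * ‖d (p.1 - p.2)‖) := by
    have := shear.summable_iff.2 h0'
    simpa only [Function.comp_def, shear_apply] using this
  have h1 : ∀ k, Summable (fun m => ‖c m * d (k - m)‖) := fun k => by
    simpa only [norm_mul] using h0.prod_factor k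
  have h2 : Summable (fun k => ∑' m, ‖c m‖ * ‖d (k - m)‖) := h0.prod
  have h3 : ∀ k, ‖∑' m, c m * d (k - m)‖ ≤ ∑' m, ‖c m‖ * ‖d (k - m)‖ := fun k => by
    have := norm_tsum_le_tsum_norm (h1 k)
    simp only [norm_mul] at this
    exact this
  have h4 : Summable (fun k => ‖∑' m, c m * d (k - m)‖) :=
    Summable.of_nonneg_of_le (fun _ => norm_nonneg _) h3 h2
  refine ⟨h4, fun z hz => ?_⟩
  have hz0 : z ≠ 0 := by rintro rfl; simp at hz
  have n1 : Summable (fun n => ‖c n * z ^ n‖) := by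
    simpa only [norm_mul, norm_zpow_of_mem_sphere hz, mul_one] using hf.1
  have n2 : Summable (fun n => ‖d n * z ^ n‖) := by
    simpa only [norm_mul, norm_zpow_of_mem_sphere hz, mul_one] using hg.1
  have n3 : Summable (fun p : ℤ × ℤ => (c p.1 * z ^ p.1) * (d p.2 * z ^ p.2)) := by
    have := summable_mul_of_summable_norm n1 n2
    exact this
  have e : HasSum (fun p : ℤ × ℤ => (c p.1 * z ^ p.1) * (d p.2 * z ^ p.2)) (f z * g z) := by
    have := HasSum.mul (hf.2 z hz) (hg.2 z hz) n3
    exact this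
  have e1 : HasSum (fun p : ℤ × ℤ => (c p.2 * z ^ p.2) * (d (p.1 - p.2) * z ^ (p.1 - p.2)))
      (f z * g z) := by
    have := shear.hasSum_iff.2 e
    simpa only [Function.comp_def, shear_apply] using this
  have e2 : ∀ k : ℤ, HasSum (fun m => (c m * z ^ m) * (d (k - m) * z ^ (k - m)))
      ((∑' m, c m * d (k - m)) * z ^ k) := fun k => by
    have q1 : HasSum (fun m => c m * d (k - m)) (∑' m, c m * d (k - m)) := (h1 k).of_norm.hasSum
    have q2 : (fun m => (c m * z ^ m) * (d (k - m) * z ^ (k - m))) =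
        fun m => c m * d (k - m) * z ^ k := by
      funext m
      have : z ^ k = z ^ m * z ^ (k - m) := by rw [← zpow_add₀ hz0]; congr 1; ring
      rw [this]; ring
    rw [q2]
    exact q1.mul_right (z ^ k)
  exact e1.prod_fiberwise e2

end HasFSeries

lemma hasFSeries_of_mem {f : ℂ → ℂ} (hf : f ∈ WienerAlg) : HasFSeries f (fcoeff f) := hf

lemma L1.hasFSeries {f : ℂ → ℂ} {a : L1}
    (h : ∀ z ∈ closedBall (0 : ℂ) 1, f z = L1.val a z) :
    HasFSeries f (fun n => if 0 ≤ n then a n.toNat else 0) := by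
  have hinj : Function.Injective (fun n : ℕ => (n : ℤ)) := Nat.cast_injective
  have hsupp : ∀ x ∉ Set.range (fun n : ℕ => (n : ℤ)), ¬ (0 ≤ x) := fun x hx hx0 =>
    hx ⟨x.toNat, Int.toNat_of_nonneg hx0⟩
  constructor
  · rw [← hinj.summable_iff (fun x hx => by simp [hsupp x hx])]
    simpa [Function.comp_def] using a.summable_norm
  · intro z hz
    have hz' := sphere_subset_closedBall hz
    rw [← hinj.hasSum_iff (fun x hx => by simp [hsupp x hx]), h z hz']
    simpa [Function.comp_def] using a.hasSum_val hz'

namespace L1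

/-- The coordinate functionals. -/
def coordL (n : ℕ) : L1 →L[ℂ] ℂ :=
  LinearMap.mkContinuous
    { toFun := fun a => a n
      map_add' := fun _ _ => rfl
      map_smul' := fun _ _ => rfl } 1 fun a => by
    rw [one_mul, norm_eq]
    exact a.summable_norm.le_tsum n fun _ _ => norm_nonneg _

lemma coordL_apply (n : ℕ) (a : L1) : coordL n a = a n := rfl

end L1

lemma summable_norm_cut {c : ℤ → ℂ} (hc : Summable (fun n => ‖c n‖)) (k : ℤ) :
    Summable (fun n : ℕ => ‖c (n - k)‖) :=
  hc.comp_injective (i := fun n : ℕ => (n : ℤ) - k) fun a b h => by simpa using h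

open Classical in
/-- The nonnegative part of the sequence `c` shifted by `k`. -/
def cut (c : ℤ → ℂ) (k : ℤ) : L1 :=
  if h : Summable (fun n => ‖c n‖) then
    L1.ofSummable (fun n : ℕ => c (n - k)) (summable_norm_cut h k)
  else 0

lemma cut_apply {c : ℤ → ℂ} (hc : Summable (fun n => ‖c n‖)) (k : ℤ) (n : ℕ) :
    cut c k n = c (n - k) := by
  rw [cut, dif_pos hc, L1.ofSummable_apply]

lemma norm_cut_le {c : ℤ → ℂ} (hc : Summable (fun n => ‖c n‖)) (k : ℤ) :
    ‖cut c k‖ ≤ ∑' n, ‖c n‖ := by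
  rw [L1.norm_eq]
  simp only [cut_apply hc]
  exact tsum_comp_le_tsum_of_inj hc (fun _ => norm_nonneg _)
    (i := fun n : ℕ => (n : ℤ) - k) fun a b h => by simpa using h

lemma hasSum_cut_convolution {c d : ℤ → ℂ} (hc : Summable (fun n => ‖c n‖))
    (hd : Summable (fun n => ‖d n‖))
    (hcd : Summable (fun k => ‖∑' m, c m * d (k - m)‖)) (k : ℤ) :
    HasSum (fun m => c m • cut d (k + m)) (cut (fun k => ∑' m, c m * d (k - m)) k) := by
  have hs : Summable (fun m => c m • cut d (k + m)) := by
    refine Summable.of_norm_bounded (hc.mul_right (∑' n, ‖d n‖)) fun m => ?_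
    rw [norm_smul]
    gcongr
    exact norm_cut_le hd _
  have h := hs.hasSum
  convert h
  refine L1.ext' fun n => ?_
  have h1 : HasSum (fun m => c m * d ((n - k : ℤ) - m)) ((∑' m, c m • cut d (k + m)) n) := by
    have := h.mapL (L1.coordL n)
    refine this.congr_fun fun m => ?_
    rw [map_smul, L1.coordL_apply, cut_apply hd, smul_eq_mul]
    congr 2; ring
  rw [cut_apply hcd, h1.tsum_eq]

/-- The elements of the Wiener algebra annihilated at infinity by a functional `Φ` on `ℓ¹(ℕ)`. -/
def asymptoticIdeal (Φ : L1 →L[ℂ] ℂ) : Set (ℂ → ℂ) :=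
  {f ∈ WienerAlg | Tendsto (fun k : ℤ => Φ (cut (fcoeff f) k)) atTop (nhds 0)}

lemma isClosedIdealW_asymptoticIdeal (Φ : L1 →L[ℂ] ℂ) :
    IsClosedIdealW (asymptoticIdeal Φ) := by
  refine ⟨fun f hf => hf.1, fun f hf g hg => ?_, fun f hf g hg => ?_, fun f hf h => ?_⟩
  · have F := hasFSeries_of_mem hf.1
    have G := hasFSeries_of_mem hg.1
    refine ⟨(F.add G).mem, ?_⟩
    have e : (fun k : ℤ => Φ (cut (fcoeff (f + g)) k)) =
        fun k => Φ (cut (fcoeff f) k) + Φ (cut (fcoeff g) k) := by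
      funext k
      rw [(F.add G).fcoeff_eq, ← map_add]
      congr 1
      refine L1.ext' fun n => ?_
      rw [cut_apply (F.add G).1, L1.add_apply, cut_apply F.1, cut_apply G.1]
      rfl
    rw [e]
    simpa using hf.2.add hg.2
  · have F := hasFSeries_of_mem hf
    have G := hasFSeries_of_mem hg.1
    have FG := F.mul G
    refine ⟨FG.mem, ?_⟩
    have e : (fun k : ℤ => Φ (cut (fcoeff (f * g)) k)) =
        fun k => ∑' m, fcoeff f m * Φ (cut (fcoeff g) (k + m)) := by
      funext k
      rw [FG.fcoeff_eq]
      have := (hasSum_cut_convolution F.1 G.1 FG.1 k).mapL Φ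
      simp only [map_smul, smul_eq_mul] at this
      exact this.tsum_eq.symm
    rw [e]
    have hb : Summable (fun m => ‖fcoeff f m‖ * (‖Φ‖ * ∑' n, ‖fcoeff g n‖)) := F.1.mul_right _
    have := tendsto_tsum_of_dominated_convergence (𝓕 := (atTop : Filter ℤ))
      (f := fun k m => fcoeff f m * Φ (cut (fcoeff g) (k + m))) (g := fun _ => (0 : ℂ)) hb
      (fun m => by
        have := (hg.2.comp
          (tendsto_atTop_add_const_right atTop m tendsto_id)).const_mul (fcoeff f m)
        simpa using this)
      (Eventually.of_forall fun k m => by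
        rw [norm_mul]
        gcongr
        exact (Φ.le_opNorm _).trans (by gcongr; exact norm_cut_le G.1 _))
    simpa using this
  · have F := hasFSeries_of_mem hf
    refine ⟨hf, ?_⟩
    rw [Metric.tendsto_atTop]
    intro ε hε
    obtain ⟨g, hg, hfg⟩ := h (ε / 2 / (‖Φ‖ + 1)) (by positivity)
    have G := hasFSeries_of_mem hg.1
    obtain ⟨N, hN⟩ := (Metric.tendsto_atTop.1 hg.2) (ε / 2) (by positivity)
    refine ⟨N, fun k hk => ?_⟩
    have h1 := hN k hk
    rw [dist_zero_right] at h1 ⊢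
    have e : cut (fcoeff f) k = cut (fcoeff (f - g)) k + cut (fcoeff g) k := by
      refine L1.ext' fun n => ?_
      rw [(F.sub G).fcoeff_eq, L1.add_apply, cut_apply (F.sub G).1, cut_apply F.1, cut_apply G.1]
      simp
    rw [e, map_add]
    have h2 : ‖Φ (cut (fcoeff (f - g)) k)‖ ≤ ε / 2 := by
      have : ‖cut (fcoeff (f - g)) k‖ ≤ WienerNorm (f - g) :=
        norm_cut_le (by rw [(F.sub G).fcoeff_eq]; exact (F.sub G).1) k
      calc _ ≤ ‖Φ‖ * ‖cut (fcoeff (f - g)) k‖ := Φ.le_opNorm _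
        _ ≤ (‖Φ‖ + 1) * (ε / 2 / (‖Φ‖ + 1)) := by gcongr <;> linarith
        _ = ε / 2 := by field_simp
    calc _ ≤ _ := norm_add_le _ _
      _ < ε := by linarith

lemma L1.cut_fcoeff {f : ℂ → ℂ} {a : L1} (h : ∀ z ∈ closedBall (0 : ℂ) 1, f z = L1.val a z)
    (k : ℕ) : cut (fcoeff f) k = (L1.shift ^ k) a := by
  have F := L1.hasFSeries h
  refine L1.ext' fun n => ?_
  rw [F.fcoeff_eq, cut_apply F.1]
  rcases lt_or_ge n k with hn | hn
  · rw [L1.shift_pow_apply_of_lt _ hn, if_neg (by omega)]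
  · obtain ⟨m, rfl⟩ := Nat.exists_eq_add_of_le' hn
    rw [L1.shift_pow_apply_add, if_pos (by omega)]
    congr 1
    omega

lemma tendsto_shift_of_mem_idealGenW {I : Set (ℂ → ℂ)} {Φ : L1 →L[ℂ] ℂ}
    (hI : ∀ g ∈ I, ∃ b : L1, (∀ z ∈ closedBall (0 : ℂ) 1, g z = L1.val b z) ∧
      ∀ n, Φ ((L1.shift ^ n) b) = 0)
    {f : ℂ → ℂ} (hf : f ∈ IdealGenW I) {a : L1}
    (ha : ∀ z ∈ closedBall (0 : ℂ) 1, f z = L1.val a z) :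
    Tendsto (fun n => Φ ((L1.shift ^ n) a)) atTop (nhds 0) := by
  have hIJ : I ⊆ asymptoticIdeal Φ := fun g hg => by
    obtain ⟨b, hb, h0⟩ := hI g hg
    refine ⟨(L1.hasFSeries hb).mem, tendsto_const_nhds.congr' ?_⟩
    filter_upwards [eventually_ge_atTop 0] with k hk
    lift k to ℕ using hk
    rw [L1.cut_fcoeff hb, h0]
  have := (hf _ ⟨isClosedIdealW_asymptoticIdeal Φ, hIJ⟩).2
  have := this.comp tendsto_natCast_atTop_atTop
  simpa only [Function.comp_def, L1.cut_fcoeff ha] using this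

/-! ### Radial limits of bounded analytic functions -/

lemma continuousOn_closedBall_of_diffContOnCl {Y : ℂ → ℂ} (hY : DiffContOnCl ℂ Y (ball 0 1)) :
    ContinuousOn Y (closedBall 0 1) := by
  have := hY.continuousOn
  rwa [closure_ball _ one_ne_zero] at this

lemma circleIntegrable_kernel_smul {k Y : ℂ → ℂ} (hY : ContinuousOn Y (closedBall 0 1))
    (hk : ContinuousOn k (sphere 0 1)) : CircleIntegrable (fun ζ => k ζ * Y ζ) 0 1 :=
  ContinuousOn.circleIntegrable zero_le_one (hk.mul (hY.mono sphere_subset_closedBall))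

lemma deriv_eq_circleAverage {Y : ℂ → ℂ} (hY : DiffContOnCl ℂ Y (ball 0 1)) {w : ℂ}
    (hw : w ∈ ball (0 : ℂ) 1) :
    deriv Y w = Real.circleAverage (fun ζ => ζ / (ζ - w) ^ 2 * Y ζ) 0 1 := by
  have hYc := continuousOn_closedBall_of_diffContOnCl hY
  have hYi : CircleIntegrable Y 0 1 :=
    ContinuousOn.circleIntegrable zero_le_one (hYc.mono sphere_subset_closedBall)
  have h1 := hasDerivAt_circleAverage_herglotzRieszKernel_smul hYi hw
  have h2 : (fun w => Real.circleAverage (fun ζ => herglotzRieszKernel 0 w ζ • Y ζ) 0 1) =ᶠ[nhds w]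
      fun w => 2 * Y w - Y 0 := by
    filter_upwards [isOpen_ball.mem_nhds hw] with v hv
    have hne : ∀ ζ ∈ sphere (0 : ℂ) 1, ζ - v ≠ 0 := fun ζ hζ h0 => by
      rw [sub_eq_zero] at h0; subst h0
      simp at hζ hv; linarith
    have e1 : Real.circleAverage (fun ζ => herglotzRieszKernel 0 v ζ • Y ζ) 0 1 =
        Real.circleAverage (fun ζ => 2 * (ζ / (ζ - v) * Y ζ) - Y ζ) 0 1 := by
      refine Real.circleAverage_congr_sphere fun ζ hζ => ?_
      rw [abs_one] at hζ
      have := hne ζ hζ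
      simp only [herglotzRieszKernel, sub_zero, smul_eq_mul]
      field_simp; ring
    have hk : CircleIntegrable (fun ζ => ζ / (ζ - v) * Y ζ) 0 1 :=
      circleIntegrable_kernel_smul hYc (continuousOn_id.div (by fun_prop) hne)
    have hk2 : CircleIntegrable (fun ζ => 2 * (ζ / (ζ - v) * Y ζ)) 0 1 := hk.const_mul 2
    have e2 := DiffContOnCl.circleAverage_smul_div (c := 0) (R := 1) (w := v) (f := Y)
      (by simpa using hY) (by simpa using hv)
    have e3 := DiffContOnCl.circleAverage (c := 0) (R := 1) (f := Y) (by simpa using hY)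
    have e4 := Real.circleAverage_fun_smul (a := (2 : ℂ)) (f := fun ζ => ζ / (ζ - v) * Y ζ)
      (c := 0) (R := 1)
    simp only [sub_zero, smul_eq_mul] at e2 e4
    rw [e1, Real.circleAverage_fun_sub hk2 hYi, e4, e2, e3]
  have h3 := h1.congr_of_eventuallyEq h2.symm
  have h4 : HasDerivAt (fun w => 2 * Y w - Y 0) (2 * deriv Y w) w :=
    (((hY.differentiableOn.differentiableAt
      (isOpen_ball.mem_nhds hw)).hasDerivAt).const_mul 2).sub_const _
  have h5 := h3.unique h4
  have e4 := Real.circleAverage_fun_smul (a := (2 : ℂ)) (f := fun ζ => ζ / (ζ - w) ^ 2 * Y ζ)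
      (c := 0) (R := 1)
  have e5 : (fun ζ => (2 * ζ / (ζ - w) ^ 2) • Y ζ) =
      fun ζ => (2 : ℂ) • (ζ / (ζ - w) ^ 2 * Y ζ) := by
    funext ζ; simp only [smul_eq_mul]; ring
  rw [e5, e4, smul_eq_mul] at h5
  exact (mul_left_cancel₀ two_ne_zero h5).symm

lemma deriv_eq_circleAverage_kernel {Y : ℂ → ℂ} (hY : DiffContOnCl ℂ Y (ball 0 1)) {r : ℝ}
    (hr0 : 0 < r) (hr1 : r < 1) :
    deriv Y r = Real.circleAverage
      (fun ζ => (ζ / (ζ - r) ^ 2 - ζ / (ζ - (r : ℂ)⁻¹) ^ 2) * Y ζ) 0 1 := by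
  have hYc := continuousOn_closedBall_of_diffContOnCl hY
  have hw : (r : ℂ) ∈ ball (0 : ℂ) 1 := by simpa [abs_of_pos hr0] using hr1
  have hr : 1 < r⁻¹ := (one_lt_inv₀ hr0).2 hr1
  have hne : ∀ ζ ∈ sphere (0 : ℂ) 1, ζ - r ≠ 0 := fun ζ hζ h0 => by
    rw [sub_eq_zero] at h0; subst h0
    simp at hζ hw; linarith
  have hne2 : ∀ ζ ∈ closedBall (0 : ℂ) 1, ζ - (r : ℂ)⁻¹ ≠ 0 := fun ζ hζ h0 => by
    rw [sub_eq_zero] at h0; subst h0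
    simp [abs_of_pos hr0] at hζ; linarith
  have h1 : CircleIntegrable (fun ζ => ζ / (ζ - r) ^ 2 * Y ζ) 0 1 :=
    circleIntegrable_kernel_smul hYc
      (continuousOn_id.div (by fun_prop) fun ζ hζ => pow_ne_zero _ (hne ζ hζ))
  have h2 : CircleIntegrable (fun ζ => ζ / (ζ - (r : ℂ)⁻¹) ^ 2 * Y ζ) 0 1 :=
    circleIntegrable_kernel_smul hYc
      (continuousOn_id.div (by fun_prop) fun ζ hζ =>
        pow_ne_zero _ (hne2 ζ (sphere_subset_closedBall hζ)))
  have hd : DiffContOnCl ℂ (fun ζ => ζ / (ζ - (r : ℂ)⁻¹) ^ 2 * Y ζ) (ball 0 1) := by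
    refine ⟨(differentiableOn_id.div (by fun_prop) fun ζ hζ =>
      pow_ne_zero _ (hne2 ζ (ball_subset_closedBall hζ))).mul hY.differentiableOn, ?_⟩
    rw [closure_ball _ one_ne_zero]
    exact (continuousOn_id.div (by fun_prop) fun ζ hζ => pow_ne_zero _ (hne2 ζ hζ)).mul hYc
  have e := DiffContOnCl.circleAverage (c := 0) (R := 1)
    (f := fun ζ => ζ / (ζ - (r : ℂ)⁻¹) ^ 2 * Y ζ) (by simpa using hd)
  simp only [sub_mul]
  rw [Real.circleAverage_fun_sub h1 h2, e, deriv_eq_circleAverage hY hw]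
  simp

lemma norm_kernel_le {ζ : ℂ} (hζ : ζ ∈ sphere (0 : ℂ) 1) {r : ℝ} (hr0 : 0 < r) (hr1 : r < 1) :
    ‖ζ / (ζ - r) ^ 2 - ζ / (ζ - (r : ℂ)⁻¹) ^ 2‖ ≤ 2 * (1 - r ^ 2) / ‖ζ - r‖ ^ 3 := by
  have h1 : ‖ζ‖ = 1 := by simpa using hζ
  have hrc : (r : ℂ) ≠ 0 := by exact_mod_cast hr0.ne'
  have hne : ζ - r ≠ 0 := fun h0 => by
    rw [sub_eq_zero] at h0; subst h0
    simp [abs_of_pos hr0] at h1; linarith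
  have hp : 0 < ‖ζ - r‖ := norm_pos_iff.2 hne
  have hz : ζ - (r : ℂ)⁻¹ = -(r : ℂ)⁻¹ * (1 - r * ζ) := by field_simp; ring
  have h2 : ‖1 - r * ζ‖ = ‖ζ - r‖ := by
    have hcz : ζ * (starRingEnd ℂ) ζ = 1 := by
      rw [Complex.mul_conj, Complex.normSq_eq_norm_sq, h1]; simp
    have : 1 - r * ζ = ζ * (starRingEnd ℂ) (ζ - r) := by
      rw [map_sub, mul_sub, hcz, Complex.conj_ofReal]; ring
    rw [this, norm_mul, RCLike.norm_conj, h1, one_mul]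
  have hne2 : 1 - r * ζ ≠ 0 := norm_pos_iff.1 (h2 ▸ hp)
  have e : ζ / (ζ - r) ^ 2 - ζ / (ζ - (r : ℂ)⁻¹) ^ 2 =
      ζ * (1 - r ^ 2) * ((1 - r * ζ) - r * (ζ - r)) / ((ζ - r) ^ 2 * (1 - r * ζ) ^ 2) := by
    have e' : ζ / (ζ - (r : ℂ)⁻¹) ^ 2 = ζ * r ^ 2 / (1 - r * ζ) ^ 2 := by
      rw [hz, mul_pow, neg_sq, inv_pow, div_eq_div_iff
        (mul_ne_zero (inv_ne_zero (pow_ne_zero _ hrc)) (pow_ne_zero _ hne2)) (pow_ne_zero _ hne2)]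
      field_simp
    rw [e', div_sub_div _ _ (pow_ne_zero _ hne) (pow_ne_zero _ hne2)]
    congr 1; ring
  rw [e, norm_div, norm_mul, norm_mul, h1, one_mul, norm_mul, norm_pow, norm_pow, h2]
  have h3 : ‖(1 - (r : ℂ) ^ 2)‖ = 1 - r ^ 2 := by
    rw [show (1 - (r : ℂ) ^ 2) = ((1 - r ^ 2 : ℝ) : ℂ) by push_cast; ring, Complex.norm_real,
      Real.norm_eq_abs, abs_of_nonneg (by nlinarith)]
  have h4 : ‖(1 - r * ζ) - r * (ζ - r)‖ ≤ 2 * ‖ζ - r‖ := by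
    calc _ ≤ ‖1 - r * ζ‖ + ‖r * (ζ - r)‖ := norm_sub_le _ _
      _ ≤ ‖ζ - r‖ + 1 * ‖ζ - r‖ := by
        rw [h2, norm_mul, Complex.norm_real, Real.norm_eq_abs, abs_of_pos hr0]; gcongr
      _ = _ := by ring
  rw [h3, div_le_div_iff₀ (by positivity) (by positivity)]
  have h5 : 0 ≤ 1 - r ^ 2 := by nlinarith
  calc (1 - r ^ 2) * ‖(1 - r * ζ) - r * (ζ - r)‖ * ‖ζ - r‖ ^ 3
      ≤ (1 - r ^ 2) * (2 * ‖ζ - r‖) * ‖ζ - r‖ ^ 3 := by gcongr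
    _ = _ := by ring

lemma norm_sub_one_le {ζ : ℂ} (hζ : ζ ∈ sphere (0 : ℂ) 1) {r : ℝ} (hr0 : 0 < r) (hr1 : r < 1) :
    ‖ζ - 1‖ ≤ 2 * ‖ζ - r‖ := by
  have h1 : ‖ζ‖ = 1 := by simpa using hζ
  have h2 : ‖ζ - 1‖ ≤ ‖ζ - r‖ + ‖(r : ℂ) - 1‖ := by
    simpa using norm_add_le (ζ - r) ((r : ℂ) - 1)
  have h3 : ‖(r : ℂ) - 1‖ = 1 - r := by
    rw [show (r : ℂ) - 1 = ((r - 1 : ℝ) : ℂ) by push_cast; ring, Complex.norm_real,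
      Real.norm_eq_abs, abs_sub_comm, abs_of_pos (by linarith)]
  have h4 : 1 - r ≤ ‖ζ - r‖ := by
    have := norm_sub_norm_le ζ r
    rw [h1, Complex.norm_real, Real.norm_eq_abs] at this
    rwa [abs_of_pos hr0] at this
  linarith

lemma circleAverage_poisson {r : ℝ} (hr0 : 0 < r) (hr1 : r < 1) :
    Real.circleAverage (fun ζ => (1 - r ^ 2) / ‖ζ - r‖ ^ 2) 0 1 = 1 := by
  have h := DiffContOnCl.circleAverage_poissonKernel_smul' (f := fun _ => (1 : ℂ)) (c := 0) (R := 1)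
    (w := (r : ℂ)) diffContOnCl_const (by simpa [abs_of_pos hr0] using hr1)
  have hpos : ∀ ζ ∈ sphere (0 : ℂ) 1, ‖ζ - r‖ ≠ 0 := fun ζ hζ h0 => by
    rw [norm_eq_zero, sub_eq_zero] at h0; subst h0
    simp [abs_of_pos hr0] at hζ; linarith
  have i1 : CircleIntegrable (fun ζ : ℂ => (((1 - r ^ 2) / ‖ζ - r‖ ^ 2 : ℝ) : ℂ)) 0 1 :=
    ContinuousOn.circleIntegrable zero_le_one (Complex.continuous_ofReal.comp_continuousOn
      (continuousOn_const.div (by fun_prop) fun ζ hζ => pow_ne_zero _ (hpos ζ hζ)))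
  have h2 := Complex.reCLM.circleAverage_comp_comm i1
  have e1 : (fun ζ : ℂ => (1 - r ^ 2) / ‖ζ - r‖ ^ 2) =
      Complex.reCLM ∘ fun ζ : ℂ => (((1 - r ^ 2) / ‖ζ - r‖ ^ 2 : ℝ) : ℂ) := by
    funext ζ; exact (Complex.ofReal_re _).symm
  have h3 : Real.circleAverage (fun ζ : ℂ => (((1 - r ^ 2) / ‖ζ - r‖ ^ 2 : ℝ) : ℂ)) 0 1 = 1 := by
    rw [← h]
    refine Real.circleAverage_congr_sphere fun ζ hζ => ?_
    have : ‖ζ‖ = 1 := by simpa using hζ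
    simp [this]
  rw [e1, h2, h3]
  simp

/-- Vanishing to first order at the boundary point `1` forces the radial limit of the derivative
to be zero. -/
lemma tendsto_deriv_radial {Y : ℂ → ℂ} (hY : DiffContOnCl ℂ Y (ball 0 1))
    (ho : ∀ ε > 0, ∃ δ > 0, ∀ ζ ∈ sphere (0 : ℂ) 1, ‖ζ - 1‖ < δ → ‖Y ζ‖ ≤ ε * ‖ζ - 1‖) :
    Tendsto (fun r : ℝ => deriv Y r) (nhdsWithin 1 (Iio 1)) (nhds 0) := by
  have hYc := continuousOn_closedBall_of_diffContOnCl hY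
  obtain ⟨M, hM⟩ := (isCompact_closedBall (0 : ℂ) 1).exists_bound_of_continuousOn hYc
  have hM0 : 0 ≤ M := (norm_nonneg _).trans (hM 0 (by simp))
  rw [Metric.tendsto_nhds]
  intro ε hε
  obtain ⟨δ, hδ, hδY⟩ := ho (ε / 8) (by positivity)
  have hlim : Tendsto (fun r : ℝ => 4 * (ε / 8) + 16 * M / δ ^ 3 * (1 - r ^ 2))
      (nhdsWithin 1 (Iio 1)) (nhds (4 * (ε / 8) + 16 * M / δ ^ 3 * (1 - 1 ^ 2))) :=
    (Continuous.tendsto (by fun_prop) _).mono_left nhdsWithin_le_nhds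
  have hlt := hlim.eventually (gt_mem_nhds (show _ < ε by norm_num; linarith))
  filter_upwards [hlt, self_mem_nhdsWithin,
    mem_nhdsWithin_of_mem_nhds (lt_mem_nhds (show (0 : ℝ) < 1 by norm_num))] with r h1 hr1 hr0
  rw [dist_zero_right]
  refine lt_of_le_of_lt ?_ h1
  change r < 1 at hr1
  rw [deriv_eq_circleAverage_kernel hY hr0 hr1]
  have hr2 : 0 < 1 - r ^ 2 := by nlinarith
  have hpos : ∀ ζ ∈ sphere (0 : ℂ) 1, 0 < ‖ζ - r‖ := fun ζ hζ => by
    rw [norm_pos_iff]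
    intro h0
    rw [sub_eq_zero] at h0; subst h0
    simp [abs_of_pos hr0] at hζ; linarith
  have hc : ContinuousOn (fun ζ : ℂ => 4 * (ε / 8) * ((1 - r ^ 2) / ‖ζ - r‖ ^ 2)
      + 16 * M / δ ^ 3 * (1 - r ^ 2)) (sphere 0 1) :=
    (continuousOn_const.mul (continuousOn_const.div (by fun_prop)
      fun ζ hζ => pow_ne_zero _ (hpos ζ hζ).ne')).add continuousOn_const
  have key : ∀ ζ ∈ sphere (0 : ℂ) 1,
      ‖(ζ / (ζ - r) ^ 2 - ζ / (ζ - (r : ℂ)⁻¹) ^ 2) * Y ζ‖ ≤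
      4 * (ε / 8) * ((1 - r ^ 2) / ‖ζ - r‖ ^ 2) + 16 * M / δ ^ 3 * (1 - r ^ 2) := fun ζ hζ => by
    have hp := hpos ζ hζ
    have hk := norm_kernel_le hζ hr0 hr1
    have hs := norm_sub_one_le hζ hr0 hr1
    rw [norm_mul]
    by_cases hd : ‖ζ - 1‖ < δ
    · have hy := hδY ζ hζ hd
      have : 0 ≤ 16 * M / δ ^ 3 * (1 - r ^ 2) := by positivity
      calc _ ≤ 2 * (1 - r ^ 2) / ‖ζ - r‖ ^ 3 * (ε / 8 * (2 * ‖ζ - r‖)) := by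
            gcongr; exact hy.trans (by gcongr)
        _ = 4 * (ε / 8) * ((1 - r ^ 2) / ‖ζ - r‖ ^ 2) := by field_simp; ring
        _ ≤ _ := by linarith
    · push Not at hd
      have hd2 : δ / 2 ≤ ‖ζ - r‖ := by linarith
      have : 0 ≤ 4 * (ε / 8) * ((1 - r ^ 2) / ‖ζ - r‖ ^ 2) := by positivity
      calc _ ≤ 2 * (1 - r ^ 2) / (δ / 2) ^ 3 * M := by
            gcongr
            · exact hk.trans (by gcongr)
            · exact hM ζ (sphere_subset_closedBall hζ)
        _ = 16 * M / δ ^ 3 * (1 - r ^ 2) := by field_simp; ring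
        _ ≤ _ := by linarith
  have h2 : CircleIntegrable (fun ζ : ℂ => 4 * (ε / 8) * ((1 - r ^ 2) / ‖ζ - r‖ ^ 2)
      + 16 * M / δ ^ 3 * (1 - r ^ 2)) 0 1 := ContinuousOn.circleIntegrable zero_le_one hc
  have h3 : ‖Real.circleAverage (fun ζ => (ζ / (ζ - r) ^ 2 - ζ / (ζ - (r : ℂ)⁻¹) ^ 2) * Y ζ) 0 1‖
      ≤ Real.circleAverage (fun ζ : ℂ => 4 * (ε / 8) * ((1 - r ^ 2) / ‖ζ - r‖ ^ 2)
      + 16 * M / δ ^ 3 * (1 - r ^ 2)) 0 1 := by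
    rw [Real.circleAverage, Real.circleAverage, norm_smul, Real.norm_eq_abs,
      abs_of_pos (by positivity), smul_eq_mul]
    gcongr
    refine intervalIntegral.norm_integral_le_of_norm_le Real.two_pi_pos.le
      (Eventually.of_forall fun θ _ => key _ (circleMap_mem_sphere _ zero_le_one _)) h2
  refine h3.trans (le_of_eq ?_)
  have i1 : CircleIntegrable (fun ζ : ℂ => (1 - r ^ 2) / ‖ζ - r‖ ^ 2) 0 1 :=
    ContinuousOn.circleIntegrable zero_le_one (continuousOn_const.div (by fun_prop)
      fun ζ hζ => pow_ne_zero _ (hpos ζ hζ).ne')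
  have i2 : CircleIntegrable (fun ζ : ℂ => 4 * (ε / 8) * ((1 - r ^ 2) / ‖ζ - r‖ ^ 2)) 0 1 :=
    i1.const_mul _
  have e4 := Real.circleAverage_fun_smul (a := 4 * (ε / 8))
    (f := fun ζ : ℂ => (1 - r ^ 2) / ‖ζ - r‖ ^ 2) (c := 0) (R := 1)
  simp only [smul_eq_mul] at e4
  rw [Real.circleAverage_fun_add i2 (circleIntegrable_const _ _ _), e4,
    circleAverage_poisson hr0 hr1, Real.circleAverage_const, mul_one]

/-- A bounded analytic function on the disc has radial limits almost everywhere. -/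
theorem ae_exists_radial_limit {u : ℂ → ℂ} (hu : DifferentiableOn ℂ u (ball 0 1)) {C : ℝ}
    (hC : ∀ z ∈ ball (0 : ℂ) 1, ‖u z‖ ≤ C) :
    ∀ᵐ θ : ℝ, ∃ l : ℂ, Tendsto (fun r : ℝ => u (r * Complex.exp (θ * Complex.I)))
      (nhdsWithin 1 (Iio 1)) (nhds l) := by
  obtain ⟨U, hU⟩ := hu.isExactOn_ball
  have hC0 : 0 ≤ C := (norm_nonneg _).trans (hC 0 (by simp))
  have hUL : LipschitzOnWith (⟨C, hC0⟩ : NNReal) U (ball 0 1) :=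
    (convex_ball _ _).lipschitzOnWith_of_nnnorm_hasDerivWithin_le
      (fun z hz => (hU z hz).hasDerivWithinAt) fun z hz => hC z hz
  obtain ⟨V, hV, hUV⟩ := hUL.extend_finite_dimension
  have hVU : ∀ z ∈ ball (0 : ℂ) 1, HasDerivAt V (u z) z := fun z hz =>
    (hU z hz).congr_of_eventuallyEq (by
      filter_upwards [isOpen_ball.mem_nhds hz] with w hw using (hUV hw).symm)
  have hexp : LipschitzWith 1 (fun θ : ℝ => Complex.exp (θ * Complex.I)) := by
    have h1 := lipschitzWith_circleMap 0 1
    have h2 : circleMap 0 1 = fun θ : ℝ => Complex.exp (θ * Complex.I) := by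
      funext θ; simp [circleMap]
    rw [h2] at h1
    simpa using h1
  have hG := (hV.comp hexp).ae_differentiableAt_real
  filter_upwards [hG] with θ hθ
  set e := Complex.exp (θ * Complex.I) with he
  have hen : ‖e‖ = 1 := Complex.norm_exp_ofReal_mul_I θ
  have he0 : e ≠ 0 := Complex.exp_ne_zero _
  obtain ⟨m, hm⟩ : ∃ m, HasDerivAt (fun t : ℝ => V (Complex.exp (t * Complex.I))) m θ :=
    ⟨_, hθ.hasDerivAt⟩
  set l : ℂ := -Complex.I * m with hl
  set Y : ℂ → ℂ := fun ζ => V (e * ζ) - V e - l * (ζ - 1) with hY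
  have hmem : ∀ z ∈ ball (0 : ℂ) 1, e * z ∈ ball (0 : ℂ) 1 := fun z hz => by
    simpa [hen] using hz
  have hYd : ∀ z ∈ ball (0 : ℂ) 1, HasDerivAt Y (u (e * z) * e - l) z := fun z hz => by
    have h1 : HasDerivAt (fun ζ : ℂ => e * ζ) e z := by simpa using (hasDerivAt_id z).const_mul e
    have h2 : HasDerivAt (fun ζ : ℂ => l * (ζ - 1)) l z := by
      simpa using ((hasDerivAt_id z).sub_const 1).const_mul l
    exact (((hVU _ (hmem z hz)).comp z h1).sub_const _).sub h2
  have hYc : DiffContOnCl ℂ Y (ball 0 1) := by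
    refine ⟨fun z hz => (hYd z hz).differentiableAt.differentiableWithinAt, ?_⟩
    have := hV.continuous
    exact Continuous.continuousOn (by fun_prop)
  have ho : ∀ ε > 0, ∃ δ > 0, ∀ ζ ∈ sphere (0 : ℂ) 1, ‖ζ - 1‖ < δ → ‖Y ζ‖ ≤ ε * ‖ζ - 1‖ := by
    have hlog : HasDerivAt Complex.log 1 1 := by
      simpa using Complex.hasDerivAt_log (z := 1) Complex.one_mem_slitPlane
    have hla := hlog.isLittleO
    have ha : Tendsto Complex.arg (nhds 1) (nhds 0) := by
      simpa using (Complex.continuousAt_arg Complex.one_mem_slitPlane).tendsto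
    have hma := hm.isLittleO
    intro ε hε
    obtain ⟨η, hη, hη1⟩ : ∃ η > 0, η * 2 + ‖l‖ * η ≤ ε ∧ η ≤ 1 := by
      refine ⟨min 1 (ε / (2 + ‖l‖)), by positivity, ?_, min_le_left _ _⟩
      have h1 : min 1 (ε / (2 + ‖l‖)) ≤ ε / (2 + ‖l‖) := min_le_right _ _
      have h2 : 0 < 2 + ‖l‖ := by positivity
      rw [le_div_iff₀ h2] at h1
      linarith
    have t1 : ∀ᶠ ζ in nhds (1 : ℂ), ‖Complex.log ζ - (ζ - 1)‖ ≤ η * ‖ζ - 1‖ := by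
      filter_upwards [hla.bound hη] with ζ hζ
      simpa using hζ
    have t2 : ∀ᶠ t : ℝ in nhds θ, ‖V (Complex.exp (t * Complex.I)) - V e - (t - θ) • m‖ ≤
        η * ‖t - θ‖ := hma.bound hη
    have t3 : Tendsto (fun ζ => θ + Complex.arg ζ) (nhds 1) (nhds θ) := by
      simpa using ha.const_add θ
    obtain ⟨δ, hδ, hδ1⟩ := Metric.eventually_nhds_iff.1 (t1.and (t3.eventually t2))
    refine ⟨δ, hδ, fun ζ hζ hd => ?_⟩
    have hζ1 : ‖ζ‖ = 1 := by simpa using hζ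
    obtain ⟨b1, b2⟩ := hδ1 (y := ζ) (by simpa [dist_eq_norm] using hd)
    have hlg : Complex.log ζ = Complex.arg ζ * Complex.I := by
      simp [Complex.log, hζ1]
    have hζe : e * ζ = Complex.exp ((θ + Complex.arg ζ : ℝ) * Complex.I) := by
      rw [Complex.ofReal_add, add_mul, Complex.exp_add, ← hlg,
        Complex.exp_log (norm_pos_iff.1 (by rw [hζ1]; exact one_pos))]
    rw [← hζe, add_sub_cancel_left] at b2
    have hlm : (Complex.arg ζ) • m = l * Complex.log ζ := by
      rw [hlg, hl, Complex.real_smul]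
      linear_combination ((Complex.arg ζ) * m : ℂ) * Complex.I_sq
    have hYe : Y ζ = (V (e * ζ) - V e - (Complex.arg ζ) • m) +
        l * (Complex.log ζ - (ζ - 1)) := by
      rw [hlm, hY]; ring
    have hargle : ‖Complex.arg ζ‖ ≤ 2 * ‖ζ - 1‖ := by
      have e1 : ‖Complex.arg ζ‖ = ‖Complex.log ζ‖ := by simp [hlg]
      rw [e1]
      calc ‖Complex.log ζ‖ ≤ ‖Complex.log ζ - (ζ - 1)‖ + ‖ζ - 1‖ := by
            simpa using norm_add_le (Complex.log ζ - (ζ - 1)) (ζ - 1)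
        _ ≤ 1 * ‖ζ - 1‖ + ‖ζ - 1‖ := by
            gcongr; exact b1.trans (by gcongr; exact hη1.2)
        _ = _ := by ring
    rw [hYe]
    calc _ ≤ ‖V (e * ζ) - V e - (Complex.arg ζ) • m‖ + ‖l * (Complex.log ζ - (ζ - 1))‖ :=
          norm_add_le _ _
      _ ≤ η * (2 * ‖ζ - 1‖) + ‖l‖ * (η * ‖ζ - 1‖) := by
          rw [norm_mul]; gcongr; exact b2.trans (by gcongr)
      _ = (η * 2 + ‖l‖ * η) * ‖ζ - 1‖ := by ring
      _ ≤ _ := by gcongr; exact hη1.1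
  have hlim := tendsto_deriv_radial hYc ho
  refine ⟨l / e, ?_⟩
  have h2 : Tendsto (fun r : ℝ => (deriv Y r + l) / e) (nhdsWithin 1 (Iio 1)) (nhds (l / e)) := by
    simpa using (hlim.add_const l).div_const e
  refine h2.congr' ?_
  filter_upwards [self_mem_nhdsWithin,
    mem_nhdsWithin_of_mem_nhds (lt_mem_nhds (show (0 : ℝ) < 1 by norm_num))] with r hr1 hr0
  rw [(hYd r (by simpa [abs_of_pos hr0] using hr1)).deriv]
  rw [mul_comm (r : ℂ) e]
  field_simp; ring

/-! ### The Hardy space `H²` as a sequence space -/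

/-- The Hardy space, realised as `ℓ²(ℕ)`. -/
abbrev H2 : Type := lp (fun _ : ℕ => ℂ) 2

namespace H2

lemma hasSum_sq (x : H2) : HasSum (fun n => ‖x n‖ ^ 2) (‖x‖ ^ 2) := by
  have := lp.hasSum_norm (p := 2) (by simp) x
  simpa using this

lemma memlp_of_sq {a : ℕ → ℂ} (h : Summable fun n => ‖a n‖ ^ 2) : Memℓp a 2 :=
  (memℓp_gen_iff (by simp)).2 (by simpa using h)

/-- The element of `H2` with given square summable coefficients. -/
def ofSq (a : ℕ → ℂ) (h : Summable fun n => ‖a n‖ ^ 2) : H2 := ⟨a, memlp_of_sq h⟩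

lemma ofSq_apply (a : ℕ → ℂ) (h : Summable fun n => ‖a n‖ ^ 2) (n : ℕ) : ofSq a h n = a n := rfl

lemma norm_apply_le (x : H2) (n : ℕ) : ‖x n‖ ≤ ‖x‖ := lp.norm_apply_le_norm (by simp) x n

/-- The function represented by an element of `H2`. -/
def val (x : H2) (z : ℂ) : ℂ := ∑' n, x n * z ^ n

lemma norm_term_le (x : H2) (z : ℂ) (n : ℕ) : ‖x n * z ^ n‖ ≤ ‖x‖ * ‖z‖ ^ n := by
  rw [norm_mul, norm_pow]; gcongr; exact norm_apply_le x n

lemma summable_val (x : H2) {z : ℂ} (hz : z ∈ ball (0 : ℂ) 1) :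
    Summable (fun n => ‖x n * z ^ n‖) :=
  Summable.of_nonneg_of_le (fun _ => norm_nonneg _) (norm_term_le x z)
    ((summable_geometric_of_lt_one (norm_nonneg z) (by simpa using hz)).mul_left _)

lemma hasSum_val (x : H2) {z : ℂ} (hz : z ∈ ball (0 : ℂ) 1) :
    HasSum (fun n => x n * z ^ n) (val x z) := (summable_val x hz).of_norm.hasSum

lemma norm_val_le (x : H2) {z : ℂ} (hz : z ∈ ball (0 : ℂ) 1) : ‖val x z‖ ≤ (1 - ‖z‖)⁻¹ * ‖x‖ := by
  have h1 : ‖z‖ < 1 := by simpa using hz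
  refine tsum_of_norm_bounded ?_ (norm_term_le x z)
  rw [mul_comm]
  exact (hasSum_geometric_of_lt_one (norm_nonneg z) h1).mul_left _

/-- Evaluation at a point of the disk. -/
def valL (z : ℂ) (hz : z ∈ ball (0 : ℂ) 1) : H2 →L[ℂ] ℂ :=
  LinearMap.mkContinuous
    { toFun := fun x => val x z
      map_add' := fun x y => by
        refine ((hasSum_val x hz).add (hasSum_val y hz)).tsum_eq ▸ ?_
        refine tsum_congr fun n => ?_
        rw [← add_mul]; rfl
      map_smul' := fun c x => by
        refine (tsum_congr fun n => ?_).trans ((hasSum_val x hz).mul_left c).tsum_eq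
        rw [← mul_assoc]; rfl }
    (1 - ‖z‖)⁻¹ fun x => norm_val_le x hz

lemma valL_apply (z : ℂ) (hz : z ∈ ball (0 : ℂ) 1) (x : H2) : valL z hz x = val x z := rfl

lemma differentiableOn_val (x : H2) : DifferentiableOn ℂ (val x) (ball 0 1) := by
  intro z hz
  have h1 : ‖z‖ < 1 := by simpa using hz
  obtain ⟨r, hr, hr1⟩ := exists_between h1
  have hr0 : 0 ≤ r := (norm_nonneg z).trans hr.le
  have := differentiableOn_tsum_of_summable_norm (F := fun n (z : ℂ) => x n * z ^ n)
    (u := fun n => ‖x‖ * r ^ n) (U := ball (0 : ℂ) r)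
    ((summable_geometric_of_lt_one hr0 hr1).mul_left _)
    (fun n => (by fun_prop)) isOpen_ball
    (fun n w hw => (norm_term_le x w n).trans (by
      have : ‖w‖ ≤ r := by simpa using (mem_ball_zero_iff.1 hw).le
      gcongr))
  exact (this.differentiableAt (isOpen_ball.mem_nhds (by simpa using hr))).differentiableWithinAt

lemma taylorCoeff_val (x : H2) (n : ℕ) : taylorCoeff (val x) n = x n :=
  taylorCoeff_eq_of_hasSum (fun _ hz => hasSum_val x hz) n

lemma ext_val {x y : H2} (h : ∀ z ∈ ball (0 : ℂ) 1, val x z = val y z) : x = y := by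
  refine lp.ext (funext fun n => ?_)
  rw [← taylorCoeff_val x n]
  exact taylorCoeff_eq_of_hasSum (fun z hz => h z hz ▸ hasSum_val y hz) n

end H2

/-! ### Parseval's identity -/

lemma HasFSeries.conj {f : ℂ → ℂ} {c : ℤ → ℂ} (h : HasFSeries f c) :
    HasFSeries (fun z => (starRingEnd ℂ) (f z)) (fun n => (starRingEnd ℂ) (c (-n))) := by
  constructor
  · have := (Equiv.neg ℤ).summable_iff.2 h.1
    simpa [Function.comp_def] using this
  · intro z hz
    have h1 : ‖z‖ = 1 := by simpa using hz
    have h2 := (h.2 z hz).map (starRingEnd ℂ) Complex.continuous_conj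
    have h3 := (Equiv.neg ℤ).hasSum_iff.2 h2
    refine h3.congr_fun fun n => ?_
    have : (starRingEnd ℂ) z = z⁻¹ := (Complex.inv_eq_conj h1).symm
    simp [map_mul, map_zpow₀, this]

lemma hasSum_sq_circleAverage {h : ℂ → ℂ} (hh : DifferentiableOn ℂ h (ball 0 1)) {r : ℝ}
    (hr0 : 0 ≤ r) (hr1 : r < 1) :
    HasSum (fun n => ‖taylorCoeff h n‖ ^ 2 * r ^ (2 * n))
      (Real.circleAverage (fun z => ‖h z‖ ^ 2) 0 r) := by
  have hs : Summable (fun n => ‖taylorCoeff h n * (r : ℂ) ^ n‖) := by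
    obtain ⟨s, hs, hs1⟩ := exists_between hr1
    have hs0 : 0 < s := hr0.trans_lt hs
    have h1 := (hasSum_taylorCoeff hh (z := s) (by simpa [abs_of_pos hs0])).summable
    have h2 := h1.tendsto_atTop_zero.norm
    obtain ⟨B, hB⟩ := h2.bddAbove_range
    refine Summable.of_nonneg_of_le (fun _ => norm_nonneg _) (f := fun n => B * (r / s) ^ n)
      (fun n => ?_) ((summable_geometric_of_lt_one (by positivity)
        ((div_lt_one hs0).2 hs)).mul_left _)
    have h3 : ‖taylorCoeff h n * (s : ℂ) ^ n‖ ≤ B := hB ⟨n, rfl⟩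
    rw [norm_mul, norm_pow, Complex.norm_real, Real.norm_eq_abs] at h3 ⊢
    rw [abs_of_pos hs0] at h3
    rw [abs_of_nonneg hr0, div_pow]
    calc ‖taylorCoeff h n‖ * r ^ n = (‖taylorCoeff h n‖ * s ^ n) * (r ^ n / s ^ n) := by
          field_simp
      _ ≤ _ := by gcongr
  set a : L1 := L1.ofSummable _ hs with ha
  have hval : ∀ z ∈ closedBall (0 : ℂ) 1, h (r * z) = L1.val a z := fun z hz => by
    have hz' : (r * z : ℂ) ∈ ball (0 : ℂ) 1 := by
      have : ‖z‖ ≤ 1 := by simpa using hz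
      rw [mem_ball_zero_iff, norm_mul, Complex.norm_real, Real.norm_eq_abs, abs_of_nonneg hr0]
      nlinarith [norm_nonneg z]
    refine (hasSum_taylorCoeff hh hz').unique ?_
    refine (a.hasSum_val hz).congr_fun fun n => ?_
    rw [ha, L1.ofSummable_apply, mul_pow, mul_assoc]
  have hF := L1.hasFSeries (f := fun z => h (r * z)) hval
  have hP := (hF.mul hF.conj).fcoeff_eq
  have hP0 := congrFun hP 0
  have hab : Summable (fun n => ‖a n‖ ^ 2) := by
    have := a.summable_norm
    refine Summable.of_nonneg_of_le (fun _ => by positivity) (f := fun n => ‖a‖ * ‖a n‖)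
      (fun n => ?_) (this.mul_left _)
    rw [sq]; gcongr
    rw [L1.norm_eq]
    exact this.le_tsum n fun _ _ => norm_nonneg _
  have e1 : (∑' m : ℤ, (if 0 ≤ m then a m.toNat else 0) * (starRingEnd ℂ)
      (if 0 ≤ -(0 - m) then a (-(0 - m)).toNat else 0)) = ((∑' n, ‖a n‖ ^ 2 : ℝ) : ℂ) := by
    have hinj : Function.Injective (fun n : ℕ => (n : ℤ)) := Nat.cast_injective
    rw [← hinj.tsum_eq (f := fun m : ℤ => (if 0 ≤ m then a m.toNat else 0) * (starRingEnd ℂ)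
      (if 0 ≤ -(0 - m) then a (-(0 - m)).toNat else 0))]
    · rw [Complex.ofReal_tsum]
      refine tsum_congr fun n => ?_
      simp [Complex.mul_conj, Complex.normSq_eq_norm_sq]
    · intro m hm
      by_cases h0 : 0 ≤ m
      · exact ⟨m.toNat, Int.toNat_of_nonneg h0⟩
      · simp [h0] at hm
  rw [e1] at hP0
  have e2 : fcoeff ((fun z => h (r * z)) * fun z => (starRingEnd ℂ) (h (r * z))) 0 =
      ((Real.circleAverage (fun z => ‖h z‖ ^ 2) 0 r : ℝ) : ℂ) := by
    rw [fcoeff, Real.circleAverage, smul_eq_mul, Complex.ofReal_mul,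
      ← intervalIntegral.integral_ofReal]
    congr 1
    · push_cast; ring
    · refine intervalIntegral.integral_congr fun θ _ => ?_
      simp [circleMap, Complex.mul_conj, Complex.normSq_eq_norm_sq]
  rw [e2] at hP0
  have e3 : Real.circleAverage (fun z => ‖h z‖ ^ 2) 0 r = ∑' n, ‖a n‖ ^ 2 := by
    exact_mod_cast hP0
  rw [e3]
  refine hab.hasSum.congr_fun fun n => ?_
  rw [ha, L1.ofSummable_apply, norm_mul, norm_pow, Complex.norm_real, Real.norm_eq_abs,
    abs_of_nonneg hr0]
  ring

/-- Uniformly bounded quadratic means characterise membership in `H2`. -/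
lemma H2.exists_of_circleAverage_le {h : ℂ → ℂ} (hh : DifferentiableOn ℂ h (ball 0 1)) {B : ℝ}
    (hB0 : 0 ≤ B)
    (hB : ∀ r : ℝ, 0 ≤ r → r < 1 → Real.circleAverage (fun z => ‖h z‖ ^ 2) 0 r ≤ B ^ 2) :
    ∃ x : H2, (∀ z ∈ ball (0 : ℂ) 1, H2.val x z = h z) ∧ ‖x‖ ≤ B := by
  have hfin : ∀ s : Finset ℕ, ∑ n ∈ s, ‖taylorCoeff h n‖ ^ 2 ≤ B ^ 2 := fun s => by
    have hc : Tendsto (fun r : ℝ => ∑ n ∈ s, ‖taylorCoeff h n‖ ^ 2 * r ^ (2 * n))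
        (nhdsWithin 1 (Iio 1)) (nhds (∑ n ∈ s, ‖taylorCoeff h n‖ ^ 2 * 1 ^ (2 * n))) :=
      (Continuous.tendsto (by fun_prop) _).mono_left nhdsWithin_le_nhds
    simp only [one_pow, mul_one] at hc
    refine le_of_tendsto hc ?_
    filter_upwards [self_mem_nhdsWithin,
      mem_nhdsWithin_of_mem_nhds (lt_mem_nhds (show (0 : ℝ) < 1 by norm_num))] with r hr1 hr0
    refine le_trans ?_ (hB r hr0.le hr1)
    exact sum_le_hasSum s (fun _ _ => by positivity) (hasSum_sq_circleAverage hh hr0.le hr1)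
  have hsum : Summable (fun n => ‖taylorCoeff h n‖ ^ 2) :=
    summable_of_sum_le (fun _ => by positivity) hfin
  refine ⟨H2.ofSq _ hsum, fun z hz => ?_, ?_⟩
  · exact (H2.hasSum_val _ hz).unique (hasSum_taylorCoeff hh hz)
  · refine (sq_le_sq₀ (norm_nonneg _) hB0).1 ?_
    exact hasSum_le_of_sum_le (H2.hasSum_sq _) hfin

lemma H2.circleAverage_sq_le (x : H2) {r : ℝ} (hr0 : 0 ≤ r) (hr1 : r < 1) :
    Real.circleAverage (fun z => ‖H2.val x z‖ ^ 2) 0 r ≤ ‖x‖ ^ 2 := by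
  refine hasSum_le (fun n => ?_)
    (hasSum_sq_circleAverage (H2.differentiableOn_val x) hr0 hr1) (H2.hasSum_sq x)
  rw [H2.taylorCoeff_val]
  exact mul_le_of_le_one_right (by positivity) (pow_le_one₀ hr0 hr1.le)

lemma circleIntegrable_of_continuousOn_ball {V : Type*} [NormedAddCommGroup V]
    {h : ℂ → V} (hh : ContinuousOn h (ball 0 1)) {r : ℝ} (hr0 : 0 ≤ r) (hr1 : r < 1) :
    CircleIntegrable h 0 r :=
  ContinuousOn.circleIntegrable hr0 (hh.mono fun z hz => by
    rw [mem_sphere_zero_iff_norm] at hz; simpa [hz])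

/-- Multiplication by a bounded analytic function acts on `H2`. -/
lemma H2.exists_mul {f : ℂ → ℂ} (hf : DifferentiableOn ℂ f (ball 0 1)) {C : ℝ}
    (hC : ∀ z ∈ ball (0 : ℂ) 1, ‖f z‖ ≤ C) (x : H2) :
    ∃ y : H2, (∀ z ∈ ball (0 : ℂ) 1, H2.val y z = f z * H2.val x z) ∧ ‖y‖ ≤ C * ‖x‖ := by
  have hC0 : 0 ≤ C := (norm_nonneg _).trans (hC 0 (by simp))
  have hx := H2.differentiableOn_val x
  refine H2.exists_of_circleAverage_le (hf.mul hx) (by positivity) fun r hr0 hr1 => ?_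
  have h1 : Real.circleAverage (fun z => ‖f z * H2.val x z‖ ^ 2) 0 r ≤
      Real.circleAverage (fun z => C ^ 2 * ‖H2.val x z‖ ^ 2) 0 r := by
    refine Real.circleAverage_mono
      (circleIntegrable_of_continuousOn_ball ((hf.mul hx).continuousOn.norm.pow 2) hr0 hr1)
      (circleIntegrable_of_continuousOn_ball
        (continuousOn_const.mul (hx.continuousOn.norm.pow 2)) hr0 hr1) fun z hz => ?_
    rw [abs_of_nonneg hr0, mem_sphere_zero_iff_norm] at hz
    have := hC z (by simpa [hz])
    rw [norm_mul, mul_pow]; gcongr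
  have e4 := Real.circleAverage_fun_smul (a := C ^ 2)
    (f := fun z => ‖H2.val x z‖ ^ 2) (c := 0) (R := r)
  simp only [smul_eq_mul] at e4
  refine h1.trans ?_
  rw [e4, mul_pow]
  gcongr
  exact H2.circleAverage_sq_le x hr0 hr1

/-! ### Shift-invariant subspaces of `H²` -/

namespace H2

/-- The monomial `z ^ n`. -/
def basis (n : ℕ) : H2 := lp.single 2 n 1

lemma basis_apply (n m : ℕ) : basis n m = if m = n then 1 else 0 := by
  simp [basis, lp.single_apply, Pi.single_apply]

lemma inner_basis (n : ℕ) (x : H2) : inner ℂ (basis n) x = x n := by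
  rw [basis, lp.inner_single_left]; simp

lemma orthonormal_basis : Orthonormal ℂ basis := by
  rw [orthonormal_iff_ite]
  intro i j
  rw [inner_basis, basis_apply]

/-- The isometry of `H2` sending the monomials to a given orthonormal family. -/
def iso {w : ℕ → H2} (hw : Orthonormal ℂ w) : H2 →ₗᵢ[ℂ] H2 := hw.orthogonalFamily.linearIsometry

lemma hasSum_iso {w : ℕ → H2} (hw : Orthonormal ℂ w) (x : H2) :
    HasSum (fun n => x n • w n) (iso hw x) := by
  have := hw.orthogonalFamily.hasSum_linearIsometry x
  exact this.congr_fun fun n => by simp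

lemma iso_basis {w : ℕ → H2} (hw : Orthonormal ℂ w) (n : ℕ) : iso hw (basis n) = w n := by
  have := hw.orthogonalFamily.linearIsometry_apply_single (i := n) (1 : ℂ)
  exact this.trans (by simp)

lemma hasSum_val_iso {w : ℕ → H2} (hw : Orthonormal ℂ w) (x : H2) {z : ℂ}
    (hz : z ∈ ball (0 : ℂ) 1) : HasSum (fun n => x n * val (w n) z) (val (iso hw x) z) := by
  have := (valL z hz).hasSum (hasSum_iso hw x)
  simpa [valL_apply] using this

lemma orthonormal_basis_succ : Orthonormal ℂ (fun n => basis (n + 1)) :=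
  orthonormal_basis.comp _ (add_left_injective 1)

/-- Multiplication by `z`. -/
def shift : H2 →ₗᵢ[ℂ] H2 := iso orthonormal_basis_succ

lemma val_basis (n : ℕ) (z : ℂ) : val (basis n) z = z ^ n := by
  simp [val, basis_apply, ite_mul]

lemma val_shift (x : H2) {z : ℂ} (hz : z ∈ ball (0 : ℂ) 1) : val (shift x) z = z * val x z := by
  refine (hasSum_val_iso orthonormal_basis_succ x hz).unique ?_
  refine ((hasSum_val x hz).mul_left z).congr_fun fun n => ?_
  rw [val_basis]; ring

lemma val_zero_eq (x : H2) : val x 0 = x 0 := by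
  have := (hasSum_val x (z := 0) (by simp)).unique
    (hasSum_single 0 fun n hn => by simp [hn])
  simpa using this

lemma shift_pow_add (x : H2) (m n : ℕ) :
    (shift ^ (m + n)) x = (shift ^ m) ((shift ^ n) x) := by
  rw [pow_add]; rfl

lemma shift_pow_succ (x : H2) (n : ℕ) : (shift ^ (n + 1)) x = shift ((shift ^ n) x) := by
  rw [pow_succ']; rfl

lemma val_shift_pow (x : H2) {z : ℂ} (hz : z ∈ ball (0 : ℂ) 1) (n : ℕ) :
    val ((shift ^ n) x) z = z ^ n * val x z := by
  induction n with
  | zero => simp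
  | succ n ih =>
    rw [shift_pow_succ, val_shift _ hz, ih]; ring

lemma shift_pow_mem {M : Submodule ℂ H2} (hS : ∀ x ∈ M, shift x ∈ M) {x : H2} (hx : x ∈ M)
    (n : ℕ) : (shift ^ n) x ∈ M := by
  induction n with
  | zero => simpa
  | succ n ih =>
    rw [shift_pow_succ]; exact hS _ ih

/-- Bounded families converging pointwise on the disk converge weakly. -/
lemma tendsto_inner_of_tendsto_val {ι : Type*} {l : Filter ι} {y : ι → H2} {y0 : H2} {B : ℝ}
    (hB : ∀ᶠ i in l, ‖y i‖ ≤ B)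
    (hv : ∀ z ∈ ball (0 : ℂ) 1, Tendsto (fun i => val (y i) z) l (nhds (val y0 z))) (w : H2) :
    Tendsto (fun i => inner ℂ w (y i)) l (nhds (inner ℂ w y0)) := by
  set W : Submodule ℂ H2 := Submodule.span ℂ
    {k | ∃ z, ∃ hz : z ∈ ball (0 : ℂ) 1, k = (InnerProductSpace.toDual ℂ H2).symm (valL z hz)}
    with hW
  have hW1 : ∀ w ∈ W, Tendsto (fun i => inner ℂ w (y i)) l (nhds (inner ℂ w y0)) := by
    intro w hw
    induction hw using Submodule.span_induction with
    | mem k hk =>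
      obtain ⟨z, hz, rfl⟩ := hk
      simpa [InnerProductSpace.toDual_symm_apply, valL_apply] using hv z hz
    | zero => simp [tendsto_const_nhds]
    | add a b _ _ ha hb => simpa [inner_add_left] using ha.add hb
    | smul c a _ ha => simpa [inner_smul_left] using ha.mul_const _
  have hW2 : W.topologicalClosure = ⊤ := by
    rw [Submodule.topologicalClosure_eq_top_iff, Submodule.eq_bot_iff]
    intro x hx
    refine ext_val fun z hz => ?_
    have := (Submodule.mem_orthogonal _ _).1 hx _ (Submodule.subset_span ⟨z, hz, rfl⟩)
    rw [InnerProductSpace.toDual_symm_apply] at this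
    rw [← valL_apply z hz, this, ← valL_apply z hz, map_zero]
  have hw : w ∈ closure (W : Set H2) := by
    rw [← Submodule.topologicalClosure_coe, hW2]; trivial
  rw [Metric.tendsto_nhds]
  intro ε hε
  obtain ⟨p, hp, hpw⟩ := Metric.mem_closure_iff.1 hw (ε / (2 * (|B| + ‖y0‖ + 1))) (by positivity)
  filter_upwards [hB, Metric.tendsto_nhds.1 (hW1 p hp) (ε / 2) (by positivity)] with i h1 h2
  rw [dist_eq_norm] at h2 hpw ⊢
  have e : inner ℂ w (y i) - inner ℂ w y0 =
      inner ℂ (w - p) (y i - y0) + (inner ℂ p (y i) - inner ℂ p y0) := by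
    simp only [inner_sub_left, inner_sub_right]; ring
  rw [e]
  have h3 : ‖y i - y0‖ ≤ |B| + ‖y0‖ + 1 := by
    have := norm_sub_le (y i) y0
    have := le_abs_self B
    linarith
  have h4 : ‖inner ℂ (w - p) (y i - y0)‖ ≤ ε / 2 := by
    calc _ ≤ ‖w - p‖ * ‖y i - y0‖ := norm_inner_le_norm _ _
      _ ≤ ε / (2 * (|B| + ‖y0‖ + 1)) * (|B| + ‖y0‖ + 1) := by gcongr
      _ = ε / 2 := by field_simp
  linarith [norm_add_le (inner ℂ (w - p) (y i - y0)) (inner ℂ p (y i) - inner ℂ p y0)]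

/-- A vector orthogonal to all `z ^ n b` is orthogonal to the products `a b`. -/
lemma inner_mul_eq_zero {a b y w : H2} {B : ℝ}
    (hy : ∀ z ∈ ball (0 : ℂ) 1, val y z = val a z * val b z)
    (hB : ∀ r : ℝ, 0 < r → r < 1 → ∀ y' : H2,
      (∀ z ∈ ball (0 : ℂ) 1, val y' z = val a (r * z) * val b z) → ‖y'‖ ≤ B)
    (hw : ∀ n, inner ℂ w ((shift ^ n) b) = 0) : inner ℂ w y = 0 := by
  have hs : ∀ r : ℝ, 0 < r → r < 1 → Summable (fun n => (a n * (r : ℂ) ^ n) • (shift ^ n) b) :=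
    fun r hr0 hr1 => by
    refine Summable.of_norm (Summable.of_nonneg_of_le (fun _ => norm_nonneg _)
      (f := fun n => ‖a‖ * r ^ n * ‖b‖) (fun n => ?_)
      (((summable_geometric_of_lt_one hr0.le hr1).mul_left _).mul_right _))
    rw [norm_smul, LinearIsometry.norm_map]
    gcongr
    have := norm_term_le a r n
    rwa [Complex.norm_real, Real.norm_eq_abs, abs_of_pos hr0] at this
  set Y : ℝ → H2 := fun r => ∑' n, (a n * (r : ℂ) ^ n) • (shift ^ n) b with hY
  have hYv : ∀ r : ℝ, 0 < r → r < 1 → ∀ z ∈ ball (0 : ℂ) 1,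
      val (Y r) z = val a (r * z) * val b z := fun r hr0 hr1 z hz => by
    have h1 := (valL z hz).hasSum (hs r hr0 hr1).hasSum
    have hz' : (r * z : ℂ) ∈ ball (0 : ℂ) 1 := by
      rw [mem_ball_zero_iff] at hz ⊢
      rw [norm_mul, Complex.norm_real, Real.norm_eq_abs, abs_of_pos hr0]
      nlinarith [norm_nonneg z]
    refine h1.unique (((hasSum_val a hz').mul_right (val b z)).congr_fun fun n => ?_)
    simp only [map_smul, valL_apply, val_shift_pow b hz, smul_eq_mul]
    ring
  have hev : ∀ᶠ r : ℝ in nhdsWithin 1 (Iio 1), 0 < r ∧ r < 1 := by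
    filter_upwards [self_mem_nhdsWithin,
      mem_nhdsWithin_of_mem_nhds (lt_mem_nhds (show (0 : ℝ) < 1 by norm_num))] with r h1 h0
    exact ⟨h0, h1⟩
  have hlim := tendsto_inner_of_tendsto_val (l := nhdsWithin (1 : ℝ) (Iio 1)) (y := Y) (y0 := y)
    (B := B) (hev.mono fun r hr => hB r hr.1 hr.2 _ (hYv r hr.1 hr.2)) (fun z hz => by
      rw [hy z hz]
      have hc : ContinuousAt (val a) z :=
        ((differentiableOn_val a).differentiableAt (isOpen_ball.mem_nhds hz)).continuousAt
      have ht : Tendsto (fun r : ℝ => (r : ℂ) * z) (nhdsWithin 1 (Iio 1)) (nhds z) := by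
        have : Tendsto (fun r : ℝ => (r : ℂ) * z) (nhds 1) (nhds (((1 : ℝ) : ℂ) * z)) :=
          Continuous.tendsto (by fun_prop) _
        simp only [Complex.ofReal_one, one_mul] at this
        exact this.mono_left nhdsWithin_le_nhds
      refine ((hc.tendsto.comp ht).mul_const _).congr' ?_
      filter_upwards [hev] with r hr
      exact (hYv r hr.1 hr.2 z hz).symm) w
  refine tendsto_nhds_unique hlim (tendsto_const_nhds.congr' ?_)
  filter_upwards [hev] with r hr
  have h1 := (innerSL ℂ w).hasSum (hs r hr.1 hr.2).hasSum
  refine (h1.unique ?_).symm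
  refine hasSum_zero.congr_fun fun n => ?_
  simp [hw n]

lemma le_one_of_pow_le {t C : ℝ} (h : ∀ n : ℕ, t ^ n ≤ C) : t ≤ 1 := by
  by_contra! ht
  obtain ⟨n, hn⟩ := ((tendsto_pow_atTop_atTop_of_one_lt ht).eventually_gt_atTop C).exists
  exact absurd (h n) (not_le.2 hn)

lemma orthonormal_shift_pow {u : H2} (hu : ‖u‖ = 1)
    (ho : ∀ n, 1 ≤ n → inner ℂ u ((shift ^ n) u) = 0) :
    Orthonormal ℂ (fun n => (shift ^ n) u) := by
  refine ⟨fun n => by rw [LinearIsometry.norm_map, hu], ?_⟩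
  have key : ∀ i j : ℕ, i < j → inner ℂ ((shift ^ i) u) ((shift ^ j) u) = 0 := fun i j hij => by
    obtain ⟨d, rfl⟩ := Nat.exists_eq_add_of_lt hij
    rw [show i + d + 1 = i + (d + 1) by ring, shift_pow_add,
      LinearIsometry.inner_map_map]
    exact ho _ (by omega)
  intro i j hij
  rcases lt_or_gt_of_ne hij with h | h
  · exact key i j h
  · rw [← inner_conj_symm, key j i h, map_zero]

section Toeplitz

variable {u : H2}

lemma val_iso_shift_pow (hu : Orthonormal ℂ (fun n => (shift ^ n) u))
    (x : H2) {z : ℂ} (hz : z ∈ ball (0 : ℂ) 1) :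
    val (iso hu x) z = val u z * val x z := by
  refine (hasSum_val_iso hu x hz).unique (((hasSum_val x hz).mul_left _).congr_fun fun n => ?_)
  rw [val_shift_pow u hz]; ring

lemma norm_val_le_one (hu : Orthonormal ℂ (fun n => (shift ^ n) u))
    {z : ℂ} (hz : z ∈ ball (0 : ℂ) 1) : ‖val u z‖ ≤ 1 := by
  have hb : ‖basis 0‖ = 1 := orthonormal_basis.1 0
  refine le_one_of_pow_le (C := (1 - ‖z‖)⁻¹ * 1) fun n => ?_
  have h1 : val ((iso hu ^ n) (basis 0)) z = val u z ^ n := by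
    induction n with
    | zero => simp [val_basis]
    | succ n ih =>
      have : (iso hu ^ (n + 1)) (basis 0) = iso hu ((iso hu ^ n) (basis 0)) := by
        rw [pow_succ']; rfl
      rw [this, val_iso_shift_pow hu _ hz, ih]; ring
  rw [← norm_pow, ← h1]
  refine (norm_val_le _ hz).trans (le_of_eq ?_)
  rw [LinearIsometry.norm_map, hb]

/-- If multiplication by `u` is isometric, dividing by `u` does not increase bounds. -/
lemma norm_val_le_of_mul (hu : Orthonormal ℂ (fun n => (shift ^ n) u))
    {m k : H2} {C : ℝ} (hm : ∀ z ∈ ball (0 : ℂ) 1, ‖val m z‖ ≤ C)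
    (hk : ∀ z ∈ ball (0 : ℂ) 1, val m z = val u z * val k z)
    (h0 : ∃ z ∈ ball (0 : ℂ) 1, val u z ≠ 0) {z : ℂ} (hz : z ∈ ball (0 : ℂ) 1) :
    ‖val k z‖ ≤ C := by
  have hC0 : 0 ≤ C := (norm_nonneg _).trans (hm z hz)
  have hstep : ∀ x : H2, ∃ y : H2, (∀ z ∈ ball (0 : ℂ) 1, val y z = val k z * val x z) ∧
      ‖y‖ ≤ C * ‖x‖ := by
    intro x
    set R : Submodule ℂ H2 := LinearMap.range (iso hu).toLinearMap with hR
    have hRc : IsComplete (R : Set H2) := by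
      have := (iso hu).isometry.isUniformInducing.isComplete_range
      exact this
    have : CompleteSpace R := hRc.completeSpace_coe
    have hmem : ∀ n, (shift ^ n) m ∈ R := fun n => by
      refine ⟨(shift ^ n) k, ?_⟩
      refine ext_val fun w hw => ?_
      change val (iso hu _) w = _
      rw [val_iso_shift_pow hu _ hw, val_shift_pow _ hw, val_shift_pow _ hw, hk w hw]
      ring
    obtain ⟨y0, hy0, hy0n⟩ := exists_mul (differentiableOn_val m) hm x
    have hy0R : y0 ∈ R := by
      rw [← Submodule.orthogonal_orthogonal R, Submodule.mem_orthogonal]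
      intro w hw
      refine inner_mul_eq_zero (a := x) (b := m) (B := C * ‖x‖) (fun z hz => ?_)
        (fun r hr0 hr1 y' hy' => ?_) fun n => ?_
      · rw [hy0 z hz]; ring
      · set xr : H2 := ofSq (fun n => x n * (r : ℂ) ^ n) (by
          refine Summable.of_nonneg_of_le (fun _ => by positivity) (fun n => ?_)
            (hasSum_sq x).summable
          rw [norm_mul, mul_pow, norm_pow, Complex.norm_real, Real.norm_eq_abs, abs_of_pos hr0]
          exact mul_le_of_le_one_right (by positivity)
            (pow_le_one₀ (by positivity) (pow_le_one₀ hr0.le hr1.le))) with hxr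
        have hxn : ‖xr‖ ≤ ‖x‖ := by
          refine (sq_le_sq₀ (norm_nonneg _) (norm_nonneg _)).1 ?_
          refine hasSum_le (fun n => ?_) (hasSum_sq xr) (hasSum_sq x)
          rw [hxr, ofSq_apply, norm_mul, mul_pow, norm_pow, Complex.norm_real, Real.norm_eq_abs,
            abs_of_pos hr0]
          exact mul_le_of_le_one_right (by positivity)
            (pow_le_one₀ (by positivity) (pow_le_one₀ hr0.le hr1.le))
        have hxv : ∀ z, val xr z = val x (r * z) := fun z => by
          simp only [val, hxr, ofSq_apply, mul_pow]
          exact tsum_congr fun n => by ring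
        obtain ⟨y1, hy1, hy1n⟩ := exists_mul (differentiableOn_val m) hm xr
        have : y' = y1 := ext_val fun z hz => by
          rw [hy' z hz, hy1 z hz, hxv]; ring
        rw [this]
        exact hy1n.trans (by gcongr)
      · rw [← inner_conj_symm, (Submodule.mem_orthogonal _ _).1 hw _ (hmem n), map_zero]
    obtain ⟨y, hy⟩ := hy0R
    have hy' : iso hu y = y0 := hy
    have hyn : ‖y‖ ≤ C * ‖x‖ := by
      rw [← (iso hu).norm_map, hy']; exact hy0n
    refine ⟨y, ?_, hyn⟩
    have han : ∀ g : H2, AnalyticOnNhd ℂ (val g) (ball 0 1) := fun g =>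
      (differentiableOn_val g).analyticOnNhd isOpen_ball
    obtain ⟨z0, hz0, hz0u⟩ := h0
    have hE : ∀ᶠ z in nhds z0, val y z = val k z * val x z := by
      filter_upwards [isOpen_ball.mem_nhds hz0,
        ((han u z0 hz0).continuousAt).eventually_ne hz0u] with z hz hzu
      have e1 : val u z * val y z = val m z * val x z := by
        rw [← hy0 z hz, ← hy', val_iso_shift_pow hu _ hz]
      rw [hk z hz, mul_assoc] at e1
      exact mul_left_cancel₀ hzu e1
    exact (han y).eqOn_of_preconnected_of_eventuallyEq ((han k).mul (han x))
      (convex_ball _ _).isPreconnected hz0 hE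
  have hpow : ∀ n : ℕ, ∃ y : H2, (∀ z ∈ ball (0 : ℂ) 1, val y z = val k z ^ n) ∧ ‖y‖ ≤ C ^ n := by
    intro n
    induction n with
    | zero => exact ⟨basis 0, fun z _ => by simp [val_basis], by simp [orthonormal_basis.1 0]⟩
    | succ n ih =>
      obtain ⟨y, hy, hyn⟩ := ih
      obtain ⟨y', hy', hyn'⟩ := hstep y
      refine ⟨y', fun z hz => by rw [hy' z hz, hy z hz]; ring, hyn'.trans ?_⟩
      rw [pow_succ']; gcongr
  have hle : ∀ n : ℕ, ‖val k z‖ ^ n ≤ (1 - ‖z‖)⁻¹ * C ^ n := fun n => by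
    obtain ⟨y, hy, hyn⟩ := hpow n
    have h1 : ‖z‖ < 1 := by simpa using hz
    have h2 : 0 ≤ (1 - ‖z‖)⁻¹ := inv_nonneg.2 (by linarith)
    rw [← norm_pow, ← hy z hz]
    exact (norm_val_le _ hz).trans (by gcongr)
  rcases hC0.eq_or_lt with hC | hC
  · have := hle 1
    rw [← hC] at this ⊢
    simpa using this
  · have h3 : ‖val k z‖ / C ≤ 1 := le_one_of_pow_le (C := (1 - ‖z‖)⁻¹) fun n => by
      rw [div_pow, div_le_iff₀ (by positivity)]; exact hle n
    rwa [div_le_one hC] at h3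

end Toeplitz

end H2

namespace H2

lemma norm_apply_le_norm (x : H2) (n : ℕ) : ‖x n‖ ≤ ‖x‖ := lp.norm_apply_le_norm (by simp) x n

lemma tendsto_circleAverage_sq (u : H2) {r : ℕ → ℝ} (hr0 : ∀ j, 0 ≤ r j) (hr1 : ∀ j, r j < 1)
    (hr : Tendsto r atTop (nhds 1)) :
    Tendsto (fun j => Real.circleAverage (fun z => ‖val u z‖ ^ 2) 0 (r j)) atTop
      (nhds (‖u‖ ^ 2)) := by
  have h1 : ∀ j, Real.circleAverage (fun z => ‖val u z‖ ^ 2) 0 (r j)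
      = ∑' n, ‖u n‖ ^ 2 * r j ^ (2 * n) := fun j => by
    have := hasSum_sq_circleAverage (differentiableOn_val u) (hr0 j) (hr1 j)
    simp only [taylorCoeff_val] at this
    exact this.tsum_eq.symm
  have h2 := hasSum_sq u
  rw [← h2.tsum_eq]
  simp only [h1]
  refine tendsto_tsum_of_dominated_convergence h2.summable (fun n => ?_) (.of_forall fun j n => ?_)
  · simpa using (hr.pow (2 * n)).const_mul (‖u n‖ ^ 2)
  · rw [Real.norm_of_nonneg (mul_nonneg (sq_nonneg _) (pow_nonneg (hr0 j) _))]
    exact mul_le_of_le_one_right (sq_nonneg _) (pow_le_one₀ (hr0 j) (hr1 j).le)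

lemma norm_eq_one_of_orthonormal {u : H2} (hu : Orthonormal ℂ (fun n => (shift ^ n) u)) :
    ‖u‖ = 1 := by simpa using hu.1 0

lemma isInnerFunction_val {u : H2} (hu : Orthonormal ℂ (fun n => (shift ^ n) u)) :
    IsInnerFunction (val u) := by
  refine ⟨differentiableOn_val u, fun z hz => norm_val_le_one hu hz, ?_⟩
  set r : ℕ → ℝ := fun j => 1 - 1 / (j + 2) with hrdef
  have hr0 : ∀ j, 0 < r j := fun j => by
    have : (1 : ℝ) / (j + 2) < 1 := by
      rw [div_lt_one (by positivity)]; linarith [j.cast_nonneg (α := ℝ)]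
    simp only [hrdef]; linarith
  have hr1 : ∀ j, r j < 1 := fun j => by
    have : (0 : ℝ) < 1 / (j + 2) := by positivity
    simp only [hrdef]; linarith
  have hr : Tendsto r atTop (nhds 1) := by
    have := ((tendsto_one_div_add_atTop_nhds_zero_nat (𝕜 := ℝ)).comp
      (tendsto_add_atTop_nat 1)).const_sub 1
    rw [sub_zero] at this
    refine this.congr fun j => ?_
    simp only [hrdef, Function.comp]; push_cast; ring
  have hr' : Tendsto r atTop (nhdsWithin 1 (Iio 1)) :=
    tendsto_nhdsWithin_iff.2 ⟨hr, .of_forall hr1⟩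
  have hmem : ∀ j (θ : ℝ), (r j : ℂ) * exp (θ * I) ∈ ball (0 : ℂ) 1 := fun j θ => by
    rw [mem_ball_zero_iff, norm_mul, norm_exp_ofReal_mul_I, mul_one, norm_real,
      Real.norm_of_nonneg (hr0 j).le]
    exact hr1 j
  set h : ℕ → ℝ → ℝ := fun j θ => 1 - ‖val u (r j * exp (θ * I))‖ ^ 2 with hh
  have hcont : ∀ j, Continuous (h j) := fun j => by
    have : Continuous fun θ : ℝ => val u (r j * exp (θ * I)) :=
      (differentiableOn_val u).continuousOn.comp_continuous (by fun_prop) (hmem j)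
    fun_prop
  have hpos : ∀ j θ, 0 ≤ h j θ := fun j θ => by
    have := norm_val_le_one hu (hmem j θ)
    simp only [hh]
    have := pow_le_one₀ (n := 2) (norm_nonneg _) this
    linarith
  have hInt : ∀ j, ∫ θ in Ioc 0 (2 * Real.pi), h j θ
      = 2 * Real.pi * (1 - Real.circleAverage (fun z => ‖val u z‖ ^ 2) 0 (r j)) := fun j => by
    rw [← intervalIntegral.integral_of_le (by positivity), Real.circleAverage_def]
    simp only [hh, smul_eq_mul, circleMap_zero]
    have hc2 : Continuous fun θ : ℝ => ‖val u (r j * exp (θ * I))‖ ^ 2 := by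
      have : Continuous fun θ : ℝ => val u (r j * exp (θ * I)) :=
        (differentiableOn_val u).continuousOn.comp_continuous (by fun_prop) (hmem j)
      fun_prop
    rw [intervalIntegral.integral_sub (by simp) (hc2.intervalIntegrable _ _)]
    rw [intervalIntegral.integral_const, smul_eq_mul, mul_sub, ← mul_assoc,
      mul_inv_cancel₀ (by positivity), one_mul, sub_zero]
  have hlim : Tendsto (fun j => ∫⁻ θ in Ioc 0 (2 * Real.pi), ENNReal.ofReal (h j θ)) atTop
      (nhds 0) := by
    have h1 := (((tendsto_circleAverage_sq u (fun j => (hr0 j).le) hr1 hr).const_sub 1).const_mul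
      (2 * Real.pi))
    rw [norm_eq_one_of_orthonormal hu] at h1
    simp only [one_pow, sub_self, mul_zero] at h1
    have h2 := ENNReal.tendsto_ofReal h1
    rw [ENNReal.ofReal_zero] at h2
    refine h2.congr fun j => ?_
    rw [← hInt, ofReal_integral_eq_lintegral_ofReal]
    · exact (hcont j).integrableOn_Ioc
    · exact .of_forall (hpos j)
  have hF : ∫⁻ θ in Ioc 0 (2 * Real.pi), liminf (fun j => ENNReal.ofReal (h j θ)) atTop
      ≤ liminf (fun j => ∫⁻ θ in Ioc 0 (2 * Real.pi), ENNReal.ofReal (h j θ)) atTop :=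
    lintegral_liminf_le fun j => (hcont j).measurable.ennreal_ofReal
  rw [hlim.liminf_eq, nonpos_iff_eq_zero] at hF
  have hF := (lintegral_eq_zero_iff
    (Measurable.liminf fun j => (hcont j).measurable.ennreal_ofReal)).1 hF
  filter_upwards [hF, ae_restrict_of_ae (ae_exists_radial_limit (differentiableOn_val u)
    (fun z hz => norm_val_le_one hu hz))] with θ h1 ⟨l, hl⟩
  have h3 : Tendsto (fun j => h j θ) atTop (nhds (1 - ‖l‖ ^ 2)) :=
    (((hl.comp hr').norm).pow 2).const_sub 1
  have h4 := (ENNReal.tendsto_ofReal h3).liminf_eq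
  have h5 : ENNReal.ofReal (1 - ‖l‖ ^ 2) = 0 := by rw [← h4]; exact h1
  have h6 : 1 ≤ ‖l‖ := by
    rw [ENNReal.ofReal_eq_zero] at h5
    nlinarith [norm_nonneg l]
  have h7 : ‖l‖ ≤ 1 := le_of_tendsto ((hl.comp hr').norm) (.of_forall fun j =>
    norm_val_le_one hu (hmem j θ))
  have := hl.norm
  rwa [le_antisymm h7 h6] at this

lemma exists_bound_div_id {x : H2} (h0 : x 0 = 0) (hx : ∃ C, ∀ z ∈ ball (0 : ℂ) 1, ‖val x z‖ ≤ C) :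
    InnerDivides id (val x) := by
  obtain ⟨C, hC⟩ := hx
  have hd := differentiableOn_val x
  have hv0 : val x 0 = 0 := by rw [val_zero_eq, h0]
  have hdd : DifferentiableOn ℂ (dslope (val x) 0) (ball 0 1) :=
    (differentiableOn_dslope (isOpen_ball.mem_nhds (by simp))).2 hd
  have heq : ∀ z, val x z = z * dslope (val x) 0 z := fun z => by
    have := sub_smul_dslope (val x) 0 z
    rw [hv0] at this
    simpa using this.symm
  refine ⟨dslope (val x) 0, ⟨hdd, ?_⟩, fun z _ => heq z⟩
  obtain ⟨C', hC'⟩ := (isCompact_closedBall (0 : ℂ) (1 / 2)).exists_bound_of_continuousOn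
    (hdd.continuousOn.mono (closedBall_subset_ball (by norm_num)))
  refine ⟨max C' (2 * C), fun z hz => ?_⟩
  rcases le_or_gt ‖z‖ (1 / 2) with h | h
  · exact (hC' z (by simpa using h)).trans (le_max_left _ _)
  · refine le_trans ?_ (le_max_right _ _)
    have := hC z hz
    rw [heq, norm_mul] at this
    nlinarith [norm_nonneg (dslope (val x) 0 z)]

lemma isInnerFunction_id : IsInnerFunction id := by
  refine ⟨differentiableOn_id, fun z hz => by simpa using (mem_ball_zero_iff.1 hz).le,
    .of_forall fun θ => ?_⟩
  have : Tendsto (fun r : ℝ => |r|) (nhdsWithin 1 (Iio 1)) (nhds 1) := by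
    have := (continuous_abs (G := ℝ)).tendsto 1
    rw [abs_one] at this
    exact this.mono_left nhdsWithin_le_nhds
  refine this.congr fun r => ?_
  simp [norm_exp_ofReal_mul_I]

/-- A shift-invariant subspace of bounded functions without common inner factor is dense. -/
theorem exists_near_one (L : Submodule ℂ H2)
    (hb : ∀ x ∈ L, ∃ C, ∀ z ∈ ball (0 : ℂ) 1, ‖val x z‖ ≤ C) (hS : ∀ x ∈ L, shift x ∈ L)
    (hgcd : ∀ u, IsInnerFunction u → (∀ x ∈ L, InnerDivides u (val x)) →
      ∃ k ∈ Hinf, ∀ z ∈ ball (0 : ℂ) 1, u z * k z = 1) {ε : ℝ} (hε : 0 < ε) :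
    ∃ x ∈ L, ‖x - basis 0‖ < ε := by
  set M := L.topologicalClosure with hM
  have hMc : IsClosed (M : Set H2) := L.isClosed_topologicalClosure
  have : CompleteSpace M := hMc.completeSpace_coe
  have hLM : L ≤ M := L.le_topologicalClosure
  have hSM : ∀ x ∈ M, shift x ∈ M := fun x hx =>
    map_mem_closure shift.continuous hx hS
  set v : H2 := M.starProjection (basis 0) with hv
  have hvM : v ∈ M := Submodule.starProjection_apply_mem _ _
  have hin : ∀ w ∈ M, inner ℂ v w = w 0 := fun w hw => by
    rw [hv, Submodule.inner_starProjection_left_eq_right,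
      Submodule.starProjection_eq_self_iff.2 hw, inner_basis]
  have hsub : basis 0 - v ∈ Mᗮ := Submodule.sub_starProjection_mem_orthogonal _
  have hbv : ‖basis 0 - v‖ ^ 2 = 1 - ‖v‖ ^ 2 := by
    have h1 : inner ℂ v (basis 0 - v) = 0 := (Submodule.mem_orthogonal _ _).1 hsub v hvM
    have h2 := norm_add_sq_eq_norm_sq_add_norm_sq_of_inner_eq_zero v (basis 0 - v) h1
    rw [add_sub_cancel, show ‖basis 0‖ = 1 from orthonormal_basis.1 0] at h2
    nlinarith
  have hv0 : v ≠ 0 := by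
    intro h0
    have hall : ∀ x ∈ L, x 0 = 0 := fun x hx => by rw [← hin x (hLM hx), h0, inner_zero_left]
    obtain ⟨k, _, hk⟩ := hgcd id isInnerFunction_id fun x hx =>
      exists_bound_div_id (hall x hx) (hb x hx)
    simpa using hk 0 (by simp)
  set u : H2 := ((‖v‖ : ℂ)⁻¹) • v with hu'
  have huM : u ∈ M := M.smul_mem _ hvM
  have hnv : ‖v‖ ≠ 0 := norm_ne_zero_iff.2 hv0
  have hun : ‖u‖ = 1 := by
    rw [hu', norm_smul, norm_inv, norm_real, norm_norm, inv_mul_cancel₀ hnv]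
  have hinu : ∀ w ∈ M, w 0 = 0 → inner ℂ u w = 0 := fun w hw h0 => by
    rw [hu', inner_smul_left, hin w hw, h0, mul_zero]
  have hsz : ∀ (x : H2) (n : ℕ), 1 ≤ n → ((shift ^ n) x) 0 = 0 := fun x n hn => by
    rw [← val_zero_eq, val_shift_pow _ (by simp), zero_pow (by omega), zero_mul]
  have hu : Orthonormal ℂ (fun n => (shift ^ n) u) := orthonormal_shift_pow hun fun n hn =>
    hinu _ (shift_pow_mem hSM huM n) (hsz u n hn)
  set T := iso hu with hT
  have hTv : ∀ x : H2, ∀ z ∈ ball (0 : ℂ) 1, val (T x) z = val u z * val x z :=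
    fun x z hz => val_iso_shift_pow hu x hz
  set R : Submodule ℂ H2 := LinearMap.range T.toLinearMap with hR
  have : CompleteSpace R := by
    have : IsComplete (R : Set H2) := T.isometry.isUniformInducing.isComplete_range
    exact this.completeSpace_coe
  have hRM : R ≤ M := by
    rintro _ ⟨x, rfl⟩
    refine hMc.mem_of_tendsto (hasSum_iso hu x) (.of_forall fun s => ?_)
    exact M.sum_mem fun n _ => M.smul_mem _ (shift_pow_mem hSM huM n)
  have hLR : ∀ m ∈ L, ∃ k, m = T k := fun m hm => by
    set x := m - R.starProjection m with hx
    have hxR : x ∈ Rᗮ := Submodule.sub_starProjection_mem_orthogonal _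
    have hxM : x ∈ M := M.sub_mem (hLM hm) (hRM (Submodule.starProjection_apply_mem _ _))
    have h1 : ∀ b, inner ℂ ((shift ^ b) u) (T x) = 0 := fun b => by
      refine inner_mul_eq_zero (a := u) (b := x) (B := ‖x‖) (hTv x) (fun r hr0 hr1 y' hy' => ?_)
        fun n => ?_
      · have hmem : ∀ z ∈ ball (0 : ℂ) 1, (r : ℂ) * z ∈ ball (0 : ℂ) 1 := fun z hz => by
          rw [mem_ball_zero_iff] at hz ⊢
          rw [norm_mul, norm_real, Real.norm_of_nonneg hr0.le]
          nlinarith [norm_nonneg z]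
        obtain ⟨y, hy, hyn⟩ := exists_mul (f := fun z => val u (r * z)) (C := 1)
          ((differentiableOn_val u).comp (by fun_prop) hmem)
          (fun z hz => norm_val_le_one hu (hmem z hz)) x
        have : y' = y := ext_val fun z hz => by rw [hy z hz, hy' z hz]
        rw [this]; simpa using hyn
      · rcases le_or_gt n b with h | h
        · obtain ⟨d, rfl⟩ := Nat.exists_eq_add_of_le h
          rw [shift_pow_add, LinearIsometry.inner_map_map]
          refine (Submodule.mem_orthogonal _ _).1 hxR _ ⟨basis d, ?_⟩
          exact iso_basis hu d
        · obtain ⟨d, rfl⟩ := Nat.exists_eq_add_of_lt h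
          rw [add_assoc, shift_pow_add, LinearIsometry.inner_map_map]
          exact hinu _ (shift_pow_mem hSM hxM _) (hsz x _ (by omega))
    have h2 : x = 0 := by
      ext b
      have := h1 b
      rw [← iso_basis hu b, ← hT, LinearIsometry.inner_map_map, inner_basis] at this
      simpa using this
    have h3 : m = R.starProjection m := by rwa [hx, sub_eq_zero] at h2
    obtain ⟨k, hk⟩ : R.starProjection m ∈ R := Submodule.starProjection_apply_mem _ _
    exact ⟨k, by rw [h3, ← hk]; rfl⟩
  have hu0 : val u 0 = ‖v‖ := by
    rw [val_zero_eq]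
    change (‖v‖ : ℂ)⁻¹ * v 0 = _
    rw [← hin v hvM, inner_self_eq_norm_sq_to_K]
    have : (‖v‖ : ℂ) ≠ 0 := by exact_mod_cast hnv
    rw [sq]
    exact inv_mul_cancel_left₀ this _
  obtain ⟨k, hk, huk⟩ := hgcd (val u) (isInnerFunction_val hu) fun m hm => by
    obtain ⟨k, hk⟩ := hLR m hm
    obtain ⟨C, hC⟩ := hb m hm
    have hmk : ∀ z ∈ ball (0 : ℂ) 1, val m z = val u z * val k z := fun z hz => by
      rw [hk]; exact hTv k z hz
    refine ⟨val k, ⟨differentiableOn_val k, C, fun z hz => ?_⟩, hmk⟩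
    exact norm_val_le_of_mul hu hC hmk ⟨0, by simp, by rw [hu0]; exact_mod_cast hnv⟩ hz
  obtain ⟨hkd, C, hkC⟩ := hk
  obtain ⟨y, hy, -⟩ := exists_mul hkd hkC (basis 0)
  have hTy : T y = basis 0 := ext_val fun z hz => by
    rw [hTv y z hz, hy z hz, val_basis, pow_zero, mul_one, huk z hz]
  have hyn : ‖y‖ = 1 := by
    rw [← T.norm_map, hTy]; exact orthonormal_basis.1 0
  have hk0 : ‖k 0‖ ≤ 1 := by
    have h1 := hy 0 (by simp)
    rw [val_basis, pow_zero, mul_one, val_zero_eq] at h1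
    rw [← h1, ← hyn]
    exact norm_apply_le_norm y 0
  have hv1 : 1 ≤ ‖v‖ := by
    have h1 := congrArg norm (huk 0 (by simp))
    rw [norm_mul, hu0, norm_one, norm_real, norm_norm] at h1
    nlinarith [norm_nonneg v]
  have heq : basis 0 = v := by
    rw [← sub_eq_zero, ← norm_eq_zero]
    nlinarith [norm_nonneg (basis 0 - v)]
  have : basis 0 ∈ closure (L : Set H2) := by
    rw [← Submodule.topologicalClosure_coe, heq]; exact hvM
  obtain ⟨x, hx, hd⟩ := Metric.mem_closure_iff.1 this ε hε
  exact ⟨x, hx, by rwa [dist_comm, dist_eq_norm] at hd⟩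

end H2

lemma log_norm_le_circleAverage {X : ℂ → ℂ} {c : ℂ} {R : ℝ} (hR : 0 < R)
    (hX : AnalyticOnNhd ℂ X (closedBall c R)) (h0 : X c ≠ 0) :
    Real.log ‖X c‖ ≤ Real.circleAverage (fun z => Real.log ‖X z‖) c R := by
  have hX' : AnalyticOnNhd ℂ X (closedBall c |R|) := by rwa [abs_of_pos hR]
  rw [hX'.circleAverage_log_norm hR.ne' h0]
  have : 0 ≤ ∑ᶠ u, (MeromorphicOn.divisor X (closedBall c |R|) u : ℝ)
      * Real.log (R * ‖c - u‖⁻¹) := by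
    refine finsum_nonneg fun u => ?_
    by_cases hu : u ∈ closedBall c |R|
    · refine mul_nonneg ?_ ?_
      · exact_mod_cast MeromorphicOn.AnalyticOnNhd.divisor_nonneg hX' u
      · rw [mem_closedBall, abs_of_pos hR, dist_comm, dist_eq_norm] at hu
        rcases (norm_nonneg (c - u)).eq_or_lt with h | h
        · simp [← h]
        · exact Real.log_nonneg (by rwa [← div_eq_mul_inv, le_div_iff₀ h, one_mul])
    · rw [Function.locallyFinsuppWithin.apply_eq_zero_of_notMem _ hu]; simp
  linarith

lemma posLog_norm_le_circleAverage {X : ℂ → ℂ} {c : ℂ} {R : ℝ} (hR : 0 < R)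
    (hX : AnalyticOnNhd ℂ X (closedBall c R)) :
    Real.posLog ‖X c‖ ≤ Real.circleAverage (fun z => Real.posLog ‖X z‖) c R := by
  have hX' : MeromorphicOn X (sphere c |R|) := by
    rw [abs_of_pos hR]; exact (hX.mono sphere_subset_closedBall).meromorphicOn
  have hci := hX'.circleIntegrable_log_norm
  have hci' := hX'.circleIntegrable_posLog_norm
  rcases le_or_gt ‖X c‖ 1 with h | h
  · rw [(Real.posLog_eq_zero_iff _).2 (by rwa [abs_norm])]
    exact Real.circleAverage_nonneg_of_nonneg fun z _ => Real.posLog_nonneg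
  · rw [Real.posLog_eq_log (by rw [abs_norm]; exact h.le)]
    refine (log_norm_le_circleAverage hR hX (norm_pos_iff.1 (by linarith))).trans ?_
    exact Real.circleAverage_mono hci hci' fun z _ => le_max_right _ _

lemma posLog_le_sub_one {x : ℝ} (hx : 0 ≤ x) {y : ℝ} (hy : x ≤ 1 + y) (hy0 : 0 ≤ y) :
    Real.posLog x ≤ y := by
  rw [Real.posLog_apply]
  refine max_le hy0 ?_
  rcases hx.eq_or_lt with h | h
  · rw [← h]; simpa
  · linarith [Real.log_le_sub_one_of_pos h]

/-- Functions in the Hardy space close to `1` have small negative logarithmic means. -/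
lemma circleAverage_posLog_inv_le {x : H2} {ε : ℝ} (hε : 0 < ε) (hε2 : ε ≤ 1 / 2)
    (hx : ‖x - H2.basis 0‖ < ε) {r : ℝ} (hr0 : 0 < r) (hr1 : r < 1) :
    CircleIntegrable (fun z => Real.posLog ‖H2.val x z‖⁻¹) 0 r ∧
    Real.circleAverage (fun z => Real.posLog ‖H2.val x z‖⁻¹) 0 r ≤ 3 * ε ∧ H2.val x 0 ≠ 0 := by
  set y := x - H2.basis 0 with hy
  have hval : ∀ z ∈ ball (0 : ℂ) 1, H2.val x z = 1 + H2.val y z := fun z hz => by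
    have := (H2.valL z hz).map_sub x (H2.basis 0)
    simp only [H2.valL_apply, H2.val_basis, pow_zero] at this
    rw [hy, this]; ring
  have hsub : closedBall (0 : ℂ) r ⊆ ball 0 1 := closedBall_subset_ball hr1
  have han : AnalyticOnNhd ℂ (H2.val x) (closedBall 0 r) :=
    ((H2.differentiableOn_val x).analyticOnNhd isOpen_ball).mono hsub
  have hmer : MeromorphicOn (H2.val x) (sphere 0 |r|) := by
    rw [abs_of_pos hr0]; exact (han.mono sphere_subset_closedBall).meromorphicOn
  have i1 := hmer.circleIntegrable_log_norm
  have i2 := hmer.circleIntegrable_posLog_norm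
  have heq : (fun z => Real.posLog ‖H2.val x z‖⁻¹)
      = fun z => Real.posLog ‖H2.val x z‖ - Real.log ‖H2.val x z‖ := by
    funext z
    rw [← Real.posLog_sub_posLog_inv]; ring
  have hy0 : ‖H2.val y 0‖ ≤ ε := by
    rw [H2.val_zero_eq]; exact (H2.norm_apply_le_norm y 0).trans hx.le
  have h0' : 1 - ε ≤ ‖H2.val x 0‖ := by
    rw [hval 0 (by simp)]
    have := norm_sub_norm_le (1 : ℂ) (-H2.val y 0)
    rw [norm_one, norm_neg, sub_neg_eq_add] at this
    linarith
  have h0 : H2.val x 0 ≠ 0 := norm_pos_iff.1 (by linarith)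
  refine ⟨?_, ?_, h0⟩
  · rw [heq]; exact i2.sub i1
  rw [heq, Real.circleAverage_fun_sub i2 i1]
  have a1 := log_norm_le_circleAverage hr0 han h0
  have a2 : -(2 * ε) ≤ Real.log ‖H2.val x 0‖ := by
    have h1 : Real.log (1 - ε) ≤ Real.log ‖H2.val x 0‖ := Real.log_le_log (by linarith) h0'
    have h2 := Real.one_sub_inv_le_log_of_pos (x := 1 - ε) (by linarith)
    have h3 : (1 - ε)⁻¹ ≤ 1 + 2 * ε := by
      rw [inv_le_iff_one_le_mul₀ (by linarith)]; nlinarith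
    linarith
  have i3 : CircleIntegrable (fun z => ‖H2.val y z‖ ^ 2) 0 r := by
    refine circleIntegrable_of_continuousOn_ball ?_ hr0.le hr1
    exact ((H2.differentiableOn_val y).continuousOn.norm).pow 2
  have a3 : Real.circleAverage (fun z => Real.posLog ‖H2.val x z‖) 0 r
      ≤ Real.circleAverage (fun z => ε / 2 + (1 / (2 * ε)) * ‖H2.val y z‖ ^ 2) 0 r := by
    have i4 : CircleIntegrable (fun z => ε / 2 + (1 / (2 * ε)) * ‖H2.val y z‖ ^ 2) 0 r := by
      have i5 : CircleIntegrable (fun z => (1 / (2 * ε)) * ‖H2.val y z‖ ^ 2) 0 r := i3.const_mul _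
      exact (circleIntegrable_const _ _ _).add i5
    refine Real.circleAverage_mono i2 i4 fun z hz => ?_
    rw [abs_of_pos hr0] at hz
    have hzb := hsub (sphere_subset_closedBall hz)
    have h1 : Real.posLog ‖H2.val x z‖ ≤ ‖H2.val y z‖ := by
      refine posLog_le_sub_one (norm_nonneg _) ?_ (norm_nonneg _)
      rw [hval z hzb]
      exact (norm_add_le _ _).trans (by simp)
    refine h1.trans ?_
    have : ε / 2 + 1 / (2 * ε) * ‖H2.val y z‖ ^ 2 - ‖H2.val y z‖
        = (‖H2.val y z‖ - ε) ^ 2 / (2 * ε) := by field_simp; ring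
    have h2 : 0 ≤ (‖H2.val y z‖ - ε) ^ 2 / (2 * ε) := by positivity
    linarith
  have a4 : Real.circleAverage (fun z => ε / 2 + (1 / (2 * ε)) * ‖H2.val y z‖ ^ 2) 0 r ≤ ε := by
    have i5 : CircleIntegrable (fun z => (1 / (2 * ε)) * ‖H2.val y z‖ ^ 2) 0 r := i3.const_mul _
    rw [Real.circleAverage_fun_add (circleIntegrable_const _ _ _) i5, Real.circleAverage_const]
    have h1 := Real.circleAverage_fun_smul (a := 1 / (2 * ε)) (f := fun z => ‖H2.val y z‖ ^ 2)
      (c := 0) (R := r)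
    simp only [smul_eq_mul] at h1
    rw [h1]
    have h2 : Real.circleAverage (fun z => ‖H2.val y z‖ ^ 2) 0 r ≤ ε ^ 2 := by
      refine (H2.circleAverage_sq_le y hr0.le hr1).trans ?_
      exact pow_le_pow_left₀ (norm_nonneg _) hx.le 2
    have h3 : 1 / (2 * ε) * Real.circleAverage (fun z => ‖H2.val y z‖ ^ 2) 0 r
      ≤ 1 / (2 * ε) * ε ^ 2 := mul_le_mul_of_nonneg_left h2 (by positivity)
    have h4 : 1 / (2 * ε) * ε ^ 2 = ε / 2 := by field_simp
    linarith
  linarith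

/-- A growth condition in the disc: up to small logarithmic means, `F` has order of growth `1`
at the boundary. -/
def LogGrowth (F : ℂ → ℂ) : Prop :=
  ∀ ε > 0, ∃ C : ℝ, ∃ W : ℂ → ENNReal, Measurable W ∧
    (∀ r : ℝ, 0 < r → r < 1 →
      ∫⁻ θ in Ioo (-Real.pi) Real.pi, W (r * exp (θ * I)) ≤ ENNReal.ofReal ε) ∧
    ∀ᵐ z, z ∈ ball (0 : ℂ) 1 →
      ENNReal.ofReal (Real.posLog ‖F z‖) ≤ ENNReal.ofReal (Real.posLog (C / (1 - ‖z‖))) + W z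

lemma integral_pi_eq_circleAverage (g : ℂ → ℝ) (r : ℝ) :
    ∫ θ in (-Real.pi)..Real.pi, g (r * exp (θ * I)) = 2 * Real.pi * Real.circleAverage g 0 r := by
  have hp : Function.Periodic (fun θ : ℝ => g (r * exp (θ * I))) (2 * Real.pi) := fun θ => by
    simp only
    congr 2
    push_cast
    rw [add_mul, exp_periodic]
  have := hp.intervalIntegral_add_eq (-Real.pi) 0
  rw [show -Real.pi + 2 * Real.pi = Real.pi by ring, zero_add] at this
  rw [this, Real.circleAverage_def, smul_eq_mul, ← mul_assoc, mul_inv_cancel₀ (by positivity),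
    one_mul]
  simp [circleMap_zero]

lemma LogGrowth.of_hardy {F : ℂ → ℂ}
    (h : ∀ ε > 0, ∃ x : H2, ‖x - H2.basis 0‖ < ε ∧
      ∃ C : ℝ, ∀ z ∈ ball (0 : ℂ) 1, ‖H2.val x z * F z‖ ≤ C / (1 - ‖z‖)) : LogGrowth F := by
  classical
  intro ε hε
  set ε' := min (1 / 2) (ε / (6 * Real.pi)) with hε'
  have he0 : 0 < ε' := by positivity
  obtain ⟨x, hx, C, hC⟩ := h ε' he0
  have hcont := (H2.differentiableOn_val x).continuousOn
  have hmeas : Measurable ((ball (0 : ℂ) 1).piecewise (H2.val x) 1) :=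
    hcont.measurable_piecewise continuousOn_const measurableSet_ball
  refine ⟨C, fun z => ENNReal.ofReal (Real.posLog ‖(ball (0 : ℂ) 1).piecewise (H2.val x) 1 z‖⁻¹),
    ?_, fun r hr0 hr1 => ?_, ?_⟩
  · have := Real.continuous_posLog.measurable
    fun_prop
  · obtain ⟨hi, hle, -⟩ := circleAverage_posLog_inv_le he0 (min_le_left _ _) hx hr0 hr1
    have hmem : ∀ θ : ℝ, (r : ℂ) * exp (θ * I) ∈ ball (0 : ℂ) 1 := fun θ => by
      rw [mem_ball_zero_iff, norm_mul, norm_exp_ofReal_mul_I, mul_one, norm_real,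
        Real.norm_of_nonneg hr0.le]
      exact hr1
    simp only [piecewise_eq_of_mem _ _ _ (hmem _)]
    rw [restrict_Ioo_eq_restrict_Ioc, ← ofReal_integral_eq_lintegral_ofReal]
    · apply ENNReal.ofReal_le_ofReal
      rw [← intervalIntegral.integral_of_le (by linarith [Real.pi_pos]),
        integral_pi_eq_circleAverage (fun z => Real.posLog ‖H2.val x z‖⁻¹)]
      calc _ ≤ 2 * Real.pi * (3 * ε') := by gcongr
        _ ≤ 2 * Real.pi * (3 * (ε / (6 * Real.pi))) := by
          gcongr; exact min_le_right _ _
        _ = ε := by field_simp; ring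
    · have hp : Function.Periodic (fun θ : ℝ => Real.posLog ‖H2.val x (r * exp (θ * I))‖⁻¹)
          (2 * Real.pi) := fun θ => by
        simp only
        congr 4
        push_cast
        rw [add_mul, exp_periodic]
      have h1 : IntervalIntegrable (fun θ : ℝ => Real.posLog ‖H2.val x (r * exp (θ * I))‖⁻¹)
          volume 0 (0 + 2 * Real.pi) := by
        have := hi
        simp only [CircleIntegrable, circleMap_zero] at this
        simpa using this
      have h2 := hp.intervalIntegrable Real.two_pi_pos.ne' h1 (-Real.pi) Real.pi
      exact (intervalIntegrable_iff_integrableOn_Ioc_of_le (by linarith [Real.pi_pos])).1 h2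
    · exact .of_forall fun θ => Real.posLog_nonneg
  · obtain ⟨-, -, h0⟩ := circleAverage_posLog_inv_le he0 (min_le_left _ _) hx
      (r := 1 / 2) (by norm_num) (by norm_num)
    have han : AnalyticOnNhd ℂ (H2.val x) (ball 0 1) :=
      (H2.differentiableOn_val x).analyticOnNhd isOpen_ball
    have hcd := han.preimage_zero_mem_codiscreteWithin h0 (by simp)
      (isConnected_ball (x := (0 : ℂ)) one_pos)
    have hae := ae_restrict_le_codiscreteWithin (μ := volume)
      (measurableSet_ball (x := (0 : ℂ)) (ε := 1)) hcd
    have hae' := (ae_restrict_iff' measurableSet_ball).1 hae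
    filter_upwards [hae'] with z hz hzb
    have hz0 : H2.val x z ≠ 0 := hz hzb
    rw [piecewise_eq_of_mem _ _ _ hzb, ← ENNReal.ofReal_add Real.posLog_nonneg Real.posLog_nonneg]
    apply ENNReal.ofReal_le_ofReal
    have h1 : ‖F z‖ = ‖H2.val x z * F z‖ * ‖H2.val x z‖⁻¹ := by
      rw [norm_mul]
      have := norm_ne_zero_iff.2 hz0
      field_simp
    rw [h1]
    refine Real.posLog_mul.trans (add_le_add_left
      (Real.posLog_le_posLog (norm_nonneg _) (hC z hzb)) _)

/-- A `C¹` convex-concave ramp with derivative `rampDeriv`. -/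
def ramp (δ x : ℝ) : ℝ := ((max (x - δ) 0) ^ 2 - (max (x - 2 * δ) 0) ^ 2) / (2 * δ)

def rampDeriv (δ x : ℝ) : ℝ := (max (x - δ) 0 - max (x - 2 * δ) 0) / δ

section ramp
variable {δ : ℝ}

lemma continuous_ramp : Continuous (ramp δ) := by unfold ramp; fun_prop

lemma ramp_eq_zero {x : ℝ} (hx : x ≤ δ) (hδ : 0 < δ) : ramp δ x = 0 := by
  simp [ramp, max_eq_right (by linarith : x - δ ≤ 0), max_eq_right (by linarith : x - 2 * δ ≤ 0)]

lemma rampDeriv_eq_zero {x : ℝ} (hx : x ≤ δ) (hδ : 0 < δ) : rampDeriv δ x = 0 := by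
  simp [rampDeriv, max_eq_right (by linarith : x - δ ≤ 0),
    max_eq_right (by linarith : x - 2 * δ ≤ 0)]

lemma ramp_of_ge {x : ℝ} (hx : 2 * δ ≤ x) (hδ : 0 < δ) : ramp δ x = x - 3 * δ / 2 := by
  rw [ramp, max_eq_left (by linarith), max_eq_left (by linarith)]
  field_simp; ring

lemma rampDeriv_of_ge {x : ℝ} (hx : 2 * δ ≤ x) (hδ : 0 < δ) : rampDeriv δ x = 1 := by
  rw [rampDeriv, max_eq_left (by linarith), max_eq_left (by linarith)]
  field_simp; ring

lemma rampDeriv_nonneg (hδ : 0 < δ) (x : ℝ) : 0 ≤ rampDeriv δ x := by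
  refine div_nonneg ?_ hδ.le
  have : max (x - 2 * δ) 0 ≤ max (x - δ) 0 := max_le_max_right 0 (by linarith)
  linarith

lemma ramp_mono (hδ : 0 < δ) : Monotone (ramp δ) := by
  intro x y hxy
  rw [ramp, ramp]
  refine div_le_div_of_nonneg_right ?_ (by positivity)
  rcases le_total (x - δ) 0 with h1 | h1 <;> rcases le_total (x - 2 * δ) 0 with h2 | h2 <;>
  rcases le_total (y - δ) 0 with h3 | h3 <;> rcases le_total (y - 2 * δ) 0 with h4 | h4 <;>
  simp only [max_eq_left, max_eq_right, h1, h2, h3, h4] <;> nlinarith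

lemma ramp_nonneg (hδ : 0 < δ) (x : ℝ) : 0 ≤ ramp δ x := by
  rw [← ramp_eq_zero (min_le_right x δ) hδ]
  exact ramp_mono hδ (min_le_left x δ)

lemma ramp_le (hδ : 0 < δ) {x : ℝ} (hx : 0 ≤ x) : ramp δ x ≤ x := by
  rcases le_total x (2 * δ) with h | h
  · rw [ramp, max_eq_right (by linarith : x - 2 * δ ≤ 0), div_le_iff₀ (by positivity)]
    rcases le_total (x - δ) 0 with h1 | h1
    · rw [max_eq_right h1]; nlinarith
    · rw [max_eq_left h1]; nlinarith
  · rw [ramp_of_ge h hδ]; linarith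

lemma ramp_add_le (hδ : 0 < δ) (a t : ℝ) :
    ramp δ (a + t) ≤ ramp δ a + rampDeriv δ a * t + t ^ 2 / (2 * δ) := by
  have up : ∀ b : ℝ, (max (b + t) 0) ^ 2 ≤ (max b 0) ^ 2 + 2 * t * max b 0 + t ^ 2 := fun b => by
    rcases le_total b 0 with h | h <;> rcases le_total (b + t) 0 with h' | h' <;>
    simp only [max_eq_left, max_eq_right, h, h'] <;> nlinarith
  have lo : ∀ b : ℝ, (max b 0) ^ 2 + 2 * t * max b 0 ≤ (max (b + t) 0) ^ 2 := fun b => by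
    rcases le_total b 0 with h | h <;> rcases le_total (b + t) 0 with h' | h' <;>
    simp only [max_eq_left, max_eq_right, h, h'] <;> nlinarith [sq_nonneg t]
  have h1 := up (a - δ)
  have h2 := lo (a - 2 * δ)
  rw [ramp, ramp, rampDeriv, show a + t - δ = a - δ + t by ring,
    show a + t - 2 * δ = a - 2 * δ + t by ring]
  have : (max (a - δ) 0 ^ 2 - max (a - 2 * δ) 0 ^ 2) / (2 * δ) +
      (max (a - δ) 0 - max (a - 2 * δ) 0) / δ * t + t ^ 2 / (2 * δ)
      = (max (a - δ) 0 ^ 2 - max (a - 2 * δ) 0 ^ 2 +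
        2 * t * (max (a - δ) 0 - max (a - 2 * δ) 0) + t ^ 2) / (2 * δ) := by
    field_simp
  rw [this]
  refine div_le_div_of_nonneg_right ?_ (by positivity)
  linarith

lemma ramp_add_eq (hδ : 0 < δ) {a t : ℝ} (ht : |t| ≤ δ / 2)
    (ha : ¬ (δ / 2 < a ∧ a < 5 * δ / 2)) : ramp δ (a + t) = ramp δ a + rampDeriv δ a * t := by
  rw [abs_le] at ht
  rw [not_and_or, not_lt, not_lt] at ha
  rcases ha with h | h
  · rw [ramp_eq_zero (by linarith) hδ, ramp_eq_zero (by linarith) hδ,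
      rampDeriv_eq_zero (by linarith) hδ]; ring
  · rw [ramp_of_ge (by linarith) hδ, ramp_of_ge (by linarith) hδ,
      rampDeriv_of_ge (by linarith) hδ]; ring

end ramp

/-- The function whose positivity defines the domain in the Phragmén–Lindelöf argument. -/
def barrier (E : Set ℂ) (z : ℂ) : ℝ := 1 - ‖z‖ ^ 2 + infDist z E ^ 2 / 24

section barrier
variable {E : Set ℂ}

lemma continuous_barrier : Continuous (barrier E) := by
  unfold barrier
  have := continuous_infDist_pt E
  fun_prop

lemma infDist_le_norm_add_one (hne : E.Nonempty) (hsub : E ⊆ sphere 0 1) (z : ℂ) :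
    infDist z E ≤ ‖z‖ + 1 := by
  obtain ⟨e, he⟩ := hne
  refine (infDist_le_dist_of_mem he).trans ?_
  rw [dist_eq_norm]
  have : ‖e‖ = 1 := by simpa using hsub he
  rw [← this]; exact norm_sub_le _ _

lemma norm_lt_two_of_barrier (hne : E.Nonempty) (hsub : E ⊆ sphere 0 1) {z : ℂ}
    (hz : 0 ≤ barrier E z) : ‖z‖ < 2 := by
  have h1 := infDist_le_norm_add_one hne hsub z
  have h0 : 0 ≤ infDist z E := infDist_nonneg
  unfold barrier at hz
  by_contra! h
  nlinarith [norm_nonneg z]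

lemma barrier_le_two (hne : E.Nonempty) (hsub : E ⊆ sphere 0 1) (z : ℂ) : barrier E z ≤ 2 := by
  have h1 := infDist_le_norm_add_one hne hsub z
  have h0 : 0 ≤ infDist z E := infDist_nonneg
  unfold barrier
  nlinarith [norm_nonneg z, sq_nonneg (‖z‖ - 1)]

lemma barrier_add_ge (hne : E.Nonempty) (hsub : E ⊆ sphere 0 1) {z h : ℂ} (hz : ‖z‖ ≤ 2)
    (hh : ‖h‖ ≤ 1) : barrier E z - 6 * ‖h‖ ≤ barrier E (z + h) := by
  have h1 := infDist_le_norm_add_one hne hsub z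
  have h0 : 0 ≤ infDist z E := infDist_nonneg
  have h0' : 0 ≤ infDist (z + h) E := infDist_nonneg
  have h2 : infDist z E ≤ infDist (z + h) E + ‖h‖ := by
    have := infDist_le_infDist_add_dist (s := E) (x := z) (y := z + h)
    rwa [dist_eq_norm, sub_add_cancel_left, norm_neg] at this
  have h3 := norm_add_le z h
  have h4 : ‖z + h‖ ^ 2 ≤ ‖z‖ ^ 2 + 5 * ‖h‖ := by
    nlinarith [norm_nonneg h, norm_nonneg z, norm_nonneg (z + h)]
  have h5 : infDist z E ^ 2 ≤ infDist (z + h) E ^ 2 + 7 * ‖h‖ := by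
    rcases le_total (infDist z E) (infDist (z + h) E) with h6 | h6
    · nlinarith [norm_nonneg h]
    · have := mul_le_mul (by linarith : infDist z E - infDist (z + h) E ≤ ‖h‖)
        (by linarith : infDist z E + infDist (z + h) E ≤ 6) (by positivity) (norm_nonneg h)
      nlinarith [norm_nonneg h]
  unfold barrier
  linarith [norm_nonneg h]

/-- One-sided second order expansion of the barrier. -/
lemma exists_barrier_add_le (hne : E.Nonempty) (hcl : IsClosed E) (hsub : E ⊆ sphere 0 1)
    {z : ℂ} (hz : ‖z‖ ≤ 2) : ∃ w : ℂ, ‖w‖ ≤ 5 / 2 ∧ ∀ h : ℂ,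
      barrier E (z + h) ≤ barrier E z + (2 * (w.re * h.re + w.im * h.im) - 23 / 24 * ‖h‖ ^ 2) := by
  obtain ⟨e, he, hed⟩ := hcl.exists_infDist_eq_dist hne z
  have hen : ‖e‖ = 1 := by simpa using hsub he
  refine ⟨-z + (z - e) / 24, ?_, fun h => ?_⟩
  · calc ‖-z + (z - e) / 24‖ ≤ ‖z‖ + ‖z - e‖ / 24 := by
          refine (norm_add_le _ _).trans ?_
          rw [norm_neg, norm_div]; simp
      _ ≤ 5 / 2 := by linarith [norm_sub_le z e]
  · have h1 : infDist (z + h) E ≤ ‖z + h - e‖ := by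
      rw [← dist_eq_norm]; exact infDist_le_dist_of_mem he
    have h2 : infDist (z + h) E ^ 2 ≤ ‖z + h - e‖ ^ 2 := pow_le_pow_left₀ infDist_nonneg h1 2
    unfold barrier
    rw [hed, dist_eq_norm]
    have n2 : ∀ w : ℂ, ‖w‖ ^ 2 = w.re ^ 2 + w.im ^ 2 := fun w => by
      rw [← normSq_eq_norm_sq, normSq_apply]; ring
    rw [n2] at h2
    simp only [n2]
    have e1 : ((z - e) / 24).re = (z.re - e.re) / 24 := by
      rw [show (24 : ℂ) = ((24 : ℝ) : ℂ) by norm_num, div_ofReal_re]; simp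
    have e2 : ((z - e) / 24).im = (z.im - e.im) / 24 := by
      rw [show (24 : ℂ) = ((24 : ℝ) : ℂ) by norm_num, div_ofReal_im]; simp
    simp only [add_re, add_im, neg_re, neg_im, sub_re, sub_im, e1, e2] at h2 ⊢
    nlinarith

end barrier

section phragmen
variable {E : Set ℂ}

def shell (E : Set ℂ) (δ : ℝ) : Set ℂ := {z | δ / 2 < barrier E z ∧ barrier E z < 5 * δ / 2}

lemma measurableSet_shell (δ : ℝ) : MeasurableSet (shell E δ) :=
  ((isOpen_lt continuous_const continuous_barrier).inter
    (isOpen_lt continuous_barrier continuous_const)).measurableSet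

lemma lintegral_ramp_barrier_le (hne : E.Nonempty) (hcl : IsClosed E) (hsub : E ⊆ sphere 0 1)
    {δ : ℝ} (hδ : 0 < δ) {s : ℝ} (hs0 : 0 < s) (hs1 : s ≤ 1) (hsδ : 6 * s ≤ δ / 2) {z : ℂ}
    (hz : ‖z‖ ≤ 2) :
    (∫⁻ θ in Ioc (-Real.pi) Real.pi,
      ENNReal.ofReal (ramp δ (barrier E (z - (s : ℂ) * exp ((θ : ℝ) * I)))))
      + ENNReal.ofReal (2 * Real.pi * (23 / 24 * s ^ 2 * rampDeriv δ (barrier E z)))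
    ≤ ENNReal.ofReal (2 * Real.pi * ramp δ (barrier E z))
      + (shell E δ).indicator (fun _ => ENNReal.ofReal (2 * Real.pi * (18 * s ^ 2 / δ))) z := by
  classical
  obtain ⟨w, hw, hwb⟩ := exists_barrier_add_le hne hcl hsub hz
  set a := barrier E z with ha
  set κ : ℝ := if z ∈ shell E δ then 18 * s ^ 2 / δ else 0 with hκ
  have hκ0 : 0 ≤ κ := by rw [hκ]; split_ifs <;> positivity
  set R : ℝ → ℝ := fun θ => ramp δ a + rampDeriv δ a *
    (-(2 * s) * (w.re * Real.cos θ + w.im * Real.sin θ) - 23 / 24 * s ^ 2) + κ with hR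
  have hle : ∀ θ : ℝ, ramp δ (barrier E (z - (s : ℂ) * exp (θ * I))) ≤ R θ := fun θ => by
    set h : ℂ := -((s : ℂ) * exp (θ * I)) with hh
    have hre : h.re = -(s * Real.cos θ) := by
      rw [hh, neg_re, re_ofReal_mul, exp_ofReal_mul_I_re]
    have him : h.im = -(s * Real.sin θ) := by
      rw [hh, neg_im, im_ofReal_mul, exp_ofReal_mul_I_im]
    have hn : ‖h‖ = s := by
      rw [hh, norm_neg, norm_mul, norm_exp_ofReal_mul_I, mul_one, norm_real,
        Real.norm_of_nonneg hs0.le]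
    have h1 := hwb h
    rw [hn] at h1
    set t := 2 * (w.re * h.re + w.im * h.im) - 23 / 24 * s ^ 2 with ht
    have ht6 : |t| ≤ 6 * s := by
      have h2 : |w.re * h.re + w.im * h.im| ≤ ‖w‖ * ‖h‖ := by
        have := abs_re_le_norm ((starRingEnd ℂ) w * h)
        rw [norm_mul, norm_conj] at this
        simpa using this
      rw [hn] at h2
      have h3 : ‖w‖ * s ≤ 5 / 2 * s := mul_le_mul_of_nonneg_right hw hs0.le
      rw [abs_le] at h2 ⊢
      constructor <;> nlinarith
    have hRt : R θ = ramp δ a + rampDeriv δ a * t + κ := by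
      rw [hR, ht, hre, him]; ring
    rw [sub_eq_add_neg, ← hh, hRt]
    refine (ramp_mono hδ h1).trans ?_
    by_cases hsh : z ∈ shell E δ
    · rw [hκ, if_pos hsh]
      refine (ramp_add_le hδ _ _).trans ?_
      have : t ^ 2 / (2 * δ) ≤ 18 * s ^ 2 / δ := by
        rw [div_le_div_iff₀ (by positivity) hδ]
        have := sq_le_sq' (abs_le.1 ht6).1 (abs_le.1 ht6).2
        nlinarith
      linarith
    · rw [ramp_add_eq hδ (ht6.trans hsδ) hsh]; linarith
  have hR0 : ∀ θ, 0 ≤ R θ := fun θ => (ramp_nonneg hδ _).trans (hle θ)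
  have hRc : Continuous R := by rw [hR]; fun_prop
  have hRi : ∫ θ in Ioc (-Real.pi) Real.pi, R θ
      = 2 * Real.pi * (ramp δ a - 23 / 24 * s ^ 2 * rampDeriv δ a + κ) := by
    rw [← intervalIntegral.integral_of_le (by linarith [Real.pi_pos])]
    have : ∀ θ, R θ = (ramp δ a - 23 / 24 * s ^ 2 * rampDeriv δ a + κ) +
        ((rampDeriv δ a * -(2 * s) * w.re) * Real.cos θ +
        (rampDeriv δ a * -(2 * s) * w.im) * Real.sin θ) := fun θ => by rw [hR]; ring
    simp only [this]
    generalize ramp δ a - 23 / 24 * s ^ 2 * rampDeriv δ a + κ = k0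
    rw [intervalIntegral.integral_add (by simp) (Continuous.intervalIntegrable (by fun_prop) _ _),
      intervalIntegral.integral_add (Continuous.intervalIntegrable (by fun_prop) _ _)
        (Continuous.intervalIntegrable (by fun_prop) _ _),
      intervalIntegral.integral_const_mul, intervalIntegral.integral_const_mul,
      intervalIntegral.integral_const]
    simp only [integral_cos, integral_sin, Real.sin_neg, Real.sin_pi, Real.cos_neg, smul_eq_mul]
    ring
  have hpi := Real.pi_pos
  have hr0 := ramp_nonneg hδ a
  have hd0 := rampDeriv_nonneg hδ a
  have hind : (shell E δ).indicator (fun _ => ENNReal.ofReal (2 * Real.pi * (18 * s ^ 2 / δ))) z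
      = ENNReal.ofReal (2 * Real.pi * κ) := by
    by_cases hsh : z ∈ shell E δ
    · rw [indicator_of_mem hsh, hκ, if_pos hsh]
    · rw [indicator_of_notMem hsh, hκ, if_neg hsh]; simp
  rw [hind, ← ENNReal.ofReal_add (by positivity) (by positivity)]
  calc _ ≤ (∫⁻ θ in Ioc (-Real.pi) Real.pi, ENNReal.ofReal (R θ))
      + ENNReal.ofReal (2 * Real.pi * (23 / 24 * s ^ 2 * rampDeriv δ a)) := by
        gcongr with θ; exact hle θ
    _ = ENNReal.ofReal ((∫ θ in Ioc (-Real.pi) Real.pi, R θ)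
      + (2 * Real.pi * (23 / 24 * s ^ 2 * rampDeriv δ a))) := by
        rw [← ofReal_integral_eq_lintegral_ofReal hRc.integrableOn_Ioc (.of_forall hR0),
          ENNReal.ofReal_add (integral_nonneg hR0) (by positivity)]
    _ ≤ _ := by
        apply ENNReal.ofReal_le_ofReal
        rw [hRi]; apply le_of_eq; ring

lemma lintegral_ge_le_of_subMean (hne : E.Nonempty) (hcl : IsClosed E) (hsub : E ⊆ sphere 0 1)
    {u : ℂ → ℝ} (huc : ContinuousOn u {z | 0 < barrier E z})
    (hsmv : ∀ δ > 0, ∃ s0 > (0 : ℝ), ∀ s : ℝ, 0 < s → s < s0 → ∀ z, δ ≤ barrier E z →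
      ENNReal.ofReal (2 * Real.pi * u z)
        ≤ ∫⁻ θ in Ioc (-Real.pi) Real.pi, ENNReal.ofReal (u (z + s * exp ((θ : ℝ) * I))))
    {δ ε : ℝ} (hδ : 0 < δ) (hε : 0 < ε)
    (hsh : ∫⁻ z in shell E δ, ENNReal.ofReal (u z) ≤ ENNReal.ofReal (ε * δ)) :
    ∫⁻ z in {z | 2 * δ ≤ barrier E z}, ENNReal.ofReal (u z) ≤ ENNReal.ofReal (20 * ε) := by
  obtain ⟨s0, hs00, hs0⟩ := hsmv δ hδ
  set s : ℝ := min (min 1 (s0 / 2)) (δ / 12) with hs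
  have hsp : 0 < s := by positivity
  have hs1 : s ≤ 1 := (min_le_left _ _).trans (min_le_left _ _)
  have hss : s < s0 := by
    have : s ≤ s0 / 2 := (min_le_left _ _).trans (min_le_right _ _)
    linarith
  have hsδ : 6 * s ≤ δ / 2 := by
    have : s ≤ δ / 12 := min_le_right _ _
    linarith
  have hpi := Real.pi_pos
  set S : Set ℂ := {z | δ / 2 ≤ barrier E z} with hS
  have hSc : IsClosed S := isClosed_le continuous_const continuous_barrier
  have hS2 : ∀ z ∈ S, ‖z‖ ≤ 2 := fun z hz =>
    (norm_lt_two_of_barrier hne hsub (le_trans (by positivity : 0 ≤ δ / 2) hz)).le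
  have hSk : IsCompact S := (isCompact_closedBall (0 : ℂ) 2).of_isClosed_subset hSc
    fun z hz => by simpa using hS2 z hz
  have hucS : ContinuousOn u S := huc.mono fun z (hz : δ / 2 ≤ barrier E z) =>
    show 0 < barrier E z from lt_of_lt_of_le (by positivity) hz
  set U : ℂ → ENNReal := S.indicator (fun z => ENNReal.ofReal (u z)) with hU
  have hUm : Measurable U := by
    classical
    have : U = S.piecewise (fun z => ENNReal.ofReal (u z)) (fun _ => (0 : ENNReal)) := by
      rw [hU]; ext z; by_cases hz : z ∈ S
      · rw [indicator_of_mem hz, piecewise_eq_of_mem _ _ _ hz]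
      · rw [indicator_of_notMem hz, piecewise_eq_of_notMem _ _ _ hz]
    rw [this]
    exact (ENNReal.continuous_ofReal.comp_continuousOn hucS).measurable_piecewise
      continuousOn_const hSc.measurableSet
  set ψ : ℂ → ENNReal := fun z => ENNReal.ofReal (ramp δ (barrier E z)) with hψ
  have hψc : Continuous ψ := by
    have h1 := continuous_ramp (δ := δ)
    have h2 := continuous_barrier (E := E)
    exact ENNReal.continuous_ofReal.comp (h1.comp h2)
  have hψm := hψc.measurable
  have hpt1 : ∀ z, ENNReal.ofReal (2 * Real.pi) * (ψ z * U z) ≤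
      ∫⁻ θ in Ioc (-Real.pi) Real.pi, ψ z * U (z + s * exp ((θ : ℝ) * I)) := fun z => by
    rcases le_or_gt (barrier E z) δ with h | h
    · simp only [hψ, ramp_eq_zero h hδ, ENNReal.ofReal_zero, zero_mul, mul_zero]; exact zero_le
    · have hzS : z ∈ S := by change δ / 2 ≤ _; linarith
      have hθS : ∀ θ : ℝ, z + s * exp (θ * I) ∈ S := fun θ => by
        have hn : ‖(s : ℂ) * exp (θ * I)‖ = s := by
          rw [norm_mul, norm_exp_ofReal_mul_I, mul_one, norm_real, Real.norm_of_nonneg hsp.le]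
        have := barrier_add_ge hne hsub (hS2 z hzS) (hn.trans_le hs1)
        rw [hn] at this
        change δ / 2 ≤ _
        linarith
      simp only [hU, indicator_of_mem hzS, indicator_of_mem (hθS _)]
      rw [lintegral_const_mul' _ _ ENNReal.ofReal_ne_top, mul_left_comm,
        ← ENNReal.ofReal_mul (by positivity)]
      gcongr
      exact hs0 s hsp hss z h.le
  have hpt2 : ∀ z, U z * ((∫⁻ θ in Ioc (-Real.pi) Real.pi, ψ (z - s * exp ((θ : ℝ) * I)))
      + ENNReal.ofReal (2 * Real.pi * (23 / 24 * s ^ 2 * rampDeriv δ (barrier E z))))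
      ≤ U z * (ENNReal.ofReal (2 * Real.pi * ramp δ (barrier E z))
      + (shell E δ).indicator (fun _ => ENNReal.ofReal (2 * Real.pi * (18 * s ^ 2 / δ))) z) :=
    fun z => by
      by_cases hz : z ∈ S
      · refine mul_le_mul_right ?_ _
        exact lintegral_ramp_barrier_le hne hcl hsub hδ hsp hs1 hsδ (hS2 z hz)
      · simp [hU, hz]
  have hswap : ∫⁻ z, ∫⁻ θ in Ioc (-Real.pi) Real.pi, ψ z * U (z + s * exp ((θ : ℝ) * I))
      = ∫⁻ z, U z * ∫⁻ θ in Ioc (-Real.pi) Real.pi, ψ (z - s * exp ((θ : ℝ) * I)) := by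
    rw [lintegral_lintegral_swap]
    · have : ∀ θ : ℝ, ∫⁻ z, ψ z * U (z + s * exp (θ * I))
          = ∫⁻ z, U z * ψ (z - s * exp (θ * I)) := fun θ => by
        rw [← lintegral_add_right_eq_self (fun z => U z * ψ (z - s * exp (θ * I)))
          ((s : ℂ) * exp (θ * I))]
        refine lintegral_congr fun z => ?_
        rw [add_sub_cancel_right, mul_comm]
      simp only [this]
      rw [lintegral_lintegral_swap]
      · refine lintegral_congr fun z => ?_
        rw [lintegral_const_mul]
        exact hψm.comp (by fun_prop)
      · refine Measurable.aemeasurable ?_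
        simp only [Function.uncurry_def]
        exact (hUm.comp measurable_snd).mul (hψm.comp (by fun_prop))
    · refine Measurable.aemeasurable ?_
      simp only [Function.uncurry_def]
      exact (hψm.comp measurable_fst).mul (hUm.comp (by fun_prop))
  have hψU : Measurable fun z => ψ z * U z := hψm.mul hUm
  have hfin : ENNReal.ofReal (2 * Real.pi) * ∫⁻ z, ψ z * U z ≠ ⊤ := by
    refine ENNReal.mul_ne_top ENNReal.ofReal_ne_top ?_
    obtain ⟨B, hB⟩ := hSk.exists_bound_of_continuousOn hucS
    have : ∀ z, ψ z * U z ≤ S.indicator (fun _ => ENNReal.ofReal 2 * ENNReal.ofReal B) z :=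
      fun z => by
        by_cases hz : z ∈ S
        · simp only [hU, hψ, indicator_of_mem hz]
          gcongr
          · exact (ramp_le hδ (le_trans (by positivity) hz)).trans (barrier_le_two hne hsub z)
          · exact (le_abs_self _).trans (hB z hz)
        · simp [hU, hz]
    refine ((lintegral_mono this).trans_lt ?_).ne
    rw [lintegral_indicator_const hSc.measurableSet]
    exact ENNReal.mul_lt_top (by finiteness) hSk.measure_lt_top
  set P : ENNReal := ENNReal.ofReal (2 * Real.pi) * ∫⁻ z, ψ z * U z with hP
  have hm1 : Measurable fun z => U z *
      ENNReal.ofReal (2 * Real.pi * (23 / 24 * s ^ 2 * rampDeriv δ (barrier E z))) := by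
    refine hUm.mul ?_
    have : Continuous fun z => 2 * Real.pi * (23 / 24 * s ^ 2 * rampDeriv δ (barrier E z)) := by
      have h2 := continuous_barrier (E := E)
      unfold rampDeriv
      fun_prop
    exact this.measurable.ennreal_ofReal
  have hmain : P + ∫⁻ z, U z *
      ENNReal.ofReal (2 * Real.pi * (23 / 24 * s ^ 2 * rampDeriv δ (barrier E z)))
      ≤ P + ∫⁻ z, U z * (shell E δ).indicator
        (fun _ => ENNReal.ofReal (2 * Real.pi * (18 * s ^ 2 / δ))) z := by
    calc _ ≤ (∫⁻ z, U z * ∫⁻ θ in Ioc (-Real.pi) Real.pi, ψ (z - s * exp ((θ : ℝ) * I)))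
        + ∫⁻ z, U z *
      ENNReal.ofReal (2 * Real.pi * (23 / 24 * s ^ 2 * rampDeriv δ (barrier E z))) := by
          gcongr
          rw [hP, ← hswap, ← lintegral_const_mul _ hψU]
          exact lintegral_mono hpt1
      _ ≤ ∫⁻ z, U z * (ENNReal.ofReal (2 * Real.pi * ramp δ (barrier E z))
      + (shell E δ).indicator (fun _ => ENNReal.ofReal (2 * Real.pi * (18 * s ^ 2 / δ))) z) := by
          rw [← lintegral_add_right _ hm1]
          refine lintegral_mono fun z => ?_
          simp only
          rw [← mul_add]
          exact hpt2 z
      _ = _ := by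
          simp only [mul_add]
          have hc : Continuous fun z => 2 * Real.pi * ramp δ (barrier E z) :=
            continuous_const.mul (continuous_ramp.comp continuous_barrier)
          have hm : Measurable fun z => U z * ENNReal.ofReal (2 * Real.pi * ramp δ (barrier E z)) :=
            hUm.mul hc.measurable.ennreal_ofReal
          rw [lintegral_add_left hm, hP, ← lintegral_const_mul _ hψU]
          congr 1
          refine lintegral_congr fun z => ?_
          rw [ENNReal.ofReal_mul (by positivity)]
          ring
  have hmain2 := (ENNReal.add_le_add_iff_left hfin).1 hmain
  have hlow : ENNReal.ofReal (2 * Real.pi * (23 / 24 * s ^ 2)) *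
      ∫⁻ z in {z | 2 * δ ≤ barrier E z}, ENNReal.ofReal (u z) ≤ ∫⁻ z, U z *
      ENNReal.ofReal (2 * Real.pi * (23 / 24 * s ^ 2 * rampDeriv δ (barrier E z))) := by
    have hmT : MeasurableSet {z | 2 * δ ≤ barrier E z} :=
      (isClosed_le continuous_const continuous_barrier).measurableSet
    rw [← lintegral_const_mul' _ _ ENNReal.ofReal_ne_top, ← lintegral_indicator hmT]
    refine lintegral_mono fun z => ?_
    by_cases hz : z ∈ {z | 2 * δ ≤ barrier E z}
    · have hzS : z ∈ S := by
        have : 2 * δ ≤ barrier E z := hz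
        change δ / 2 ≤ _; linarith
      simp only [indicator_of_mem hz, hU, indicator_of_mem hzS, rampDeriv_of_ge hz hδ]
      rw [mul_one, mul_comm]
    · simp [indicator_of_notMem hz]
  have hup : ∫⁻ z, U z * (shell E δ).indicator
        (fun _ => ENNReal.ofReal (2 * Real.pi * (18 * s ^ 2 / δ))) z
      ≤ ENNReal.ofReal (2 * Real.pi * (18 * s ^ 2 / δ)) * ENNReal.ofReal (ε * δ) := by
    refine le_trans ?_ (mul_le_mul_right hsh _)
    rw [← lintegral_const_mul' _ _ ENNReal.ofReal_ne_top,
      ← lintegral_indicator (measurableSet_shell δ)]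
    refine lintegral_mono fun z => ?_
    by_cases hz : z ∈ shell E δ
    · have hzS : z ∈ S := hz.1.le
      simp only [indicator_of_mem hz, hU, indicator_of_mem hzS]
      rw [mul_comm]
    · simp [indicator_of_notMem hz]
  have hfinal := hlow.trans (hmain2.trans hup)
  rw [← ENNReal.ofReal_mul (by positivity)] at hfinal
  have hpos : 0 < 2 * Real.pi * (23 / 24 * s ^ 2) := by positivity
  have h3 := ENNReal.le_div_iff_mul_le
    (a := ∫⁻ z in {z | 2 * δ ≤ barrier E z}, ENNReal.ofReal (u z))
    (b := ENNReal.ofReal (2 * Real.pi * (23 / 24 * s ^ 2)))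
    (c := ENNReal.ofReal (2 * Real.pi * (18 * s ^ 2 / δ) * (ε * δ)))
    (Or.inl (by simpa using hpos)) (Or.inl ENNReal.ofReal_ne_top)
  rw [mul_comm] at hfinal
  refine (h3.2 hfinal).trans ?_
  rw [← ENNReal.ofReal_div_of_pos hpos]
  apply ENNReal.ofReal_le_ofReal
  rw [div_le_iff₀ hpos]
  have : 2 * Real.pi * (18 * s ^ 2 / δ) * (ε * δ) = 2 * Real.pi * s ^ 2 * ε * 18 := by
    field_simp
  rw [this]
  have : 0 < 2 * Real.pi * s ^ 2 * ε := by positivity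
  nlinarith

/-- A nonnegative subharmonic function on `{barrier > 0}` which is small in the mean near the
boundary vanishes. -/
theorem eq_zero_of_subMean (hne : E.Nonempty) (hcl : IsClosed E) (hsub : E ⊆ sphere 0 1)
    {u : ℂ → ℝ} (hu0 : ∀ z, 0 ≤ u z) (huc : ContinuousOn u {z | 0 < barrier E z})
    (hsmv : ∀ δ > 0, ∃ s0 > (0 : ℝ), ∀ s : ℝ, 0 < s → s < s0 → ∀ z, δ ≤ barrier E z →
      ENNReal.ofReal (2 * Real.pi * u z)
        ≤ ∫⁻ θ in Ioc (-Real.pi) Real.pi, ENNReal.ofReal (u (z + s * exp ((θ : ℝ) * I))))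
    (hsh : ∀ ε > 0, ∃ δ0 > 0, ∀ δ, 0 < δ → δ < δ0 →
      ∫⁻ z in shell E δ, ENNReal.ofReal (u z) ≤ ENNReal.ofReal (ε * δ))
    {z : ℂ} (hz : 0 < barrier E z) : u z = 0 := by
  by_contra hne0
  have hup : 0 < u z := lt_of_le_of_ne (hu0 z) (Ne.symm hne0)
  set T : Set ℂ := {w | barrier E z / 2 ≤ barrier E w} with hT
  have hInt : ∫⁻ w in T, ENNReal.ofReal (u w) = 0 := by
    refine le_antisymm (ENNReal.le_of_forall_pos_le_add fun ε hε _ => ?_) zero_le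
    rw [zero_add]
    obtain ⟨δ0, hδ0, h⟩ := hsh (ε / 20) (by positivity)
    set δ := min (δ0 / 2) (barrier E z / 4)
    have hδp : 0 < δ := by positivity
    have hδl : δ < δ0 := lt_of_le_of_lt (min_le_left _ _) (by linarith)
    have h1 := lintegral_ge_le_of_subMean hne hcl hsub huc hsmv hδp (by positivity)
      (h δ hδp hδl)
    rw [show 20 * ((ε : ℝ) / 20) = ε by ring, ENNReal.ofReal_coe_nnreal] at h1
    refine le_trans (lintegral_mono_set fun w hw => ?_) h1
    have h2 : δ ≤ barrier E z / 4 := min_le_right _ _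
    have h3 : barrier E z / 2 ≤ barrier E w := hw
    change 2 * δ ≤ _
    linarith
  set O : Set ℂ := {w | barrier E z / 2 < barrier E w} with hO
  have hOo : IsOpen O := isOpen_lt continuous_const continuous_barrier
  have hucO : ContinuousOn u O := huc.mono fun w (hw : w ∈ O) => by
    have : barrier E z / 2 < barrier E w := hw
    change 0 < barrier E w
    linarith
  have hV : IsOpen (O ∩ u ⁻¹' Ioi 0) := hucO.isOpen_inter_preimage hOo isOpen_Ioi
  have hintO : ∫⁻ w in O, ENNReal.ofReal (u w) = 0 :=
    le_antisymm ((lintegral_mono_set fun w (hw : w ∈ O) =>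
      (show barrier E z / 2 ≤ barrier E w from le_of_lt hw)).trans hInt.le) zero_le
  have hae := (lintegral_eq_zero_iff' (ENNReal.continuous_ofReal.comp_continuousOn hucO
    |>.aemeasurable hOo.measurableSet)).1 hintO
  have hnull : volume (O ∩ u ⁻¹' Ioi 0) = 0 := by
    have h1 := (ae_restrict_iff' hOo.measurableSet).1 hae
    refine measure_mono_null (fun w hw => ?_) (ae_iff.1 h1)
    intro h2
    have h3 := h2 hw.1
    have h4 : 0 < u w := hw.2
    simp at h3
    linarith
  have := hV.eq_empty_of_measure_zero hnull
  exact (this ▸ (⟨(by linarith : barrier E z / 2 < barrier E z), hup⟩ :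
    z ∈ O ∩ u ⁻¹' Ioi 0) : z ∈ (∅ : Set ℂ))

end phragmen

section shellEstimate
variable {E : Set ℂ}

lemma exists_arc_measure_le (hE : IsCarleson E) (hne : E.Nonempty)
    (hnull : ∀ᵐ θ : ℝ ∂(volume.restrict (Ioo (-Real.pi) Real.pi)),
      0 < infDist (exp (θ * I)) E) {ε : ℝ} (hε : 0 < ε) :
    ∃ x0 > (0 : ℝ), ∀ x, 0 < x → x < x0 →
      volume.restrict (Ioo (-Real.pi) Real.pi) {θ : ℝ | infDist (exp (θ * I)) E ≤ x}
        * ENNReal.ofReal (Real.log (2 / x)) ≤ ENNReal.ofReal ε := by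
  obtain ⟨-, hsub, hInt⟩ := hE
  set μ := volume.restrict (Ioo (-Real.pi) Real.pi) with hμ
  set d : ℝ → ℝ := fun θ => infDist (exp (θ * I)) E with hd
  have hdc : Continuous d := (continuous_infDist_pt E).comp (by fun_prop)
  have hd2 : ∀ θ, d θ ≤ 2 := fun θ => by
    have := infDist_le_norm_add_one hne hsub (exp (θ * I))
    rw [norm_exp_ofReal_mul_I] at this
    linarith
  set f : ℝ → ENNReal := fun θ => ENNReal.ofReal (Real.log (2 / d θ)) with hf
  have hfm : Measurable f := by
    have := hdc.measurable
    fun_prop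
  have hfin : ∫⁻ θ, f θ ∂μ ≠ ⊤ := by
    have h1 : Integrable (fun θ => Real.log (2 / d θ)) μ := by
      rw [hμ, restrict_Ioo_eq_restrict_Ioc]; exact hInt
    exact (h1.lintegral_lt_top).ne
  have hms : ∀ x, MeasurableSet {θ | d θ ≤ x} := fun x =>
    (isClosed_le hdc continuous_const).measurableSet
  have hlim : Tendsto (fun x : ℝ => ∫⁻ θ, {θ | d θ ≤ x}.indicator f θ ∂μ)
      (nhdsWithin 0 (Ioi 0)) (nhds (∫⁻ _, 0 ∂μ)) := by
    refine tendsto_lintegral_filter_of_dominated_convergence f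
      (.of_forall fun x => hfm.indicator (hms x))
      (.of_forall fun x => .of_forall fun θ => indicator_le_self _ _ _) hfin ?_
    filter_upwards [hnull] with θ hθ
    refine tendsto_const_nhds.congr' ?_
    have : ∀ᶠ x : ℝ in nhdsWithin 0 (Ioi 0), x < d θ :=
      nhdsWithin_le_nhds (Iio_mem_nhds hθ)
    filter_upwards [this] with x hx
    rw [indicator_of_notMem]
    exact not_le.2 hx
  rw [lintegral_zero] at hlim
  have hev := hlim.eventually (gt_mem_nhds (by simpa using hε : (0 : ENNReal) < ENNReal.ofReal ε))
  obtain ⟨x0, hx0, h0⟩ := mem_nhdsGT_iff_exists_Ioo_subset.1 hev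
  refine ⟨x0, hx0, fun x hxp hxl => le_trans ?_ (le_of_lt (h0 ⟨hxp, hxl⟩))⟩
  rw [mul_comm, ← lintegral_indicator_const (hms x)]
  refine lintegral_mono_ae ?_
  filter_upwards [hnull] with θ hθ
  by_cases h : θ ∈ {θ | d θ ≤ x}
  · rw [indicator_of_mem h, indicator_of_mem h]
    have h' : d θ ≤ x := h
    apply ENNReal.ofReal_le_ofReal
    apply Real.log_le_log (by positivity)
    gcongr
  · rw [indicator_of_notMem h, indicator_of_notMem h]

lemma lintegral_log_le {a k : ℝ} (ha0 : 0 < a) (ha1 : a ≤ 1) (hk : 0 ≤ k) :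
    ∫⁻ r in Ioc (1 - a) (1 + a), ENNReal.ofReal (k - Real.log (1 - r))
      ≤ ENNReal.ofReal (2 * a * (k + 1 + Real.log (1 / a))) := by
  have hi0 : IntervalIntegrable (fun r => Real.log (1 - r)) volume (1 - a) (1 + a) := by
    have := (intervalIntegral.intervalIntegrable_log' (a := a) (b := -a)).comp_sub_left 1
    convert this using 1
    ring
  have hi : IntervalIntegrable (fun r => k - Real.log (1 - r)) volume (1 - a) (1 + a) :=
    (intervalIntegrable_const).sub hi0
  have hI : ∫ r in (1 - a)..(1 + a), (k - Real.log (1 - r))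
      = 2 * a * (k + 1 + Real.log (1 / a)) := by
    rw [intervalIntegral.integral_sub intervalIntegrable_const hi0,
      intervalIntegral.integral_comp_sub_left (fun x => Real.log x), integral_log,
      intervalIntegral.integral_const]
    rw [show 1 - (1 + a) = -a by ring, show 1 - (1 - a) = a by ring, Real.log_neg_eq_log,
      one_div, Real.log_inv, smul_eq_mul]
    ring
  rw [← ofReal_integral_eq_lintegral_ofReal
    ((intervalIntegrable_iff_integrableOn_Ioc_of_le (by linarith)).1 hi),
    ← intervalIntegral.integral_of_le (by linarith), hI]
  refine (ae_restrict_iff' measurableSet_Ioc).2 (.of_forall fun r hr => ?_)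
  have : Real.log (1 - r) ≤ 0 := by
    rw [← Real.log_abs]
    apply Real.log_nonpos (abs_nonneg _)
    rw [abs_le]
    constructor <;> linarith [hr.1, hr.2]
  change 0 ≤ _
  linarith

lemma shell_geometry {δ : ℝ} (hδ0 : 0 < δ) (hδ1 : δ ≤ 1 / 10) {z : ℂ}
    (hz : z ∈ shell E δ) (hout : ‖z‖ ^ 2 - 1 < infDist z E ^ 2 / 48) :
    |1 - ‖z‖| < 5 * δ / 2 ∧ ∀ w : ℂ, ‖z - w‖ = |1 - ‖z‖| → infDist w E ≤ 14 * √δ := by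
  obtain ⟨h1, h2⟩ := hz
  rw [barrier] at h1 h2
  have hn := norm_nonneg z
  have hd : infDist z E ^ 2 ≤ 120 * δ := by linarith
  have hab : |1 - ‖z‖| < 5 * δ / 2 := by
    have h3 : |1 - ‖z‖| * (1 + ‖z‖) < 5 * δ / 2 := by
      rw [← abs_of_nonneg (by linarith : 0 ≤ 1 + ‖z‖), ← abs_mul, abs_lt]
      have := sq_nonneg (infDist z E)
      constructor <;> nlinarith
    have := abs_nonneg (1 - ‖z‖)
    nlinarith
  refine ⟨hab, fun w hw => ?_⟩
  have hs : 0 < √δ := Real.sqrt_pos.2 hδ0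
  have hss : √δ ^ 2 = δ := Real.sq_sqrt hδ0.le
  have h4 : infDist w E ≤ infDist z E + dist w z := infDist_le_infDist_add_dist
  rw [dist_comm, dist_eq_norm, hw] at h4
  have h5 : infDist z E ≤ 11 * √δ := by
    apply abs_le_of_sq_le_sq' _ (by positivity) |>.2
    rw [mul_pow, hss]
    linarith
  have h6 : √δ ≤ 1 := Real.sqrt_le_one.2 (by linarith)
  nlinarith

/-- The mean over a shell, with the weight coming from `LogGrowth`. -/
theorem shell_estimate (hE : IsCarleson E) (hne : E.Nonempty)
    (hnull : ∀ᵐ θ : ℝ ∂(volume.restrict (Ioo (-Real.pi) Real.pi)),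
      0 < infDist (exp (θ * I)) E) {F : ℂ → ℂ} {C0 C1 : ℝ} (hC1 : 0 ≤ C1)
    (hF : ∀ z, 1 < ‖z‖ → ‖F z‖ ≤ C0 / (‖z‖ - 1)) (hL : LogGrowth F) {u : ℂ → ℝ}
    (hout : ∀ z, 0 < barrier E z → infDist z E ^ 2 / 48 ≤ ‖z‖ ^ 2 - 1 → u z = 0)
    (hu : ∀ z, 0 < barrier E z → ‖z‖ ≠ 1 → u z ≤ C1 + Real.posLog ‖F z‖)
    {ε : ℝ} (hε : 0 < ε) :
    ∃ δ0 > (0 : ℝ), ∀ δ, 0 < δ → δ < δ0 →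
      ∫⁻ z in shell E δ, ENNReal.ofReal (u z) ≤ ENNReal.ofReal (ε * δ) := by
  obtain ⟨x0, hx0, hx⟩ := exists_arc_measure_le hE hne hnull (ε := ε / 160) (by positivity)
  obtain ⟨C, W, hWm, hW, hFW⟩ := hL (ε / 20) (by positivity)
  set C' := max |C| |C0| with hC'
  have hC'0 : 0 ≤ C' := (abs_nonneg _).trans (le_max_left _ _)
  set k := C1 + Real.posLog C' with hk
  have hk0 : 0 ≤ k := add_nonneg hC1 Real.posLog_nonneg
  have hl7 : 0 < Real.log 7 := Real.log_pos (by norm_num)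
  refine ⟨min (min (1 / 10) ((x0 / 14) ^ 2)) (Real.exp (-(k + 1 + 8 * Real.log 7))),
    by positivity, fun δ hδ0 hδ => ?_⟩
  have hδ1 : δ ≤ 1 / 10 := hδ.le.trans ((min_le_left _ _).trans (min_le_left _ _))
  have hδx : 14 * √δ < x0 := by
    have h1 : δ < (x0 / 14) ^ 2 := hδ.trans_le ((min_le_left _ _).trans (min_le_right _ _))
    have := (Real.sqrt_lt' (by positivity)).2 h1
    linarith
  have hδL : k + 1 + 8 * Real.log 7 ≤ -Real.log δ := by
    have h1 : δ < Real.exp (-(k + 1 + 8 * Real.log 7)) := hδ.trans_le (min_le_right _ _)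
    have := (Real.log_lt_iff_lt_exp hδ0).2 h1
    linarith
  set ρ := 14 * √δ with hρ
  have hs : 0 < √δ := Real.sqrt_pos.2 hδ0
  have hρ0 : 0 < ρ := by positivity
  set a := 5 * δ / 2 with ha
  have ha0 : 0 < a := by positivity
  have ha1 : a ≤ 1 := by linarith
  set μ := volume.restrict (Ioo (-Real.pi) Real.pi) with hμ
  set Θ : Set ℂ := {w | infDist w E ≤ ρ} with hΘ
  have hΘm : MeasurableSet Θ :=
    (isClosed_le (continuous_infDist_pt E) continuous_const).measurableSet
  set m := μ {θ : ℝ | infDist (exp (θ * I)) E ≤ ρ} with hm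
  have hmle := hx ρ hρ0 hδx
  -- the majorant
  set G : ℂ → ENNReal := {z : ℂ | |1 - ‖z‖| < a}.indicator fun z =>
    ((fun z : ℂ => z / ‖z‖) ⁻¹' Θ).indicator (fun z => ENNReal.ofReal (k - Real.log (1 - ‖z‖))) z
      + (ball (0 : ℂ) 1).indicator W z with hG
  have hGm : Measurable G := by
    refine Measurable.indicator ?_ (isOpen_lt (by fun_prop) continuous_const).measurableSet
    refine Measurable.add ?_ (hWm.indicator measurableSet_ball)
    refine Measurable.indicator (by fun_prop) ?_
    exact (by fun_prop : Measurable fun z : ℂ => z / ‖z‖) hΘm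
  have hsph : ∀ᵐ z : ℂ, ‖z‖ ≠ 1 := by
    have := Measure.addHaar_sphere (volume : Measure ℂ) 0 1
    rw [← compl_mem_ae_iff] at this
    filter_upwards [this] with z hz h
    exact hz (by simpa using h)
  have hstep1 : ∫⁻ z in shell E δ, ENNReal.ofReal (u z) ≤ ∫⁻ z, G z := by
    rw [← lintegral_indicator (measurableSet_shell δ)]
    refine lintegral_mono_ae ?_
    filter_upwards [hsph, hFW] with z hz1 hzF
    by_cases hzs : z ∈ shell E δ
    swap
    · rw [indicator_of_notMem hzs]; exact zero_le
    rw [indicator_of_mem hzs]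
    have hb : 0 < barrier E z := lt_trans (by positivity) hzs.1
    rcases le_or_gt (infDist z E ^ 2 / 48) (‖z‖ ^ 2 - 1) with ho | ho
    · rw [hout z hb ho]; simp
    obtain ⟨hza, hzw⟩ := shell_geometry hδ0 hδ1 hzs ho
    have hz0 : z ≠ 0 := by
      rintro rfl
      rw [norm_zero, sub_zero, abs_one] at hza
      linarith
    have hzn : 0 < ‖z‖ := norm_pos_iff.2 hz0
    have hmem1 : z ∈ {z : ℂ | |1 - ‖z‖| < a} := hza
    have hmem2 : z ∈ (fun z : ℂ => z / ‖z‖) ⁻¹' Θ := by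
      apply hzw
      have : z - z / ‖z‖ = (z / ‖z‖) * ((‖z‖ - 1 : ℝ) : ℂ) := by
        have : (‖z‖ : ℂ) ≠ 0 := by exact_mod_cast hzn.ne'
        push_cast
        field_simp
      rw [this, norm_mul, norm_div, norm_real, norm_real, norm_norm, div_self hzn.ne', one_mul,
        Real.norm_eq_abs, abs_sub_comm]
    rw [hG, indicator_of_mem hmem1, indicator_of_mem hmem2]
    have hpos : 0 < |1 - ‖z‖| := abs_pos.2 (sub_ne_zero.2 (Ne.symm hz1))
    have hlog : ∀ c, |c| ≤ C' →
        Real.posLog (c / (1 - ‖z‖)) ≤ Real.posLog C' - Real.log (1 - ‖z‖) := fun c hc => by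
      rw [div_eq_mul_inv]
      refine Real.posLog_mul.trans ?_
      have h1 : Real.posLog c ≤ Real.posLog C' := by
        rw [← Real.posLog_abs]; exact Real.posLog_le_posLog (abs_nonneg _) hc
      have h2 : Real.posLog (1 - ‖z‖)⁻¹ = -Real.log (1 - ‖z‖) := by
        rw [Real.posLog_eq_log, Real.log_inv]
        rw [abs_inv]
        exact (one_le_inv₀ hpos).2 (by linarith)
      rw [h2]; linarith
    have hu' := hu z hb hz1
    rcases lt_or_gt_of_ne hz1 with hlt | hgt
    · have hzb : z ∈ ball (0 : ℂ) 1 := by simpa using hlt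
      rw [indicator_of_mem hzb]
      calc ENNReal.ofReal (u z) ≤ ENNReal.ofReal (C1 + Real.posLog ‖F z‖) :=
            ENNReal.ofReal_le_ofReal hu'
        _ = ENNReal.ofReal C1 + ENNReal.ofReal (Real.posLog ‖F z‖) :=
            ENNReal.ofReal_add hC1 Real.posLog_nonneg
        _ ≤ ENNReal.ofReal C1 + (ENNReal.ofReal (Real.posLog (C / (1 - ‖z‖))) + W z) := by
            gcongr; exact hzF hzb
        _ = ENNReal.ofReal (C1 + Real.posLog (C / (1 - ‖z‖))) + W z := by
            rw [ENNReal.ofReal_add hC1 Real.posLog_nonneg, add_assoc]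
        _ ≤ _ := by
            gcongr
            have := hlog C (le_max_left _ _)
            linarith
    · refine le_trans (ENNReal.ofReal_le_ofReal ?_) le_self_add
      refine hu'.trans ?_
      have h1 := Real.posLog_le_posLog (norm_nonneg _) (hF z hgt)
      have h2 := hlog (-C0) (by rw [abs_neg]; exact le_max_right _ _)
      rw [← neg_sub (‖z‖) 1, neg_div_neg_eq] at h2
      rw [← neg_sub (‖z‖) 1]
      linarith
  have hstep2 : ∫⁻ z, G z ≤ ∫⁻ r in Ioc (1 - a) (1 + a),
      2 * (ENNReal.ofReal (k - Real.log (1 - r)) * m + ENNReal.ofReal (ε / 20)) := by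
    rw [← Complex.lintegral_comp_polarCoord_symm, polarCoord_target, Measure.volume_eq_prod,
      ← Measure.prod_restrict]
    have hpm : Measurable fun p : ℝ × ℝ => ENNReal.ofReal p.1 • G (Complex.polarCoord.symm p) := by
      have : Measurable fun p : ℝ × ℝ => G (Complex.polarCoord.symm p) := by
        simp only [Complex.polarCoord_symm_apply]
        exact hGm.comp (by fun_prop)
      exact (by fun_prop : Measurable fun p : ℝ × ℝ => ENNReal.ofReal p.1).mul this
    rw [lintegral_prod _ hpm.aemeasurable, ← lintegral_indicator measurableSet_Ioc]
    refine (lintegral_mono_ae ?_).trans (setLIntegral_le_lintegral (Ioi 0) _)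
    refine (ae_restrict_iff' measurableSet_Ioi).2 (.of_forall fun r (hr : 0 < r) => ?_)
    simp only [Complex.polarCoord_symm_apply, smul_eq_mul]
    have hexp : ∀ θ : ℝ, ((r : ℂ) * (Real.cos θ + Real.sin θ * I)) = r * exp (θ * I) := fun θ => by
      rw [exp_mul_I]; push_cast; rfl
    simp only [hexp]
    have hnr : ∀ θ : ℝ, ‖(r : ℂ) * exp (θ * I)‖ = r := fun θ => by
      rw [norm_mul, norm_exp_ofReal_mul_I, mul_one, norm_real, Real.norm_of_nonneg hr.le]
    by_cases hra : |1 - r| < a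
    swap
    · have : ∀ θ : ℝ, G (r * exp (θ * I)) = 0 := fun θ => by
        rw [hG, indicator_of_notMem]
        change ¬ |1 - ‖_‖| < a
        rwa [hnr]
      simp [this]
    have hrI : r ∈ Ioc (1 - a) (1 + a) := by
      rw [abs_lt] at hra
      constructor <;> linarith
    rw [indicator_of_mem hrI, lintegral_const_mul' _ _ ENNReal.ofReal_ne_top]
    have hr2 : r ≤ 2 := by linarith [hrI.2]
    have hGe : ∀ θ : ℝ, G (r * exp (θ * I)) =
        {θ : ℝ | infDist (exp (θ * I)) E ≤ ρ}.indicator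
          (fun _ => ENNReal.ofReal (k - Real.log (1 - r))) θ
        + (ball (0 : ℂ) 1).indicator W (r * exp (θ * I)) := fun θ => by
      have hmem : (r : ℂ) * exp (θ * I) ∈ {z : ℂ | |1 - ‖z‖| < a} := by
        change |1 - ‖_‖| < a
        rwa [hnr]
      have hdiv : (r : ℂ) * exp (θ * I) / ‖(r : ℂ) * exp (θ * I)‖ = exp (θ * I) := by
        rw [hnr]
        have : (r : ℂ) ≠ 0 := by exact_mod_cast hr.ne'
        field_simp
      rw [hG, indicator_of_mem hmem]
      congr 1
      by_cases hθ : infDist (exp (θ * I)) E ≤ ρ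
      · rw [indicator_of_mem (s := {θ : ℝ | infDist (exp (θ * I)) E ≤ ρ}) hθ, indicator_of_mem, hnr]
        change infDist (_ / _) E ≤ ρ
        rwa [hdiv]
      · rw [indicator_of_notMem (s := {θ : ℝ | infDist (exp (θ * I)) E ≤ ρ}) hθ,
          indicator_of_notMem]
        change ¬ infDist (_ / _) E ≤ ρ
        rwa [hdiv]
    have hmsΘ : MeasurableSet {θ : ℝ | infDist (exp (θ * I)) E ≤ ρ} :=
      (by fun_prop : Measurable fun θ : ℝ => exp (θ * I)) hΘm
    simp only [hGe]
    rw [lintegral_add_left (measurable_const.indicator hmsΘ), lintegral_indicator_const hmsΘ]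
    gcongr
    · exact (ENNReal.ofReal_le_ofReal hr2).trans (by simp)
    · rcases lt_or_ge r 1 with h | h
      · have : ∀ θ : ℝ, (r : ℂ) * exp (θ * I) ∈ ball (0 : ℂ) 1 := fun θ => by
          rw [mem_ball_zero_iff, hnr]; exact h
        simp only [indicator_of_mem (this _)]
        exact hW r hr h
      · have : ∀ θ : ℝ, (r : ℂ) * exp (θ * I) ∉ ball (0 : ℂ) 1 := fun θ => by
          rw [mem_ball_zero_iff, hnr]; exact not_lt.2 h
        simp [indicator_of_notMem (this _)]
  have hstep3 : ∫⁻ r in Ioc (1 - a) (1 + a),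
      2 * (ENNReal.ofReal (k - Real.log (1 - r)) * m + ENNReal.ofReal (ε / 20))
      ≤ 2 * (ENNReal.ofReal (2 * a * (k + 1 + Real.log (1 / a))) * m
        + ENNReal.ofReal (ε / 20) * ENNReal.ofReal (2 * a)) := by
    rw [lintegral_const_mul _ (by fun_prop), lintegral_add_right _ measurable_const,
      lintegral_mul_const _ (by fun_prop), setLIntegral_const, Real.volume_Ioc]
    gcongr
    · exact lintegral_log_le ha0 ha1 hk0
    · linarith
  have hlogs : k + 1 + Real.log (1 / a) ≤ 8 * Real.log (2 / ρ) := by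
    have h1 : Real.log (2 / ρ) = -(1 / 2) * Real.log δ - Real.log 7 := by
      rw [hρ, show (2 : ℝ) / (14 * √δ) = (7 * √δ)⁻¹ by field_simp; norm_num, Real.log_inv,
        Real.log_mul (by norm_num) hs.ne', Real.log_sqrt hδ0.le]
      ring
    have h2 : Real.log (1 / a) ≤ -Real.log δ := by
      rw [← Real.log_inv]
      apply Real.log_le_log (by positivity)
      rw [ha, ← one_div]
      apply one_div_le_one_div_of_le hδ0
      linarith
    rw [h1]
    linarith
  refine hstep1.trans (hstep2.trans (hstep3.trans ?_))
  have hm1 : ENNReal.ofReal (2 * a * (k + 1 + Real.log (1 / a))) * m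
      ≤ ENNReal.ofReal (16 * a) * ENNReal.ofReal (ε / 160) := by
    calc _ ≤ ENNReal.ofReal (16 * a * Real.log (2 / ρ)) * m := by
          refine mul_le_mul_left (ENNReal.ofReal_le_ofReal ?_) _
          nlinarith
      _ = ENNReal.ofReal (16 * a) * (m * ENNReal.ofReal (Real.log (2 / ρ))) := by
          rw [ENNReal.ofReal_mul (by positivity)]; ring
      _ ≤ _ := by gcongr
  calc _ ≤ 2 * (ENNReal.ofReal (16 * a) * ENNReal.ofReal (ε / 160)
        + ENNReal.ofReal (ε / 20) * ENNReal.ofReal (2 * a)) := by gcongr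
    _ = ENNReal.ofReal (2 * (16 * a * (ε / 160) + ε / 20 * (2 * a))) := by
        rw [← ENNReal.ofReal_mul (by positivity), ← ENNReal.ofReal_mul (by positivity),
          ← ENNReal.ofReal_add (by positivity) (by positivity),
          ENNReal.ofReal_mul (by norm_num : (0 : ℝ) ≤ 2)]
        simp
    _ ≤ _ := by
        apply ENNReal.ofReal_le_ofReal
        rw [ha]
        apply le_of_eq
        ring

end shellEstimate

section phragmenLindelof
variable {E : Set ℂ}

lemma posLog_subMean {X : ℂ → ℂ} {z : ℂ} {s : ℝ} (hs : 0 < s)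
    (hX : AnalyticOnNhd ℂ X (closedBall z s)) :
    ENNReal.ofReal (2 * Real.pi * Real.posLog ‖X z‖)
      ≤ ∫⁻ θ in Ioc (-Real.pi) Real.pi,
        ENNReal.ofReal (Real.posLog ‖X (z + s * exp ((θ : ℝ) * I))‖) := by
  set Y : ℂ → ℂ := fun w => X (z + w) with hY
  have hYa : AnalyticOnNhd ℂ Y (closedBall 0 s) := fun w hw => by
    have : AnalyticAt ℂ X (z + w) := hX _ (by simpa using hw)
    exact this.comp_of_eq (by fun_prop) rfl
  have h1 := posLog_norm_le_circleAverage hs hYa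
  have hYc : ContinuousOn (fun θ : ℝ => Real.posLog ‖X (z + s * exp (θ * I))‖)
      (Icc (-Real.pi) Real.pi) := by
    refine Real.continuous_posLog.comp_continuousOn (ContinuousOn.norm ?_)
    refine hX.continuousOn.comp (by fun_prop) fun θ _ => ?_
    rw [mem_closedBall_iff_norm, add_sub_cancel_left, norm_mul, norm_exp_ofReal_mul_I, mul_one,
      norm_real, Real.norm_of_nonneg hs.le]
  rw [← ofReal_integral_eq_lintegral_ofReal (hYc.integrableOn_Icc.mono_set Ioc_subset_Icc_self)
    (.of_forall fun _ => Real.posLog_nonneg),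
    ← intervalIntegral.integral_of_le (by linarith [Real.pi_pos]),
    integral_pi_eq_circleAverage (fun w => Real.posLog ‖Y w‖)]
  apply ENNReal.ofReal_le_ofReal
  have : Y 0 = X z := by rw [hY]; simp
  rw [← this]
  gcongr

theorem phragmen_lindelof (hE : IsCarleson E) (hne : E.Nonempty)
    (hnull : ∀ᵐ θ : ℝ ∂(volume.restrict (Ioo (-Real.pi) Real.pi)),
      0 < infDist (exp (θ * I)) E) {F : ℂ → ℂ} {C0 : ℝ}
    (hF : ∀ z, 1 < ‖z‖ → ‖F z‖ ≤ C0 / (‖z‖ - 1)) (hL : LogGrowth F) {X : ℂ → ℂ} {V : Set ℂ}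
    (hVo : IsOpen V) {κ : ℝ} (hκ : 0 < κ)
    (hV : ∀ z ∈ V, 0 < barrier E z → 1 < ‖X z‖ → closedBall z κ ⊆ V)
    (hXd : DifferentiableOn ℂ X (V ∩ {z | 0 < barrier E z})) {C : ℝ}
    (hXF : ∀ z ∈ V, 0 < barrier E z → ‖z‖ ≠ 1 → ‖X z‖ ≤ C * ‖F z‖)
    (hout : ∀ z ∈ V, 0 < barrier E z → infDist z E ^ 2 / 48 ≤ ‖z‖ ^ 2 - 1 → ‖X z‖ ≤ 1)
    {z : ℂ} (hzV : z ∈ V) (hz : 0 < barrier E z) : ‖X z‖ ≤ 1 := by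
  have hBo : IsOpen {z | 0 < barrier E z} := isOpen_lt continuous_const continuous_barrier
  have hXa : AnalyticOnNhd ℂ X (V ∩ {z | 0 < barrier E z}) := hXd.analyticOnNhd (hVo.inter hBo)
  set u : ℂ → ℝ := V.indicator fun z => Real.posLog ‖X z‖ with hu
  have hu0 : ∀ z, 0 ≤ u z := fun z => indicator_nonneg (fun _ _ => Real.posLog_nonneg) z
  have huV : ∀ z ∈ V, u z = Real.posLog ‖X z‖ := fun z hz => indicator_of_mem hz _
  have hu1 : ∀ z, 0 < barrier E z → u z ≠ 0 → z ∈ V ∧ 1 < ‖X z‖ := fun z _ hz0 => by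
    have hzV : z ∈ V := by
      by_contra h
      exact hz0 (indicator_of_notMem h _)
    refine ⟨hzV, ?_⟩
    rw [huV z hzV] at hz0
    by_contra h
    exact hz0 ((Real.posLog_eq_zero_iff _).2 (by rw [abs_norm]; exact not_lt.1 h))
  have huc : ContinuousOn u {z | 0 < barrier E z} := fun z (hz : 0 < barrier E z) => by
    by_cases hzV : z ∈ V
    · have h1 : ContinuousAt (fun z => Real.posLog ‖X z‖) z :=
        Real.continuous_posLog.continuousAt.comp (hXa z ⟨hzV, hz⟩).continuousAt.norm
      refine (h1.congr ?_).continuousWithinAt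
      filter_upwards [hVo.mem_nhds hzV] with w hw
      exact (huV w hw).symm
    · refine (continuousWithinAt_const (b := (0 : ℝ))).congr_of_eventuallyEq ?_
        (indicator_of_notMem hzV _)
      filter_upwards [self_mem_nhdsWithin, mem_nhdsWithin_of_mem_nhds (ball_mem_nhds z hκ)]
        with w hw hwz
      by_contra hw0
      obtain ⟨h1, h2⟩ := hu1 w hw hw0
      exact hzV (hV w h1 hw h2 (mem_closedBall'.2 (mem_ball.1 hwz).le))
  have hsmv : ∀ δ > 0, ∃ s0 > (0 : ℝ), ∀ s : ℝ, 0 < s → s < s0 → ∀ z, δ ≤ barrier E z →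
      ENNReal.ofReal (2 * Real.pi * u z)
        ≤ ∫⁻ θ in Ioc (-Real.pi) Real.pi, ENNReal.ofReal (u (z + s * exp ((θ : ℝ) * I))) := by
    intro δ hδ
    refine ⟨min (min 1 κ) (δ / 12), by positivity, fun s hs hss z hz => ?_⟩
    have hs1 : s ≤ 1 := hss.le.trans ((min_le_left _ _).trans (min_le_left _ _))
    have hsκ : s ≤ κ := hss.le.trans ((min_le_left _ _).trans (min_le_right _ _))
    have hsδ : s < δ / 12 := hss.trans_le (min_le_right _ _)
    have hz0 : 0 < barrier E z := hδ.trans_le hz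
    by_cases h0 : u z = 0
    · rw [h0]; simp
    obtain ⟨hzV, hz1⟩ := hu1 z hz0 h0
    have hsub : closedBall z s ⊆ V ∩ {z | 0 < barrier E z} := fun w hw => by
      refine ⟨hV z hzV hz0 hz1 (closedBall_subset_closedBall hsκ hw), ?_⟩
      rw [mem_closedBall_iff_norm] at hw
      have := barrier_add_ge hne hE.2.1 (norm_lt_two_of_barrier hne hE.2.1 hz0.le).le
        (hw.trans hs1)
      rw [add_sub_cancel] at this
      change 0 < barrier E w
      linarith
    have hmem : ∀ θ : ℝ, z + s * exp (θ * I) ∈ V := fun θ => by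
      refine (hsub ?_).1
      rw [mem_closedBall_iff_norm, add_sub_cancel_left, norm_mul, norm_exp_ofReal_mul_I, mul_one,
        norm_real, Real.norm_of_nonneg hs.le]
    simp only [huV _ (hmem _), huV z hzV]
    exact posLog_subMean hs (hXa.mono hsub)
  have hzero := eq_zero_of_subMean hne hE.1 hE.2.1 hu0 huc hsmv
    (fun ε hε => shell_estimate hE hne hnull (C1 := Real.posLog C) Real.posLog_nonneg hF hL
      (u := u) (fun w hw hwo => ?_) (fun w hw hw1 => ?_) hε) hz
  · rw [huV z hzV, Real.posLog_eq_zero_iff, abs_norm] at hzero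
    exact hzero
  · by_contra h0
    obtain ⟨h1, h2⟩ := hu1 w hw h0
    linarith [hout w h1 hw hwo]
  · by_cases hwV : w ∈ V
    · rw [huV w hwV]
      exact (Real.posLog_le_posLog (norm_nonneg _) (hXF w hwV hw hw1)).trans Real.posLog_mul
    · rw [hu, indicator_of_notMem hwV]
      exact add_nonneg Real.posLog_nonneg Real.posLog_nonneg

end phragmenLindelof

section isolatedSingularity

lemma isCarleson_singleton {p : ℂ} (hp : p ∈ sphere (0 : ℂ) 1) :
    IsCarleson {p} ∧ ∀ᵐ θ : ℝ ∂(volume.restrict (Ioo (-Real.pi) Real.pi)),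
      0 < infDist (exp (θ * I)) {p} := by
  have hpi := Real.pi_pos
  have hn : ∀ᵐ θ : ℝ, θ ∈ Ioc (-Real.pi) Real.pi → exp (θ * I) ≠ p := by
    have h1 : ∀ᵐ θ : ℝ, θ ≠ arg p := by
      have := measure_singleton (μ := volume) (arg p)
      rw [← compl_mem_ae_iff] at this
      exact this
    filter_upwards [h1] with θ hθ hmem h
    apply hθ
    rw [← h, exp_mul_I, arg_cos_add_sin_mul_I hmem]
  refine ⟨⟨isClosed_singleton, by simpa using hp, ?_⟩, ?_⟩
  · have hm : MeromorphicOn (fun z : ℂ => z - p) (sphere 0 |1|) := fun z _ => by fun_prop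
    have hc := hm.circleIntegrable_log_norm
    have h1 : IntervalIntegrable (fun θ : ℝ => Real.log ‖exp (θ * I) - p‖) volume
        0 (0 + 2 * Real.pi) := by
      simpa [CircleIntegrable, circleMap] using hc
    have hper : Function.Periodic (fun θ : ℝ => Real.log ‖exp (θ * I) - p‖) (2 * Real.pi) :=
      fun θ => by
        simp only
        congr 3
        push_cast
        rw [add_mul, exp_periodic]
    have h2 := hper.intervalIntegrable Real.two_pi_pos.ne' h1 (-Real.pi) Real.pi
    have h3 := (intervalIntegrable_iff_integrableOn_Ioc_of_le (by linarith)).1 h2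
    have h4 : IntegrableOn (fun θ : ℝ => Real.log 2 - Real.log ‖exp (θ * I) - p‖)
        (Ioc (-Real.pi) Real.pi) := by
      have hcst : IntegrableOn (fun _ : ℝ => Real.log 2) (Ioc (-Real.pi) Real.pi) := by simp
      exact hcst.sub h3
    refine h4.congr ?_
    refine (ae_restrict_iff' measurableSet_Ioc).2 ?_
    filter_upwards [hn] with θ hθ hmem
    have : ‖exp (θ * I) - p‖ ≠ 0 := norm_ne_zero_iff.2 (sub_ne_zero.2 (hθ hmem))
    rw [infDist_singleton, dist_eq_norm, Real.log_div two_ne_zero this]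
  · refine (ae_restrict_iff' measurableSet_Ioo).2 ?_
    filter_upwards [hn] with θ hθ hmem
    rw [infDist_singleton]
    exact dist_pos.2 (hθ (Ioo_subset_Ioc_self hmem))

lemma norm_le_of_hasSum_outer {c : ℕ → ℂ} {ε : ℝ} {N : ℕ} {B : ℝ} (hε : 0 ≤ ε)
    (hB : ∀ n, ‖c n‖ ≤ B) (hN : ∀ n, N ≤ n → ‖c n‖ ≤ ε) {z w : ℂ} (hz : 1 < ‖z‖)
    (hw : HasSum (fun n => c n / z ^ (n + 1)) w) : ‖w‖ ≤ N * B + ε / (‖z‖ - 1) := by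
  have hz0 : 0 < ‖z‖ := by linarith
  have hB0 : 0 ≤ B := (norm_nonneg _).trans (hB 0)
  have hg : HasSum (fun n : ℕ => ε / ‖z‖ * (‖z‖⁻¹) ^ n) (ε / ‖z‖ * (1 - ‖z‖⁻¹)⁻¹) :=
    (hasSum_geometric_of_lt_one (by positivity) (inv_lt_one_of_one_lt₀ hz)).mul_left _
  have hfin : HasSum (fun n : ℕ => if n ∈ Finset.range N then B else 0)
      (∑ n ∈ Finset.range N, if n ∈ Finset.range N then B else 0) :=
    hasSum_sum_of_ne_finset_zero fun n hn => if_neg hn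
  have hsum := hfin.add hg
  have hle : ∀ n, ‖c n / z ^ (n + 1)‖ ≤ (if n ∈ Finset.range N then B else 0)
      + ε / ‖z‖ * (‖z‖⁻¹) ^ n := fun n => by
    rw [norm_div, norm_pow]
    have hp : 1 ≤ ‖z‖ ^ (n + 1) := one_le_pow₀ hz.le
    by_cases hn : n < N
    · rw [if_pos (Finset.mem_range.2 hn)]
      have h1 : ‖c n‖ / ‖z‖ ^ (n + 1) ≤ ‖c n‖ := div_le_self (norm_nonneg _) hp
      have h2 : 0 ≤ ε / ‖z‖ * (‖z‖⁻¹) ^ n := by positivity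
      linarith [hB n]
    · rw [if_neg (by simpa using hn), zero_add]
      have : ε / ‖z‖ * (‖z‖⁻¹) ^ n = ε / ‖z‖ ^ (n + 1) := by
        rw [pow_succ, inv_pow]; field_simp
      rw [this]
      gcongr
      exact hN n (not_lt.1 hn)
  have := hw.norm_le_of_bounded hsum hle
  refine this.trans (le_of_eq ?_)
  congr 1
  · rw [Finset.sum_congr rfl fun n hn => if_pos hn]; simp
  · have : ‖z‖ - 1 ≠ 0 := by linarith
    field_simp

lemma exists_bound_of_hasSum_outer {c : ℕ → ℂ} (hc : Tendsto c atTop (nhds 0)) {F : ℂ → ℂ}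
    (hF : ∀ z, 1 < ‖z‖ → HasSum (fun n => c n / z ^ (n + 1)) (F z)) :
    ∃ C0, 0 ≤ C0 ∧ ∀ z, 1 < ‖z‖ → ‖F z‖ ≤ C0 / (‖z‖ - 1) := by
  obtain ⟨B, hB⟩ := hc.norm.bddAbove_range
  have hB' : ∀ n, ‖c n‖ ≤ B := fun n => hB ⟨n, rfl⟩
  have hB0 : 0 ≤ B := (norm_nonneg _).trans (hB' 0)
  refine ⟨B, hB0, fun z hz => ?_⟩
  have := norm_le_of_hasSum_outer (N := 0) hB0 hB' (fun n _ => hB' n) hz (hF z hz)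
  simpa using this

lemma tendsto_radial_of_hasSum_outer {c : ℕ → ℂ} (hc : Tendsto c atTop (nhds 0)) {F : ℂ → ℂ}
    (hF : ∀ z, 1 < ‖z‖ → HasSum (fun n => c n / z ^ (n + 1)) (F z)) {p : ℂ} (hp : ‖p‖ = 1) :
    Tendsto (fun t : ℝ => ((t : ℂ) * p - p) * F (t * p)) (nhdsWithin 1 (Ioi 1)) (nhds 0) := by
  obtain ⟨B, hB⟩ := hc.norm.bddAbove_range
  have hB' : ∀ n, ‖c n‖ ≤ B := fun n => hB ⟨n, rfl⟩
  have hB0 : 0 ≤ B := (norm_nonneg _).trans (hB' 0)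
  rw [tendsto_zero_iff_norm_tendsto_zero]
  refine tendsto_order.2 ⟨fun a ha => .of_forall fun t => ha.trans_le (norm_nonneg _),
    fun ε hε => ?_⟩
  have hN := hc.norm.eventually (gt_mem_nhds (by simpa using half_pos hε : ‖(0 : ℂ)‖ < ε / 2))
  obtain ⟨N, hN⟩ := eventually_atTop.1 hN
  have h1 : Tendsto (fun t : ℝ => (t - 1) * (N * B)) (nhdsWithin 1 (Ioi 1)) (nhds 0) := by
    have : Continuous fun t : ℝ => (t - 1) * (N * B) := by fun_prop
    have := (this.tendsto 1).mono_left (nhdsWithin_le_nhds (s := Ioi 1))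
    simpa using this
  filter_upwards [h1.eventually (gt_mem_nhds (half_pos hε)), self_mem_nhdsWithin] with t ht ht1
  have ht1' : 1 < t := ht1
  have hnt : ‖(t : ℂ) * p‖ = t := by
    rw [norm_mul, hp, mul_one, norm_real, Real.norm_of_nonneg (by linarith)]
  have h2 := norm_le_of_hasSum_outer (by positivity) hB' (fun n hn => (hN n hn).le)
    (by rw [hnt]; exact ht1') (hF (t * p) (by rw [hnt]; exact ht1'))
  rw [hnt] at h2
  have h3 : ‖(t : ℂ) * p - p‖ = t - 1 := by
    rw [show (t : ℂ) * p - p = ((t - 1 : ℝ) : ℂ) * p by push_cast; ring, norm_mul, hp, mul_one,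
      norm_real, Real.norm_of_nonneg (by linarith)]
  rw [norm_mul, h3]
  have ht0 : 0 < t - 1 := by linarith
  calc (t - 1) * ‖F (t * p)‖ ≤ (t - 1) * (N * B + ε / 2 / (t - 1)) := by gcongr
    _ = (t - 1) * (N * B) + ε / 2 := by field_simp
    _ < ε := by linarith

lemma norm_sub_one_ge {d x : ℝ} (h : d ^ 2 / 48 ≤ x ^ 2 - 1) (hx0 : 0 ≤ x) (hx : x ≤ 2) :
    d ^ 2 / 144 ≤ x - 1 := by
  nlinarith [sq_nonneg d]

/-- Isolated singularities on the circle are removable. -/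
theorem exists_extension_of_isolated {c : ℕ → ℂ} (hc : Tendsto c atTop (nhds 0)) {F : ℂ → ℂ}
    (hF : ∀ z, 1 < ‖z‖ → HasSum (fun n => c n / z ^ (n + 1)) (F z)) (hL : LogGrowth F)
    {p : ℂ} (hp : ‖p‖ = 1) {κ : ℝ} (hκ0 : 0 < κ) (hκ1 : κ ≤ 1)
    (hd : DifferentiableOn ℂ F (ball p κ \ {p})) :
    ∃ G : ℂ → ℂ, DifferentiableOn ℂ G (ball p (κ / 2)) ∧ ∀ z ∈ ball p (κ / 2), z ≠ p →
      G z = F z := by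
  obtain ⟨C0, hC00, hC0⟩ := exists_bound_of_hasSum_outer hc hF
  obtain ⟨hE, hnull⟩ := isCarleson_singleton (p := p) (by simpa using hp)
  set h : ℂ → ℂ := fun z => (z - p) ^ 2 * F z with hh
  have hhd : DifferentiableOn ℂ h (ball p κ \ {p}) :=
    DifferentiableOn.mul (by fun_prop) hd
  have hcomp : IsCompact (closedBall p (κ / 2) \ ball p (κ / 4)) :=
    (isCompact_closedBall p _).diff isOpen_ball
  have hcsub : closedBall p (κ / 2) \ ball p (κ / 4) ⊆ ball p κ \ {p} := fun z hz => by
    refine ⟨closedBall_subset_ball (by linarith) hz.1, ?_⟩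
    rintro rfl
    exact hz.2 (mem_ball_self (by linarith))
  obtain ⟨B, hB⟩ := hcomp.exists_bound_of_continuousOn (hhd.continuousOn.mono hcsub)
  set M := max (144 * C0) B + 1 with hM
  have hM0 : 0 < M := by positivity
  have hdist : ∀ z ∈ ball p (κ / 2), ‖z - p‖ ≤ 1 := fun z hz => by
    rw [mem_ball_iff_norm] at hz
    linarith
  have hout : ∀ z ∈ ball p (κ / 2), z ≠ p → dist z p ^ 2 / 48 ≤ ‖z‖ ^ 2 - 1 → ‖h z‖ ≤ M :=
    fun z hz hzp ho => by
      have hz1 := hdist z hz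
      have hz2 : ‖z‖ ≤ 2 := by
        have := norm_le_norm_add_norm_sub' z p
        rw [hp] at this
        linarith
      have h1 := norm_sub_one_ge ho (norm_nonneg _) hz2
      have hpos : 0 < dist z p := dist_pos.2 hzp
      have h2 : 1 < ‖z‖ := by nlinarith [pow_pos hpos 2]
      have h3 := hC0 z h2
      have h4 : ‖h z‖ = dist z p ^ 2 * ‖F z‖ := by rw [hh, norm_mul, norm_pow, dist_eq_norm]
      rw [h4]
      calc dist z p ^ 2 * ‖F z‖ ≤ dist z p ^ 2 * (C0 / (dist z p ^ 2 / 144)) := by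
            gcongr
            exact h3.trans (by gcongr)
        _ = 144 * C0 := by field_simp
        _ ≤ M := by linarith [le_max_left (144 * C0) B]
  have hbp : barrier {p} p = 0 := by rw [barrier, hp, infDist_singleton]; simp
  have hin : ∀ z ∈ ball p (κ / 2), 0 < barrier {p} z → ‖h z / M‖ ≤ 1 := fun z hz hb => by
    refine phragmen_lindelof (X := fun z => h z / M) hE (singleton_nonempty p) hnull hC0 hL
      (V := ball p (κ / 2)) isOpen_ball (κ := κ / 8) (by positivity) (fun z hz _ hX => ?_)
      ?_ (C := 1 / M) (fun z hz _ _ => ?_) (fun z hz hb ho => ?_) hz hb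
    · have hzn : z ∈ ball p (κ / 4) := by
        by_contra hcon
        have h1 := hB z ⟨ball_subset_closedBall hz, hcon⟩
        rw [norm_div, norm_real, Real.norm_of_nonneg hM0.le, one_lt_div hM0] at hX
        linarith [le_max_right (144 * C0) B]
      refine (closedBall_subset_ball' ?_)
      rw [mem_ball] at hzn
      linarith
    · refine DifferentiableOn.div_const (hhd.mono ?_) _
      rintro z ⟨hz, hb⟩
      refine ⟨ball_subset_ball (by linarith) hz, ?_⟩
      rintro rfl
      have hb' : 0 < barrier {z} z := hb
      linarith
    · rw [hh, norm_div, norm_mul, norm_pow, norm_real, Real.norm_of_nonneg hM0.le, one_div,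
        div_eq_inv_mul]
      gcongr
      have := hdist z hz
      have h2 : ‖z - p‖ ^ 2 ≤ 1 := pow_le_one₀ (norm_nonneg _) this
      nlinarith [norm_nonneg (F z)]
    · rw [infDist_singleton] at ho
      have hzp : z ≠ p := by rintro rfl; linarith
      have := hout z hz hzp ho
      rw [norm_div, norm_real, Real.norm_of_nonneg hM0.le]
      exact (div_le_one hM0).2 this
  have hbd : ∀ z ∈ ball p (κ / 2) \ {p}, ‖h z‖ ≤ M := fun z hz => by
    rcases lt_or_ge 0 (barrier {p} z) with hb | hb
    · have := hin z hz.1 hb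
      rwa [norm_div, norm_real, Real.norm_of_nonneg hM0.le, div_le_one hM0] at this
    · refine hout z hz.1 hz.2 ?_
      rw [barrier, infDist_singleton] at hb
      nlinarith [sq_nonneg (dist z p)]
  have hnh : ball p (κ / 2) ∈ nhds p := ball_mem_nhds p (by positivity)
  set H := Function.update h p (limUnder (nhdsWithin p {p}ᶜ) h) with hH
  have hHd : DifferentiableOn ℂ H (ball p (κ / 2)) :=
    Complex.differentiableOn_update_limUnder_of_bddAbove hnh
      (hhd.mono (sdiff_subset_sdiff_left (ball_subset_ball (by linarith))))
      ⟨M, by rintro _ ⟨z, hz, rfl⟩; exact hbd z hz⟩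
  have hHe : ∀ z, z ≠ p → H z = h z := fun z hz => Function.update_of_ne hz _ _
  have hrad := tendsto_radial_of_hasSum_outer hc hF hp
  have hline : Tendsto (fun t : ℝ => (t : ℂ) * p) (nhdsWithin 1 (Ioi 1)) (nhds p) := by
    have : Continuous fun t : ℝ => (t : ℂ) * p := by fun_prop
    have := (this.tendsto 1).mono_left (nhdsWithin_le_nhds (s := Ioi 1))
    simpa using this
  have hp0 : p ≠ 0 := by rintro rfl; simp at hp
  have hnep : ∀ t : ℝ, 1 < t → (t : ℂ) * p ≠ p := fun t ht h => by
    have := congrArg norm h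
    rw [norm_mul, hp, norm_real, Real.norm_of_nonneg (by linarith)] at this
    linarith
  have hHp : H p = 0 := by
    have h1 := (hHd.differentiableAt hnh).continuousAt.tendsto.comp hline
    refine tendsto_nhds_unique h1 ?_
    have h2 := (hline.sub_const p).mul hrad
    rw [mul_zero] at h2
    refine h2.congr' ?_
    filter_upwards [self_mem_nhdsWithin] with t ht
    rw [Function.comp_apply, hHe _ (hnep t ht), hh]
    ring
  set G1 := dslope H p with hG1
  have hG1d : DifferentiableOn ℂ G1 (ball p (κ / 2)) := (differentiableOn_dslope hnh).2 hHd
  have hG1e : ∀ z, z ≠ p → G1 z = (z - p) * F z := fun z hz => by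
    rw [hG1, dslope_of_ne _ hz, slope_def_field, hHp, hHe z hz, hh]
    have := sub_ne_zero.2 hz
    field_simp
    ring
  have hG1p : G1 p = 0 := by
    have h1 := (hG1d.differentiableAt hnh).continuousAt.tendsto.comp hline
    refine tendsto_nhds_unique h1 (hrad.congr' ?_)
    filter_upwards [self_mem_nhdsWithin] with t ht
    rw [Function.comp_apply, hG1e _ (hnep t ht)]
  refine ⟨dslope G1 p, (differentiableOn_dslope hnh).2 hG1d, fun z _ hzp => ?_⟩
  rw [dslope_of_ne _ hzp, slope_def_field, hG1p, hG1e z hzp]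
  have := sub_ne_zero.2 hzp
  field_simp
  ring

end isolatedSingularity

section outerMultiplier
variable {E : Set ℂ}

/-- The point at height `dist(e^{iθ}, E)` above `e^{iθ}`. -/
def pole (E : Set ℂ) (θ : ℝ) : ℂ := exp (θ * I) * ((1 + infDist (exp (θ * I)) E : ℝ) : ℂ)

lemma continuous_pole : Continuous (pole E) := by
  have : Continuous fun θ : ℝ => infDist (exp (θ * I)) E :=
    (continuous_infDist_pt E).comp (by fun_prop)
  unfold pole
  fun_prop

lemma norm_pole (θ : ℝ) : ‖pole E θ‖ = 1 + infDist (exp (θ * I)) E := by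
  rw [pole, norm_mul, norm_exp_ofReal_mul_I, one_mul, norm_real,
    Real.norm_of_nonneg (by have := infDist_nonneg (x := exp (θ * I)) (s := E); linarith)]

lemma norm_pole_sub_exp (θ : ℝ) : ‖pole E θ - exp (θ * I)‖ = infDist (exp (θ * I)) E := by
  rw [pole, show exp (θ * I) * ((1 + infDist (exp (θ * I)) E : ℝ) : ℂ) - exp (θ * I)
    = exp (θ * I) * ((infDist (exp (θ * I)) E : ℝ) : ℂ) by push_cast; ring, norm_mul,
    norm_exp_ofReal_mul_I, one_mul, norm_real, Real.norm_of_nonneg infDist_nonneg]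

lemma infDist_exp_le_two (hne : E.Nonempty) (hsub : E ⊆ sphere 0 1) (θ : ℝ) :
    infDist (exp (θ * I)) E ≤ 2 := by
  have := infDist_le_norm_add_one hne hsub (exp (θ * I))
  rw [norm_exp_ofReal_mul_I] at this
  linarith

lemma infDist_pos_of_barrier (hcl : IsClosed E) (hne : E.Nonempty) (hsub : E ⊆ sphere 0 1) {z : ℂ}
    (hz : 0 < barrier E z) : 0 < infDist z E := by
  refine (hcl.notMem_iff_infDist_pos hne).1 fun h => ?_
  have h1 : ‖z‖ = 1 := by simpa using hsub h
  rw [barrier, h1, infDist_zero_of_mem h] at hz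
  simp at hz

lemma norm_le_of_barrier (hne : E.Nonempty) (hsub : E ⊆ sphere 0 1) {z : ℂ}
    (hz : 0 < barrier E z) : ‖z‖ ≤ 1 + infDist z E ^ 2 / 48 ∧ infDist z E ≤ 3 := by
  have h2 := (norm_lt_two_of_barrier hne hsub hz.le).le
  have h3 := infDist_le_norm_add_one hne hsub z
  rw [barrier] at hz
  refine ⟨?_, by linarith⟩
  rcases le_or_gt ‖z‖ 1 with h | h
  · have := sq_nonneg (infDist z E)
    linarith
  · nlinarith

lemma norm_pole_sub_ge (hne : E.Nonempty) (hsub : E ⊆ sphere 0 1) {z : ℂ}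
    (hz : 0 < barrier E z) (θ : ℝ) : 7 * infDist z E / 24 ≤ ‖pole E θ - z‖ := by
  obtain ⟨h1, h2⟩ := norm_le_of_barrier hne hsub hz
  have h3 : infDist z E ≤ infDist (exp (θ * I)) E + dist z (exp (θ * I)) :=
    infDist_le_infDist_add_dist
  have h4 : dist z (exp (θ * I)) ≤ ‖pole E θ - z‖ + infDist (exp (θ * I)) E := by
    rw [← norm_pole_sub_exp (E := E) θ, dist_eq_norm,
      show z - exp (θ * I) = -(pole E θ - z) + (pole E θ - exp (θ * I)) by ring]
    refine (norm_add_le _ _).trans ?_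
    rw [norm_neg]
  have h5 : 1 + infDist (exp (θ * I)) E ≤ ‖pole E θ - z‖ + ‖z‖ := by
    rw [← norm_pole]
    have := norm_add_le (pole E θ - z) z
    rwa [sub_add_cancel] at this
  have h6 := infDist_nonneg (x := z) (s := E)
  nlinarith

lemma pole_sub_ne_zero (hcl : IsClosed E) (hne : E.Nonempty) (hsub : E ⊆ sphere 0 1) {z : ℂ}
    (hz : 0 < barrier E z) (θ : ℝ) : pole E θ - z ≠ 0 := by
  have h1 := norm_pole_sub_ge hne hsub hz θ
  have h2 := infDist_pos_of_barrier hcl hne hsub hz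
  rw [← norm_pos_iff]
  linarith

lemma re_herglotz (a z : ℂ) :
    ((a + z) / (a - z)).re = (‖a‖ ^ 2 - ‖z‖ ^ 2) / ‖a - z‖ ^ 2 := by
  rw [div_re, ← normSq_eq_norm_sq, ← normSq_eq_norm_sq, ← normSq_eq_norm_sq, ← add_div]
  congr 1
  simp only [normSq_apply, add_re, sub_re, add_im, sub_im]
  ring

lemma neg_one_le_re_herglotz (hcl : IsClosed E) (hne : E.Nonempty) (hsub : E ⊆ sphere 0 1) {z : ℂ}
    (hz : 0 < barrier E z) (θ : ℝ) : -1 ≤ ((pole E θ + z) / (pole E θ - z)).re := by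
  have h1 := norm_pole_sub_ge hne hsub hz θ
  have h2 := infDist_pos_of_barrier hcl hne hsub hz
  have h3 : 0 ≤ infDist (exp (θ * I)) E := infDist_nonneg
  rw [re_herglotz, le_div_iff₀ (by have : 0 < ‖pole E θ - z‖ := by linarith
                                   positivity), norm_pole]
  rw [barrier] at hz
  have : (7 * infDist z E / 24) ^ 2 ≤ ‖pole E θ - z‖ ^ 2 := by gcongr
  nlinarith

lemma norm_herglotz_le (hcl : IsClosed E) (hne : E.Nonempty) (hsub : E ⊆ sphere 0 1) {z : ℂ}
    (hz : 0 < barrier E z) (θ : ℝ) : ‖(pole E θ + z) / (pole E θ - z)‖ ≤ 18 / infDist z E := by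
  have h1 := norm_pole_sub_ge hne hsub hz θ
  have h2 := infDist_pos_of_barrier hcl hne hsub hz
  have h3 := infDist_exp_le_two hne hsub θ
  have h4 := norm_lt_two_of_barrier hne hsub hz.le
  have h5 := norm_add_le (pole E θ) z
  rw [norm_pole] at h5
  have h6 : 0 < ‖pole E θ - z‖ := by linarith
  rw [norm_div, div_le_div_iff₀ h6 h2]
  nlinarith

lemma norm_herglotz_sub_le (hcl : IsClosed E) (hne : E.Nonempty) (hsub : E ⊆ sphere 0 1) {z w : ℂ}
    (hz : 0 < barrier E z) (hw : 0 < barrier E w) (θ : ℝ) :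
    ‖(pole E θ + z) / (pole E θ - z) - (pole E θ + w) / (pole E θ - w)‖
      ≤ 72 * ‖z - w‖ / (infDist z E * infDist w E) := by
  have h1 := norm_pole_sub_ge hne hsub hz θ
  have h1' := norm_pole_sub_ge hne hsub hw θ
  have h2 := infDist_pos_of_barrier hcl hne hsub hz
  have h2' := infDist_pos_of_barrier hcl hne hsub hw
  have h3 := infDist_exp_le_two hne hsub θ
  have hz0 := pole_sub_ne_zero hcl hne hsub hz θ
  have hw0 := pole_sub_ne_zero hcl hne hsub hw θ
  have h6 : 0 < ‖pole E θ - z‖ := by linarith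
  have h6' : 0 < ‖pole E θ - w‖ := by linarith
  have : (pole E θ + z) / (pole E θ - z) - (pole E θ + w) / (pole E θ - w)
      = 2 * pole E θ * (z - w) / ((pole E θ - z) * (pole E θ - w)) := by
    field_simp
    ring
  rw [this, norm_div, norm_mul, norm_mul, norm_mul, norm_pole, Complex.norm_two]
  calc 2 * (1 + infDist (exp (θ * I)) E) * ‖z - w‖ / (‖pole E θ - z‖ * ‖pole E θ - w‖)
      ≤ 2 * (1 + 2) * ‖z - w‖ / ((7 * infDist z E / 24) * (7 * infDist w E / 24)) := by gcongr
    _ = (3456 / 49) * (‖z - w‖ / (infDist z E * infDist w E)) := by field_simp; ring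
    _ ≤ 72 * (‖z - w‖ / (infDist z E * infDist w E)) := by gcongr; norm_num
    _ = _ := by ring

/-- The Herglotz-type integral of the weight `L` with poles above the circle. -/
def herglotz (E : Set ℂ) (L : ℝ → ℝ) (z : ℂ) : ℂ :=
  ∫ θ in Ioc (-Real.pi) Real.pi, (L θ : ℂ) * ((pole E θ + z) / (pole E θ - z))

/-- The multiplier with log-modulus weight `L`. -/
def multiplier (E : Set ℂ) (L : ℝ → ℝ) (z : ℂ) : ℂ :=
  exp (-((1 / (2 * Real.pi) : ℝ) : ℂ) * herglotz E L z)

variable {L : ℝ → ℝ}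

lemma aestronglyMeasurable_herglotz (hL : IntegrableOn L (Ioc (-Real.pi) Real.pi)) (z : ℂ) :
    AEStronglyMeasurable (fun θ => (L θ : ℂ) * ((pole E θ + z) / (pole E θ - z)))
      (volume.restrict (Ioc (-Real.pi) Real.pi)) := by
  have h1 := hL.ofReal (𝕜 := ℂ) |>.aestronglyMeasurable
  have h2 := (continuous_pole (E := E)).measurable
  exact h1.mul (by fun_prop : Measurable fun θ =>
    (pole E θ + z) / (pole E θ - z)).aestronglyMeasurable

lemma integrableOn_herglotz (hcl : IsClosed E) (hne : E.Nonempty) (hsub : E ⊆ sphere 0 1)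
    (hL : IntegrableOn L (Ioc (-Real.pi) Real.pi)) {z : ℂ} (hz : 0 < barrier E z) :
    IntegrableOn (fun θ => (L θ : ℂ) * ((pole E θ + z) / (pole E θ - z)))
      (Ioc (-Real.pi) Real.pi) := by
  refine (hL.norm.mul_const (18 / infDist z E)).mono' (aestronglyMeasurable_herglotz hL z)
    (.of_forall fun θ => ?_)
  rw [norm_mul, norm_real]
  gcongr
  exact norm_herglotz_le hcl hne hsub hz θ

lemma differentiableOn_multiplier (hcl : IsClosed E) (hne : E.Nonempty) (hsub : E ⊆ sphere 0 1)
    (hL : IntegrableOn L (Ioc (-Real.pi) Real.pi)) :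
    DifferentiableOn ℂ (multiplier E L) {z | 0 < barrier E z} := by
  intro z (hz : 0 < barrier E z)
  have hBo : IsOpen {z | 0 < barrier E z} := isOpen_lt continuous_const continuous_barrier
  have hdz := infDist_pos_of_barrier hcl hne hsub hz
  have hU : {z | 0 < barrier E z} ∩ {w | infDist z E / 2 < infDist w E} ∈ nhds z :=
    (hBo.inter (isOpen_lt continuous_const (continuous_infDist_pt E))).mem_nhds
      ⟨hz, by change infDist z E / 2 < infDist z E; linarith⟩
  obtain ⟨r, hr, hrU⟩ := Metric.mem_nhds_iff.1 hU
  have hm := (continuous_pole (E := E)).measurable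
  have key := hasDerivAt_integral_of_dominated_loc_of_deriv_le
    (μ := volume.restrict (Ioc (-Real.pi) Real.pi))
    (F := fun (w : ℂ) θ => (L θ : ℂ) * ((pole E θ + w) / (pole E θ - w)))
    (F' := fun (w : ℂ) θ => (L θ : ℂ) * (2 * pole E θ / (pole E θ - w) ^ 2)) (x₀ := z)
    (s := ball z r) (bound := fun θ => ‖L θ‖ * (2 * (1 + 2) / (7 * (infDist z E / 2) / 24) ^ 2))
    (ball_mem_nhds z hr) (.of_forall fun w => aestronglyMeasurable_herglotz hL w)
    (integrableOn_herglotz hcl hne hsub hL hz)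
    ((hL.ofReal (𝕜 := ℂ) |>.aestronglyMeasurable).mul
      (by fun_prop : Measurable fun θ => 2 * pole E θ / (pole E θ - z) ^ 2).aestronglyMeasurable)
    (.of_forall fun θ w hw => ?_) (hL.norm.mul_const _) (.of_forall fun θ w hw => ?_)
  · have : DifferentiableAt ℂ (herglotz E L) z := key.2.differentiableAt
    exact ((this.const_mul (-((1 / (2 * Real.pi) : ℝ) : ℂ))).cexp).differentiableWithinAt
  · obtain ⟨hw1, hw2⟩ := hrU hw
    have hw2' : infDist z E / 2 < infDist w E := hw2
    have h1 := norm_pole_sub_ge hne hsub hw1 θ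
    rw [norm_mul, norm_real, norm_div, norm_mul, norm_pow, norm_pole, Complex.norm_two]
    gcongr
    · exact infDist_exp_le_two hne hsub θ
    · linarith
  · obtain ⟨hw1, -⟩ := hrU hw
    have h0 := pole_sub_ne_zero hcl hne hsub hw1 θ
    have h1 : HasDerivAt (fun w => pole E θ + w) 1 w := (hasDerivAt_id w).const_add _
    have h2 : HasDerivAt (fun w => pole E θ - w) (-1) w := (hasDerivAt_id w).const_sub _
    have h3 := (h1.div h2 h0).const_mul (L θ : ℂ)
    have e : (1 * (pole E θ - w) - (pole E θ + w) * -1) = 2 * pole E θ := by ring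
    rw [e] at h3
    exact h3

lemma norm_multiplier (hcl : IsClosed E) (hne : E.Nonempty) (hsub : E ⊆ sphere 0 1)
    (hL : IntegrableOn L (Ioc (-Real.pi) Real.pi)) {z : ℂ} (hz : 0 < barrier E z) :
    ‖multiplier E L z‖ = Real.exp (-(1 / (2 * Real.pi)) *
      ∫ θ in Ioc (-Real.pi) Real.pi, L θ * ((pole E θ + z) / (pole E θ - z)).re) ∧
    IntegrableOn (fun θ => L θ * ((pole E θ + z) / (pole E θ - z)).re)
      (Ioc (-Real.pi) Real.pi) := by
  have hi := integrableOn_herglotz hcl hne hsub hL hz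
  have h1 : ∀ θ, ((L θ : ℂ) * ((pole E θ + z) / (pole E θ - z))).re
      = L θ * ((pole E θ + z) / (pole E θ - z)).re := fun θ => re_ofReal_mul _ _
  have h2 := hi.re
  simp only [RCLike.re_to_complex, h1] at h2
  refine ⟨?_, h2⟩
  rw [multiplier, norm_exp, ← ofReal_neg, re_ofReal_mul, herglotz]
  congr 2
  have h3 := integral_re hi
  simp only [RCLike.re_to_complex, h1] at h3
  exact h3.symm

lemma norm_multiplier_le (hcl : IsClosed E) (hne : E.Nonempty) (hsub : E ⊆ sphere 0 1)
    (hL : IntegrableOn L (Ioc (-Real.pi) Real.pi)) (hL0 : ∀ θ, 0 ≤ L θ) {z : ℂ}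
    (hz : 0 < barrier E z) {s t m : ℝ} (hst : s ≤ t) (hI : Ioc s t ⊆ Ioc (-Real.pi) Real.pi)
    (hm : ∀ θ ∈ Ioc s t, m ≤ L θ * ((pole E θ + z) / (pole E θ - z)).re) :
    ‖multiplier E L z‖ ≤ Real.exp (1 / (2 * Real.pi) *
      ((∫ θ in Ioc (-Real.pi) Real.pi, L θ) - (t - s) * m)) := by
  obtain ⟨h1, h2⟩ := norm_multiplier hcl hne hsub hL hz
  rw [h1]
  apply Real.exp_le_exp.2
  rw [neg_mul, ← mul_neg]
  have hpi := Real.pi_pos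
  gcongr
  have hind : IntegrableOn ((Ioc s t).indicator fun _ => m) (Ioc (-Real.pi) Real.pi) :=
    (integrable_indicator_iff measurableSet_Ioc).2 (integrableOn_const (by
      rw [Measure.restrict_apply measurableSet_Ioc]
      exact (lt_of_le_of_lt (measure_mono inter_subset_left) measure_Ioc_lt_top).ne))
  have h3 : ∫ θ in Ioc (-Real.pi) Real.pi, (Ioc s t).indicator (fun _ => m) θ = (t - s) * m := by
    rw [setIntegral_indicator measurableSet_Ioc, inter_eq_self_of_subset_right hI,
      setIntegral_const, Real.volume_real_Ioc_of_le hst, smul_eq_mul]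
  rw [← h3, ← integral_sub hL hind, ← integral_neg]
  refine integral_mono h2.neg (hL.sub hind) fun θ => ?_
  have h4 := neg_one_le_re_herglotz hcl hne hsub hz θ
  by_cases hθ : θ ∈ Ioc s t
  · simp only [indicator_of_mem hθ]
    have := hm θ hθ
    linarith [hL0 θ]
  · simp only [indicator_of_notMem hθ]
    nlinarith [hL0 θ]

lemma norm_multiplier_le_mul (hcl : IsClosed E) (hne : E.Nonempty) (hsub : E ⊆ sphere 0 1)
    (hL : IntegrableOn L (Ioc (-Real.pi) Real.pi)) (hL0 : ∀ θ, 0 ≤ L θ) {z w : ℂ}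
    (hz : 0 < barrier E z) (hw : 0 < barrier E w) {k : ℝ}
    (hk : 72 * ‖z - w‖ / (infDist z E * infDist w E) ≤ k) :
    ‖multiplier E L z‖ ≤ Real.exp (1 / (2 * Real.pi) *
      ((∫ θ in Ioc (-Real.pi) Real.pi, L θ) * k)) * ‖multiplier E L w‖ := by
  obtain ⟨h1, h2⟩ := norm_multiplier hcl hne hsub hL hz
  obtain ⟨h1', h2'⟩ := norm_multiplier hcl hne hsub hL hw
  rw [h1, h1', ← Real.exp_add]
  apply Real.exp_le_exp.2
  rw [neg_mul, neg_mul, ← mul_neg, ← mul_neg, ← mul_add]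
  have hpi := Real.pi_pos
  gcongr
  rw [← integral_mul_const, ← sub_eq_add_neg, ← integral_sub (hL.mul_const k) h2', ← integral_neg]
  refine integral_mono h2.neg ((hL.mul_const k).sub h2') fun θ => ?_
  have h3 := (norm_herglotz_sub_le hcl hne hsub hz hw θ).trans hk
  have h4 := (abs_re_le_norm _).trans h3
  rw [sub_re, abs_le] at h4
  have := hL0 θ
  simp only
  nlinarith [h4.1]

lemma norm_herglotz_integral_le (hcl : IsClosed E) (hne : E.Nonempty) (hsub : E ⊆ sphere 0 1)
    (hL : IntegrableOn L (Ioc (-Real.pi) Real.pi)) (hL0 : ∀ θ, 0 ≤ L θ) {z : ℂ}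
    (hz : 0 < barrier E z) :
    ‖herglotz E L z‖ ≤ (∫ θ in Ioc (-Real.pi) Real.pi, L θ) * (18 / infDist z E) := by
  rw [← integral_mul_const]
  refine norm_integral_le_of_norm_le (hL.mul_const _) (.of_forall fun θ => ?_)
  rw [norm_mul, norm_real, Real.norm_of_nonneg (hL0 θ)]
  exact mul_le_mul_of_nonneg_left (norm_herglotz_le hcl hne hsub hz θ) (hL0 θ)

end outerMultiplier

section multiplierSequence
variable {E : Set ℂ}

/-- The truncated weight `1000 log (2 / dist(·, E))` near `E`. -/
def weight (E : Set ℂ) (n : ℕ) (θ : ℝ) : ℝ :=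
  {θ : ℝ | infDist (exp (θ * I)) E < 1 / ((n : ℝ) + 1)}.indicator
    (fun θ => 1000 * Real.log (2 / infDist (exp (θ * I)) E)) θ

lemma log_two_div_infDist_nonneg (hne : E.Nonempty) (hsub : E ⊆ sphere 0 1) (θ : ℝ) :
    0 ≤ Real.log (2 / infDist (exp (θ * I)) E) := by
  have h1 := infDist_exp_le_two hne hsub θ
  rcases (infDist_nonneg (x := exp (θ * I)) (s := E)).eq_or_lt with h | h
  · simp [← h]
  · exact Real.log_nonneg ((one_le_div h).2 h1)

lemma weight_nonneg (hne : E.Nonempty) (hsub : E ⊆ sphere 0 1) (n : ℕ) (θ : ℝ) :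
    0 ≤ weight E n θ :=
  indicator_nonneg (fun θ _ => mul_nonneg (by norm_num) (log_two_div_infDist_nonneg hne hsub θ)) θ

lemma weight_le (hne : E.Nonempty) (hsub : E ⊆ sphere 0 1) (n : ℕ) (θ : ℝ) :
    weight E n θ ≤ 1000 * Real.log (2 / infDist (exp (θ * I)) E) :=
  indicator_le_self' (fun θ _ => mul_nonneg (by norm_num) (log_two_div_infDist_nonneg hne hsub θ)) θ

lemma measurableSet_near (n : ℕ) :
    MeasurableSet {θ : ℝ | infDist (exp (θ * I)) E < 1 / ((n : ℝ) + 1)} :=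
  (isOpen_lt ((continuous_infDist_pt E).comp (by fun_prop : Continuous fun θ : ℝ => exp (θ * I)))
    continuous_const).measurableSet

lemma integrableOn_weight (hE : IsCarleson E) (n : ℕ) :
    IntegrableOn (weight E n) (Ioc (-Real.pi) Real.pi) :=
  (hE.2.2.const_mul 1000).indicator (measurableSet_near n)

lemma integral_weight_le (hE : IsCarleson E) (hne : E.Nonempty) (n : ℕ) :
    ∫ θ in Ioc (-Real.pi) Real.pi, weight E n θ
      ≤ ∫ θ in Ioc (-Real.pi) Real.pi, 1000 * Real.log (2 / infDist (exp (θ * I)) E) :=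
  integral_mono (integrableOn_weight hE n) (hE.2.2.const_mul 1000) (weight_le hne hE.2.1 n)

lemma tendsto_integral_weight (hE : IsCarleson E) (hne : E.Nonempty)
    (hnull : ∀ᵐ θ : ℝ ∂(volume.restrict (Ioo (-Real.pi) Real.pi)), 0 < infDist (exp (θ * I)) E) :
    Tendsto (fun n => ∫ θ in Ioc (-Real.pi) Real.pi, weight E n θ) atTop (nhds 0) := by
  have key := tendsto_integral_of_dominated_convergence
    (μ := volume.restrict (Ioc (-Real.pi) Real.pi)) (F := weight E) (f := fun _ => (0 : ℝ))
    (fun θ => 1000 * Real.log (2 / infDist (exp (θ * I)) E))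
    (fun n => (integrableOn_weight hE n).aestronglyMeasurable) (hE.2.2.const_mul 1000)
    (fun n => .of_forall fun θ => by
      rw [Real.norm_of_nonneg (weight_nonneg hne hE.2.1 n θ)]
      exact weight_le hne hE.2.1 n θ) ?_
  · simpa using key
  · rw [← restrict_Ioo_eq_restrict_Ioc]
    filter_upwards [hnull] with θ hθ
    refine tendsto_const_nhds.congr' ?_
    filter_upwards [(tendsto_one_div_add_atTop_nhds_zero_nat (𝕜 := ℝ)).eventually_lt_const hθ]
      with n hn
    rw [weight, indicator_of_notMem]
    exact not_lt.2 hn.le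

lemma norm_exp_mul_I_sub_le (s t : ℝ) : ‖exp (s * I) - exp (t * I)‖ ≤ |s - t| := by
  have h := Real.norm_exp_I_mul_ofReal_sub_one_le (x := s - t)
  have e : exp (s * I) - exp (t * I) = exp (t * I) * (exp (I * ((s - t : ℝ) : ℂ)) - 1) := by
    rw [mul_sub, ← exp_add, mul_one]
    congr 2
    push_cast
    ring
  rw [e, norm_mul, norm_exp_ofReal_mul_I, one_mul]
  exact h

/-- Lower bound of the Herglotz kernel on an arc next to an outer point. -/
lemma re_herglotz_ge (hcl : IsClosed E) (hne : E.Nonempty) (hsub : E ⊆ sphere 0 1) {z : ℂ}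
    (hz : 0 < barrier E z) (h1 : 1 ≤ ‖z‖) (hd : infDist z E ≤ 1 / 2) {θ : ℝ}
    (hθ : |θ - arg z| ≤ infDist z E / 4) :
    infDist z E / 2 ≤ infDist (exp (θ * I)) E ∧ infDist (exp (θ * I)) E ≤ 3 * infDist z E / 2 ∧
      1 / (4 * infDist z E) ≤ ((pole E θ + z) / (pole E θ - z)).re := by
  have hdp := infDist_pos_of_barrier hcl hne hsub hz
  obtain ⟨hz1, -⟩ := norm_le_of_barrier hne hsub hz
  have hzz : ‖z - exp (θ * I)‖ ≤ infDist z E / 2 := by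
    have e : z - exp (θ * I) = ((‖z‖ - 1 : ℝ) : ℂ) * exp (arg z * I)
        + (exp (arg z * I) - exp (θ * I)) := by
      conv_lhs => rw [← norm_mul_exp_arg_mul_I z]
      push_cast
      ring
    rw [e]
    refine (norm_add_le _ _).trans ?_
    rw [norm_mul, norm_exp_ofReal_mul_I, norm_real, Real.norm_of_nonneg (by linarith)]
    have := norm_exp_mul_I_sub_le (arg z) θ
    rw [abs_sub_comm] at this
    nlinarith
  have h2 : infDist z E ≤ infDist (exp (θ * I)) E + dist z (exp (θ * I)) :=
    infDist_le_infDist_add_dist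
  have h3 : infDist (exp (θ * I)) E ≤ infDist z E + dist (exp (θ * I)) z :=
    infDist_le_infDist_add_dist
  rw [dist_comm] at h3
  rw [dist_eq_norm] at h2 h3
  refine ⟨by linarith, by linarith, ?_⟩
  have h4 : ‖pole E θ - z‖ ≤ 2 * infDist z E := by
    rw [show pole E θ - z = (pole E θ - exp (θ * I)) - (z - exp (θ * I)) by ring]
    refine (norm_sub_le _ _).trans ?_
    rw [norm_pole_sub_exp]
    linarith
  have h5 : 0 < ‖pole E θ - z‖ := norm_pos_iff.2 (pole_sub_ne_zero hcl hne hsub hz θ)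
  rw [re_herglotz, norm_pole, div_le_div_iff₀ (by positivity) (by positivity)]
  have h6 : infDist z E ≤ (1 + infDist (exp (θ * I)) E) ^ 2 - ‖z‖ ^ 2 := by
    rw [barrier] at hz
    nlinarith
  have h7 : ‖pole E θ - z‖ ^ 2 ≤ 4 * infDist z E ^ 2 := by nlinarith
  nlinarith

lemma norm_multiplier_weight_le (hE : IsCarleson E) (hne : E.Nonempty) (n : ℕ) {z : ℂ}
    (hz : 0 < barrier E z) : ‖multiplier E (weight E n) z‖ ≤ Real.exp (1 / (2 * Real.pi) *
      ∫ θ in Ioc (-Real.pi) Real.pi, 1000 * Real.log (2 / infDist (exp (θ * I)) E)) := by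
  have h := norm_multiplier_le hE.1 hne hE.2.1 (integrableOn_weight hE n)
    (weight_nonneg hne hE.2.1 n) hz (s := 0) (t := 0) (m := 0) le_rfl (by simp) (by simp)
  refine h.trans ?_
  have := integral_weight_le hE hne n
  have := Real.pi_pos
  gcongr
  linarith

lemma exists_norm_multiplier_weight_outer_le (hE : IsCarleson E) (hne : E.Nonempty) (n : ℕ) :
    ∃ C, 0 ≤ C ∧ ∀ z, 0 < barrier E z → infDist z E ^ 2 / 48 ≤ ‖z‖ ^ 2 - 1 →
      ‖multiplier E (weight E n) z‖ ≤ C * infDist z E ^ 2 := by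
  set A := Real.exp (1 / (2 * Real.pi) *
      ∫ θ in Ioc (-Real.pi) Real.pi, 1000 * Real.log (2 / infDist (exp (θ * I)) E)) with hA
  have hA0 : 0 < A := Real.exp_pos _
  have hn : (1 : ℝ) ≤ 2 * ((n : ℝ) + 1) := by have := n.cast_nonneg (α := ℝ); linarith
  refine ⟨A * (2 * ((n : ℝ) + 1)) ^ 2, by positivity, fun z hz ho => ?_⟩
  have hdp := infDist_pos_of_barrier hE.1 hne hE.2.1 hz
  rcases le_or_gt (1 / (2 * ((n : ℝ) + 1))) (infDist z E) with h | h
  · refine (norm_multiplier_weight_le hE hne n hz).trans ?_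
    rw [← hA, mul_assoc, ← mul_pow]
    have : 1 ≤ 2 * ((n : ℝ) + 1) * infDist z E := by
      rw [div_le_iff₀ (by positivity)] at h
      linarith
    exact le_mul_of_one_le_right hA0.le (one_le_pow₀ this)
  · have hd : infDist z E ≤ 1 / 2 := by
      refine h.le.trans ?_
      gcongr
      have := n.cast_nonneg (α := ℝ)
      linarith
    have h1 : 1 ≤ ‖z‖ := by nlinarith [sq_nonneg (infDist z E), norm_nonneg z]
    have hlog : 0 ≤ Real.log (1 / infDist z E) :=
      Real.log_nonneg ((one_le_div hdp).2 (by linarith))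
    have hm : ∀ θ : ℝ, |θ - arg z| ≤ infDist z E / 4 →
        1000 * Real.log (1 / infDist z E) * (1 / (4 * infDist z E))
          ≤ weight E n θ * ((pole E θ + z) / (pole E θ - z)).re := fun θ hθ => by
      obtain ⟨ha, hb, hc⟩ := re_herglotz_ge hE.1 hne hE.2.1 hz h1 hd hθ
      have hw : weight E n θ = 1000 * Real.log (2 / infDist (exp (θ * I)) E) := by
        refine indicator_of_mem ?_ _
        change infDist (exp (θ * I)) E < 1 / ((n : ℝ) + 1)
        have e : 1 / ((n : ℝ) + 1) = 2 * (1 / (2 * ((n : ℝ) + 1))) := by field_simp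
        rw [e]
        linarith
      rw [hw]
      have hl : Real.log (1 / infDist z E) ≤ Real.log (2 / infDist (exp (θ * I)) E) := by
        refine Real.log_le_log (by positivity) ?_
        rw [div_le_div_iff₀ hdp (by linarith)]
        linarith
      exact mul_le_mul (by linarith) hc (by positivity) (by linarith)
    obtain ⟨s, t, hst, hI, hIθ⟩ : ∃ s t : ℝ, t - s = infDist z E / 4 ∧
        Ioc s t ⊆ Ioc (-Real.pi) Real.pi ∧ ∀ θ ∈ Ioc s t, |θ - arg z| ≤ infDist z E / 4 := by
      have hp := Real.pi_gt_three
      rcases le_or_gt 0 (arg z) with h0 | h0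
      · refine ⟨arg z - infDist z E / 4, arg z, by ring,
          Ioc_subset_Ioc (by linarith) (arg_le_pi z), fun θ hθ => ?_⟩
        rw [abs_le]
        constructor <;> linarith [hθ.1, hθ.2]
      · refine ⟨arg z, arg z + infDist z E / 4, by ring,
          Ioc_subset_Ioc (neg_pi_lt_arg z).le (by linarith), fun θ hθ => ?_⟩
        rw [abs_le]
        constructor <;> linarith [hθ.1, hθ.2]
    have key := norm_multiplier_le hE.1 hne hE.2.1 (integrableOn_weight hE n)
      (weight_nonneg hne hE.2.1 n) hz (by linarith) hI fun θ hθ => hm θ (hIθ θ hθ)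
    refine key.trans ?_
    have hpi := Real.pi_pos
    have e1 : (t - s) * (1000 * Real.log (1 / infDist z E) * (1 / (4 * infDist z E)))
        = 125 / 2 * Real.log (1 / infDist z E) := by
      rw [hst]
      field_simp
      ring
    rw [e1]
    calc _ ≤ Real.exp (1 / (2 * Real.pi) *
          (∫ θ in Ioc (-Real.pi) Real.pi, 1000 * Real.log (2 / infDist (exp (θ * I)) E))
          + -(2 * Real.log (1 / infDist z E))) := by
          apply Real.exp_le_exp.2
          rw [mul_sub, sub_eq_add_neg]
          have h3 : 2 ≤ 1 / (2 * Real.pi) * (125 / 2) := by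
            rw [← mul_div_assoc, le_div_iff₀ (by norm_num), div_mul_eq_mul_div,
              le_div_iff₀ (by positivity)]
            linarith [Real.pi_lt_four]
          have := integral_weight_le hE hne n
          rw [← mul_assoc]
          gcongr
      _ = A * infDist z E ^ 2 := by
          rw [Real.exp_add, ← hA]
          congr 1
          rw [one_div, Real.log_inv, mul_neg, neg_neg, mul_comm, Real.exp_mul, Real.exp_log hdp]
          norm_num
      _ ≤ _ := by
          gcongr
          exact le_mul_of_one_le_right hA0.le (one_le_pow₀ hn)

lemma tendsto_multiplier_weight (hE : IsCarleson E) (hne : E.Nonempty)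
    (hnull : ∀ᵐ θ : ℝ ∂(volume.restrict (Ioo (-Real.pi) Real.pi)), 0 < infDist (exp (θ * I)) E)
    {z : ℂ} (hz : 0 < barrier E z) :
    Tendsto (fun n => multiplier E (weight E n) z) atTop (nhds 1) := by
  have h1 : Tendsto (fun n => herglotz E (weight E n) z) atTop (nhds 0) := by
    refine squeeze_zero_norm (fun n => norm_herglotz_integral_le hE.1 hne hE.2.1
      (integrableOn_weight hE n) (weight_nonneg hne hE.2.1 n) hz) ?_
    simpa using (tendsto_integral_weight hE hne hnull).mul_const (18 / infDist z E)
  have h2 := (h1.const_mul (-((1 / (2 * Real.pi) : ℝ) : ℂ))).cexp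
  simpa [multiplier] using h2

lemma norm_multiplier_weight_le_mul (hE : IsCarleson E) (hne : E.Nonempty) (n : ℕ) {z w : ℂ}
    (hz : 0 < barrier E z) (hw : 0 < barrier E w)
    (hk : 72 * ‖z - w‖ / (infDist z E * infDist w E) ≤ 1) :
    ‖multiplier E (weight E n) z‖ ≤ Real.exp (1 / (2 * Real.pi) *
      ∫ θ in Ioc (-Real.pi) Real.pi, 1000 * Real.log (2 / infDist (exp (θ * I)) E))
        * ‖multiplier E (weight E n) w‖ := by
  refine (norm_multiplier_le_mul hE.1 hne hE.2.1 (integrableOn_weight hE n)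
    (weight_nonneg hne hE.2.1 n) hz hw hk).trans ?_
  have := integral_weight_le hE hne n
  have := Real.pi_pos
  rw [mul_one]
  gcongr

end multiplierSequence

section flatFunctions

lemma closure_unit_ball : closure (ball (0 : ℂ) 1) = closedBall 0 1 := closure_ball 0 one_ne_zero

lemma norm_le_on_closedBall {g : ℂ → ℂ} {b : ℂ → ℝ} (hg : ContinuousOn g (closedBall 0 1))
    (hb : Continuous b) (h : ∀ z ∈ ball (0 : ℂ) 1, ‖g z‖ ≤ b z) :
    ∀ z ∈ closedBall (0 : ℂ) 1, ‖g z‖ ≤ b z := by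
  intro z hz
  have hz' : z ∈ closure (ball (0 : ℂ) 1) := closure_unit_ball ▸ hz
  have : NeBot (nhdsWithin z (ball 0 1)) := mem_closure_iff_nhdsWithin_neBot.1 hz'
  exact le_of_tendsto_of_tendsto ((hg z hz).mono ball_subset_closedBall).norm
    (hb.continuousWithinAt) (eventually_nhdsWithin_of_forall h)

lemma eqOn_closedBall {g h : ℂ → ℂ} (hg : ContinuousOn g (closedBall 0 1))
    (hh : ContinuousOn h (closedBall 0 1)) (e : ∀ z ∈ ball (0 : ℂ) 1, g z = h z) :
    ∀ z ∈ closedBall (0 : ℂ) 1, g z = h z := fun z hz => by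
  have := norm_le_on_closedBall (b := fun _ => 0) (hg.sub hh) continuous_const
    (fun z hz => by simp [e z hz]) z hz
  simpa [sub_eq_zero] using this

/-- Mean value inequality from an interior point to a boundary point. -/
lemma norm_sub_le_of_norm_deriv_le_near {h : ℂ → ℂ} (hc : ContinuousOn h (closedBall 0 1))
    (hd : DifferentiableOn ℂ h (ball 0 1)) {z e : ℂ} (hz : z ∈ ball (0 : ℂ) 1)
    (he : e ∈ closedBall (0 : ℂ) 1) {K : ℝ}
    (hK : ∀ w ∈ ball (0 : ℂ) 1, ‖w - e‖ ≤ ‖z - e‖ → ‖deriv h w‖ ≤ K) :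
    ‖h z - h e‖ ≤ K * ‖z - e‖ := by
  set p : ℝ → ℂ := fun t => e + t * (z - e) with hp
  have hp1 : ∀ t : ℝ, 0 < t → t ≤ 1 → p t ∈ ball (0 : ℂ) 1 := fun t h0 h1 => by
    rw [mem_ball_zero_iff]
    rw [mem_ball_zero_iff] at hz
    rw [mem_closedBall_zero_iff] at he
    rw [show p t = ((1 - t : ℝ) : ℂ) * e + (t : ℂ) * z by simp only [hp]; push_cast; ring]
    refine (norm_add_le _ _).trans_lt ?_
    rw [norm_mul, norm_mul, norm_real, norm_real, Real.norm_of_nonneg h0.le,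
      Real.norm_of_nonneg (by linarith)]
    nlinarith [norm_nonneg e]
  have hp2 : ∀ t : ℝ, 0 < t → t ≤ 1 → ‖p t - e‖ ≤ ‖z - e‖ := fun t h0 h1 => by
    rw [show p t - e = (t : ℂ) * (z - e) by simp only [hp]; ring, norm_mul, norm_real,
      Real.norm_of_nonneg h0.le]
    exact mul_le_of_le_one_left (norm_nonneg _) h1
  have hpc : Continuous p := by fun_prop
  have hconv : Convex ℝ (ball (0 : ℂ) 1 ∩ closedBall e ‖z - e‖) :=
    (convex_ball _ _).inter (convex_closedBall _ _)
  have h1 : ∀ t : ℝ, 0 < t → t ≤ 1 → ‖h z - h (p t)‖ ≤ K * ‖z - p t‖ := fun t h0 h1 =>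
    hconv.norm_image_sub_le_of_norm_deriv_le
      (fun w hw => hd.differentiableAt (isOpen_ball.mem_nhds hw.1))
      (fun w hw => hK w hw.1 (by simpa [dist_eq_norm] using hw.2))
      ⟨hp1 t h0 h1, by simpa [dist_eq_norm] using hp2 t h0 h1⟩ ⟨hz, by simp [dist_eq_norm]⟩
  have hp0 : Tendsto p (nhdsWithin 0 (Ioc 0 1)) (nhdsWithin e (closedBall 0 1)) := by
    refine tendsto_nhdsWithin_iff.2 ⟨?_, eventually_nhdsWithin_of_forall fun t ht =>
      ball_subset_closedBall (hp1 t ht.1 ht.2)⟩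
    have := hpc.tendsto 0
    simp only [hp, ofReal_zero, zero_mul, add_zero] at this
    exact this.mono_left nhdsWithin_le_nhds
  have : NeBot (nhdsWithin (0 : ℝ) (Ioc 0 1)) := by
    rw [nhdsWithin_Ioc_eq_nhdsGT one_pos]
    infer_instance
  exact le_of_tendsto_of_tendsto (tendsto_const_nhds.sub ((hc e he).tendsto.comp hp0)).norm
    ((tendsto_const_nhds.sub (tendsto_nhds_of_tendsto_nhdsWithin hp0)).norm.const_mul K)
    (eventually_nhdsWithin_of_forall fun t ht => h1 t ht.1 ht.2)

lemma VanishAllDeriv.exists_bound {E : Set ℂ} (hcl : IsClosed E) (hne : E.Nonempty)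
    (hsub : E ⊆ sphere 0 1) {g : ℂ → ℂ} (hg : VanishAllDeriv E g) :
    ∃ C, 0 ≤ C ∧ (∀ z ∈ closedBall (0 : ℂ) 1, ‖g z‖ ≤ C * infDist z E ^ 2) ∧
      ∀ z ∈ ball (0 : ℂ) 1, ‖deriv g z‖ ≤ C * infDist z E := by
  obtain ⟨hgc, hgd, hg0, hgn⟩ := hg
  obtain ⟨g1, h1c, h1e, h10⟩ := hgn 1
  obtain ⟨g2, h2c, h2e, -⟩ := hgn 2
  rw [iteratedDeriv_one] at h1e
  obtain ⟨C, hC⟩ := (isCompact_closedBall (0 : ℂ) 1).exists_bound_of_continuousOn h2c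
  have hC0 : 0 ≤ C := (norm_nonneg _).trans (hC 0 (by simp))
  have hEc : IsCompact E := (isCompact_sphere (0 : ℂ) 1).of_isClosed_subset hcl hsub
  have hEb : ∀ e ∈ E, e ∈ closedBall (0 : ℂ) 1 := fun e he => sphere_subset_closedBall (hsub he)
  have h1d : DifferentiableOn ℂ g1 (ball 0 1) := (hgd.deriv isOpen_ball).congr h1e
  have h1' : ∀ z ∈ ball (0 : ℂ) 1, ‖deriv g1 z‖ ≤ C := fun z hz => by
    have : deriv g1 z = deriv (deriv g) z :=
      (h1e.eventuallyEq_of_mem (isOpen_ball.mem_nhds hz)).deriv_eq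
    rw [this, ← iteratedDeriv_one (f := g), ← iteratedDeriv_succ, ← h2e hz]
    exact hC z (ball_subset_closedBall hz)
  have hB1 : ∀ z ∈ ball (0 : ℂ) 1, ‖deriv g z‖ ≤ C * infDist z E := fun z hz => by
    obtain ⟨e, he, hd⟩ := hEc.exists_infDist_eq_dist hne z
    have := norm_sub_le_of_norm_deriv_le_near h1c h1d hz (hEb e he) (K := C) fun w hw _ => h1' w hw
    rwa [h10 e he, sub_zero, h1e hz, ← dist_eq_norm, ← hd] at this
  refine ⟨C, hC0, norm_le_on_closedBall hgc (by have := continuous_infDist_pt E; fun_prop)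
    fun z hz => ?_, hB1⟩
  obtain ⟨e, he, hd⟩ := hEc.exists_infDist_eq_dist hne z
  have := norm_sub_le_of_norm_deriv_le_near hgc hgd hz (hEb e he) (K := C * infDist z E)
    fun w hw hwe => (hB1 w hw).trans <| by
      gcongr
      rw [hd, dist_eq_norm]
      refine le_trans ?_ hwe
      rw [← dist_eq_norm]
      exact infDist_le_dist_of_mem he
  rw [hg0 e he, sub_zero, ← dist_eq_norm, ← hd] at this
  linarith

lemma taylorCoeff_deriv {h : ℂ → ℂ} (n : ℕ) :
    taylorCoeff (deriv h) n = ((n : ℂ) + 1) * taylorCoeff h (n + 1) := by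
  rw [taylorCoeff, taylorCoeff, iteratedDeriv_succ', Nat.factorial_succ]
  have h1 : ((n : ℂ) + 1) ≠ 0 := n.cast_add_one_ne_zero
  have h2 : ((n.factorial : ℕ) : ℂ) ≠ 0 := Nat.cast_ne_zero.2 n.factorial_ne_zero
  push_cast
  field_simp

lemma summable_one_div_succ_sq : Summable fun n : ℕ => 1 / ((n : ℝ) + 1) ^ 2 := by
  have := (summable_nat_add_iff 1).2 (Real.summable_one_div_nat_pow.2 one_lt_two)
  simpa using this

/-- A holomorphic function with bounded derivative belongs to `A⁺`, quantitatively. -/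
lemma L1.exists_of_bounded_deriv {h : ℂ → ℂ} (hd : DifferentiableOn ℂ h (ball 0 1)) {C0 C : ℝ}
    (hC0 : ∀ z ∈ ball (0 : ℂ) 1, ‖h z‖ ≤ C0) (hC : ∀ z ∈ ball (0 : ℂ) 1, ‖deriv h z‖ ≤ C) :
    ∃ b : L1, (∀ z ∈ ball (0 : ℂ) 1, L1.val b z = h z) ∧
      ‖b‖ ≤ C0 + (C ^ 2 + ∑' n : ℕ, 1 / ((n : ℝ) + 1) ^ 2) := by
  have hC' : 0 ≤ C := (norm_nonneg _).trans (hC 0 (by simp))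
  have hdd := hd.deriv isOpen_ball
  obtain ⟨x, hx, hxC⟩ := H2.exists_of_circleAverage_le hdd hC' fun r hr0 hr1 => by
    refine Real.circleAverage_mono_on_of_le_circle
      (circleIntegrable_of_continuousOn_ball (hdd.continuousOn.norm.pow 2) hr0 hr1) fun z hz => ?_
    rw [abs_of_nonneg hr0, mem_sphere_zero_iff_norm] at hz
    have := hC z (by simpa [hz])
    gcongr
  have hxn : ∀ n, x n = ((n : ℂ) + 1) * taylorCoeff h (n + 1) := fun n => by
    rw [← taylorCoeff_deriv, ← H2.taylorCoeff_val x n]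
    have : H2.val x =ᶠ[nhds 0] deriv h :=
      eventually_of_mem (isOpen_ball.mem_nhds (by simp : (0 : ℂ) ∈ ball (0 : ℂ) 1)) hx
    rw [taylorCoeff, taylorCoeff, this.iteratedDeriv_eq]
  have hsq := H2.hasSum_sq x
  have hle : ∀ n : ℕ, ‖taylorCoeff h (n + 1)‖ ≤ ‖x n‖ ^ 2 + 1 / ((n : ℝ) + 1) ^ 2 := fun n => by
    have h1 : (0 : ℝ) < (n : ℝ) + 1 := by positivity
    have h2 : ‖x n‖ = ((n : ℝ) + 1) * ‖taylorCoeff h (n + 1)‖ := by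
      rw [hxn, norm_mul]
      congr 1
      have := Complex.norm_natCast (n + 1)
      push_cast at this
      exact this
    have h3 : ‖taylorCoeff h (n + 1)‖ = ‖x n‖ * (1 / ((n : ℝ) + 1)) := by
      rw [h2]
      field_simp
    rw [h3, ← one_div_pow]
    nlinarith [sq_nonneg (‖x n‖ - 1 / ((n : ℝ) + 1)), norm_nonneg (x n), one_div_pos.2 h1]
  have hs1 := hsq.summable.add summable_one_div_succ_sq
  have hs : Summable fun n => ‖taylorCoeff h (n + 1)‖ :=
    hs1.of_nonneg_of_le (fun _ => norm_nonneg _) hle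
  have hs' : Summable fun n => ‖taylorCoeff h n‖ := (summable_nat_add_iff 1).1 hs
  refine ⟨L1.ofSummable _ hs', fun z hz => ?_, ?_⟩
  · exact ((L1.hasSum_val _ (ball_subset_closedBall hz)).unique (hasSum_taylorCoeff hd hz))
  · rw [L1.norm_eq]
    simp only [L1.ofSummable_apply]
    rw [hs'.tsum_eq_zero_add]
    have h0 : ‖taylorCoeff h 0‖ ≤ C0 := by
      simpa [taylorCoeff] using hC0 0 (by simp)
    have h1 : ∑' n, ‖taylorCoeff h (n + 1)‖ ≤ C ^ 2 + ∑' n : ℕ, 1 / ((n : ℝ) + 1) ^ 2 := by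
      refine (hs.tsum_le_tsum hle hs1).trans ?_
      rw [hsq.summable.tsum_add summable_one_div_succ_sq, hsq.tsum_eq]
      gcongr
    linarith

end flatFunctions

section flatPairing
variable {E : Set ℂ}

lemma barrier_pos_of_mem_closedBall (hcl : IsClosed E) (hne : E.Nonempty) {z : ℂ}
    (hz : z ∈ closedBall (0 : ℂ) 1) (hzE : z ∉ E) : 0 < barrier E z := by
  have h1 := (hcl.notMem_iff_infDist_pos hne).1 hzE
  rw [mem_closedBall_zero_iff] at hz
  rw [barrier]
  nlinarith [norm_nonneg z, sq_pos_of_pos h1]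

/-- Uniform bound for the multipliers. -/
def multiplierBound (E : Set ℂ) : ℝ := Real.exp (1 / (2 * Real.pi) *
  ∫ θ in Ioc (-Real.pi) Real.pi, 1000 * Real.log (2 / infDist (exp (θ * I)) E))

lemma multiplierBound_pos : 0 < multiplierBound E := Real.exp_pos _

lemma exists_norm_multiplier_mul_le (hE : IsCarleson E) (hne : E.Nonempty)
    (hnull : ∀ᵐ θ : ℝ ∂(volume.restrict (Ioo (-Real.pi) Real.pi)), 0 < infDist (exp (θ * I)) E)
    {F : ℂ → ℂ} {C0 : ℝ} (hC0 : 0 ≤ C0) (hF : ∀ z, 1 < ‖z‖ → ‖F z‖ ≤ C0 / (‖z‖ - 1))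
    (hL : LogGrowth F) (hd : DifferentiableOn ℂ F Eᶜ) (n : ℕ) :
    ∃ M, 0 ≤ M ∧ ∀ z, 0 < barrier E z → ‖multiplier E (weight E n) z * F z‖ ≤ M := by
  obtain ⟨C, hC, hCz⟩ := exists_norm_multiplier_weight_outer_le hE hne n
  have hM : (0 : ℝ) < C * 144 * C0 + 1 := by positivity
  have hEz : ∀ z, 0 < barrier E z → z ∉ E := fun z hz h => by
    have := infDist_pos_of_barrier hE.1 hne hE.2.1 hz
    rw [infDist_zero_of_mem h] at this
    exact this.false
  refine ⟨C * 144 * C0 + 1, hM.le, fun z hz => ?_⟩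
  have key := phragmen_lindelof hE hne hnull hF hL
    (X := fun z => multiplier E (weight E n) z * F z / ((C * 144 * C0 + 1 : ℝ) : ℂ))
    (V := univ) isOpen_univ (κ := 1) one_pos (fun _ _ _ _ => subset_univ _)
    (((differentiableOn_multiplier hE.1 hne hE.2.1 (integrableOn_weight hE n)).mono
      inter_subset_right |>.mul (hd.mono fun w hw => hEz w hw.2)).div_const _)
    (C := multiplierBound E / (C * 144 * C0 + 1)) (fun w _ hw _ => ?_) (fun w _ hw ho => ?_)
    (mem_univ z) hz
  · rw [norm_div, norm_real, Real.norm_of_nonneg hM.le, div_le_one hM] at key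
    exact key
  · rw [norm_div, norm_mul, norm_real, Real.norm_of_nonneg hM.le, div_mul_eq_mul_div]
    have := norm_multiplier_weight_le hE hne n hw
    gcongr
    exact this
  · have hdp := infDist_pos_of_barrier hE.1 hne hE.2.1 hw
    rw [norm_div, norm_mul, norm_real, Real.norm_of_nonneg hM.le, div_le_one hM]
    have h1 := norm_sub_one_ge ho (norm_nonneg _) (norm_lt_two_of_barrier hne hE.2.1 hw.le).le
    have h2 : 0 < infDist w E ^ 2 / 144 := by positivity
    have h3 : ‖F w‖ ≤ C0 / (infDist w E ^ 2 / 144) :=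
      (hF w (by linarith)).trans (by gcongr)
    calc _ ≤ C * infDist w E ^ 2 * (C0 / (infDist w E ^ 2 / 144)) := by
          have := hCz w hw ho
          gcongr
      _ = C * 144 * C0 := by field_simp
      _ ≤ _ := by linarith

lemma norm_deriv_multiplier_le (hE : IsCarleson E) (hne : E.Nonempty) (n : ℕ) {z : ℂ}
    (hz : z ∈ ball (0 : ℂ) 1) :
    ‖deriv (multiplier E (weight E n)) z‖ ≤ multiplierBound E / (infDist z E ^ 2 / 200) := by
  have hzE : z ∉ E := fun h => by
    have := hE.2.1 h
    rw [mem_ball_zero_iff] at hz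
    rw [mem_sphere_zero_iff_norm] at this
    linarith
  have hdp := (hE.1.notMem_iff_infDist_pos hne).1 hzE
  rw [mem_ball_zero_iff] at hz
  have hd2 := infDist_le_norm_add_one hne hE.2.1 z
  have hsub : ∀ w ∈ closedBall z (infDist z E ^ 2 / 200), 0 < barrier E w := fun w hw => by
    rw [mem_closedBall, dist_eq_norm] at hw
    have h1 := barrier_add_ge (h := w - z) hne hE.2.1 (by linarith : ‖z‖ ≤ 2) (by nlinarith)
    rw [add_sub_cancel] at h1
    rw [barrier] at h1
    nlinarith [norm_nonneg z, sq_pos_of_pos hdp]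
  have hdo := differentiableOn_multiplier hE.1 hne hE.2.1 (integrableOn_weight hE n)
  have hr : 0 < infDist z E ^ 2 / 200 := by positivity
  refine norm_deriv_le_of_forall_mem_sphere_norm_le hr ?_ fun w hw =>
    norm_multiplier_weight_le hE hne n (hsub w (sphere_subset_closedBall hw))
  refine DifferentiableOn.diffContOnCl ?_
  rw [closure_ball _ hr.ne']
  exact hdo.mono fun w hw => hsub w hw

lemma continuousOn_mul_of_bounded (hcl : IsClosed E) (hne : E.Nonempty)
    {g h : ℂ → ℂ} (hg : ContinuousOn g (closedBall 0 1)) (hg0 : ∀ z ∈ E, g z = 0)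
    (hh : ContinuousOn h {z | 0 < barrier E z}) {M : ℝ} (hM : ∀ z, 0 < barrier E z → ‖h z‖ ≤ M) :
    ContinuousOn (fun z => g z * h z) (closedBall 0 1) := by
  intro z hz
  by_cases hzE : z ∈ E
  · change Tendsto _ _ (nhds (g z * h z))
    rw [hg0 z hzE, zero_mul]
    have h1 : Tendsto (fun w => ‖g w‖ * M) (nhdsWithin z (closedBall 0 1)) (nhds 0) := by
      have : Tendsto (fun w => ‖g w‖ * M) (nhdsWithin z (closedBall 0 1)) (nhds (‖g z‖ * M)) :=
        (hg z hz).norm.mul_const M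
      rwa [hg0 z hzE, norm_zero, zero_mul] at this
    refine squeeze_zero_norm' (eventually_nhdsWithin_of_forall fun w hw => ?_) h1
    by_cases hwE : w ∈ E
    · simp [hg0 w hwE]
    · rw [norm_mul]
      exact mul_le_mul_of_nonneg_left (hM w (barrier_pos_of_mem_closedBall hcl hne hw hwE))
        (norm_nonneg _)
  · have h1 := barrier_pos_of_mem_closedBall hcl hne hz hzE
    have h2 : {z | 0 < barrier E z} ∈ nhds z :=
      (isOpen_lt continuous_const continuous_barrier).mem_nhds h1
    exact (hg z hz).mul (hh.continuousAt h2).continuousWithinAt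

lemma barrier_pos_of_mem_ball {z : ℂ} (hz : z ∈ ball (0 : ℂ) 1) : 0 < barrier E z := by
  rw [mem_ball_zero_iff] at hz
  rw [barrier]
  nlinarith [norm_nonneg z, sq_nonneg (infDist z E)]

lemma exists_L1_mul_multiplier (hE : IsCarleson E) (hne : E.Nonempty) {g : ℂ → ℂ}
    (hg : VanishAllDeriv E g) : ∃ B, ∀ n, ∃ b : L1, ‖b‖ ≤ B ∧
      ∀ z ∈ closedBall (0 : ℂ) 1, L1.val b z = g z * multiplier E (weight E n) z := by
  obtain ⟨C, hC, hC1, hC2⟩ := hg.exists_bound hE.1 hne hE.2.1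
  set A := multiplierBound E
  have hA : 0 < A := multiplierBound_pos
  refine ⟨C * 2 ^ 2 * A + ((C * 2 * A + 200 * C * A) ^ 2 + ∑' n : ℕ, 1 / ((n : ℝ) + 1) ^ 2),
    fun n => ?_⟩
  have hqd := differentiableOn_multiplier hE.1 hne hE.2.1 (integrableOn_weight hE n)
  have hqA : ∀ z, 0 < barrier E z → ‖multiplier E (weight E n) z‖ ≤ A := fun z hz =>
    norm_multiplier_weight_le hE hne n hz
  have hqd' : DifferentiableOn ℂ (multiplier E (weight E n)) (ball 0 1) :=
    hqd.mono fun z hz => barrier_pos_of_mem_ball hz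
  have hd2 : ∀ z ∈ ball (0 : ℂ) 1, infDist z E ≤ 2 := fun z hz => by
    have := infDist_le_norm_add_one hne hE.2.1 z
    rw [mem_ball_zero_iff] at hz
    linarith
  have hd0 : ∀ z ∈ ball (0 : ℂ) 1, 0 < infDist z E := fun z hz =>
    infDist_pos_of_barrier hE.1 hne hE.2.1 (barrier_pos_of_mem_ball hz)
  obtain ⟨b, hb, hbn⟩ := L1.exists_of_bounded_deriv (hg.2.1.fun_mul hqd') (C0 := C * 2 ^ 2 * A)
    (C := C * 2 * A + 200 * C * A) (fun z hz => by
      have h1 := hC1 z (ball_subset_closedBall hz)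
      have h2 := hqA z (barrier_pos_of_mem_ball hz)
      have h3 := hd2 z hz
      have h4 := (hd0 z hz).le
      rw [norm_mul]
      have h5 : ‖g z‖ ≤ C * 2 ^ 2 := h1.trans (by gcongr)
      gcongr) (fun z hz => by
      have h0 := isOpen_ball.mem_nhds hz
      rw [deriv_fun_mul (hg.2.1.differentiableAt h0) (hqd'.differentiableAt h0)]
      have h1 := hC1 z (ball_subset_closedBall hz)
      have h2 := hqA z (barrier_pos_of_mem_ball hz)
      have h3 := hd2 z hz
      have h4 := hd0 z hz
      have h5 : ‖deriv g z‖ ≤ C * 2 := (hC2 z hz).trans (by gcongr)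
      have h6 := norm_deriv_multiplier_le hE hne n hz
      refine (norm_add_le _ _).trans ?_
      rw [norm_mul, norm_mul]
      have h7 : ‖g z‖ * ‖deriv (multiplier E (weight E n)) z‖
          ≤ C * infDist z E ^ 2 * (A / (infDist z E ^ 2 / 200)) := by gcongr
      have h8 : C * infDist z E ^ 2 * (A / (infDist z E ^ 2 / 200)) = 200 * C * A := by
        field_simp
      have h9 : ‖deriv g z‖ * ‖multiplier E (weight E n) z‖ ≤ C * 2 * A := by gcongr
      linarith)
  exact ⟨b, hbn, eqOn_closedBall b.continuousOn_val
    (continuousOn_mul_of_bounded hE.1 hne hg.1 hg.2.2.1 hqd.continuousOn hqA) hb⟩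

end flatPairing

section duality

lemma L1.fcoeff_val (b : L1) (n : ℕ) : fcoeff (L1.val b) n = b n := by
  rw [(L1.hasFSeries (fun _ _ => rfl) : HasFSeries (L1.val b) _).fcoeff_eq]
  simp

lemma exp_mem_sphere (θ : ℝ) : exp (θ * I) ∈ sphere (0 : ℂ) 1 := by
  simp [norm_exp_ofReal_mul_I]

lemma exp_mem_closedBall (θ : ℝ) : exp (θ * I) ∈ closedBall (0 : ℂ) 1 :=
  sphere_subset_closedBall (exp_mem_sphere θ)

lemma continuous_exp_mul_I : Continuous fun θ : ℝ => exp (θ * I) := by fun_prop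

lemma ContinuousOn.comp_exp {g : ℂ → ℂ} (hg : ContinuousOn g (closedBall 0 1)) :
    Continuous fun θ : ℝ => g (exp (θ * I)) :=
  hg.comp_continuous continuous_exp_mul_I exp_mem_closedBall

lemma hasSum_dual (b : L1) {c : ℕ → ℂ} {B : ℝ} (hB : ∀ n, ‖c n‖ ≤ B) {F : ℂ → ℂ}
    (hF : ∀ z, 1 < ‖z‖ → HasSum (fun n => c n / z ^ (n + 1)) (F z)) {R : ℝ} (hR : 1 < R) :
    HasSum (fun n => b n * c n / (R : ℂ) ^ (n + 1)) ((1 / (2 * Real.pi)) *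
      ∫ θ in (0:ℝ)..(2 * Real.pi),
        L1.val b (exp (θ * I)) * exp (θ * I) * F (R * exp (θ * I))) := by
  have hR0 : (0 : ℝ) < R := by linarith
  have hRn : ∀ θ : ℝ, ‖(R : ℂ) * exp (θ * I)‖ = R := fun θ => by
    rw [norm_mul, norm_exp_ofReal_mul_I, norm_real, Real.norm_of_nonneg hR0.le, mul_one]
  have hvc := b.continuousOn_val.comp_exp
  have hs : Summable fun n : ℕ => ‖b‖ * (B / R ^ (n + 1)) := by
    have h1 := (summable_geometric_of_lt_one (inv_nonneg.2 hR0.le)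
      (inv_lt_one_of_one_lt₀ hR)).mul_left (‖b‖ * (B / R))
    refine h1.congr fun n => ?_
    rw [pow_succ, inv_pow]
    field_simp
  have key := intervalIntegral.hasSum_integral_of_dominated_convergence (μ := volume)
    (a := 0) (b := 2 * Real.pi)
    (F := fun (n : ℕ) (θ : ℝ) => L1.val b (exp (θ * I)) * exp (θ * I) *
      (c n / (R * exp (θ * I)) ^ (n + 1)))
    (f := fun θ => L1.val b (exp (θ * I)) * exp (θ * I) * F (R * exp (θ * I)))
    (fun n _ => ‖b‖ * (B / R ^ (n + 1)))
    (fun n => by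
      refine Continuous.aestronglyMeasurable ?_
      refine (hvc.mul continuous_exp_mul_I).mul (continuous_const.div (by fun_prop) fun θ => ?_)
      refine pow_ne_zero _ (norm_ne_zero_iff.1 ?_)
      rw [hRn]
      exact hR0.ne')
    (fun n => .of_forall fun θ _ => by
      rw [norm_mul, norm_mul, norm_exp_ofReal_mul_I, mul_one, norm_div, norm_pow, hRn]
      gcongr
      · exact L1.norm_val_le _ (exp_mem_closedBall θ)
      · exact hB n)
    (.of_forall fun _ _ => hs) intervalIntegrable_const
    (.of_forall fun θ _ => (hF _ (by rw [hRn]; exact hR)).mul_left _)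
  refine (key.mul_left (1 / (2 * Real.pi) : ℂ)).congr_fun fun n => ?_
  have h1 : ∀ θ : ℝ, L1.val b (exp (θ * I)) * exp (θ * I) * (c n / (R * exp (θ * I)) ^ (n + 1))
      = (c n / (R : ℂ) ^ (n + 1)) *
        (L1.val b (exp (θ * I)) * exp (-((n : ℤ) : ℂ) * (θ : ℂ) * I)) := fun θ => by
    have h2 : exp (-((n : ℤ) : ℂ) * (θ : ℂ) * I) * exp (θ * I) ^ n = 1 := by
      rw [← exp_nat_mul, ← exp_add]
      simp
      ring_nf
      simp
    have h3 : exp (θ * I) ≠ 0 := exp_ne_zero _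
    have h4 : (R : ℂ) ≠ 0 := ofReal_ne_zero.2 hR0.ne'
    have h5 : exp (-((n : ℤ) : ℂ) * (θ : ℂ) * I) = 1 / exp (θ * I) ^ n :=
      eq_div_of_mul_eq (pow_ne_zero _ h3) h2
    rw [h5, mul_pow, pow_succ (exp (θ * I))]
    field_simp
  simp only [h1]
  rw [intervalIntegral.integral_const_mul, ← L1.fcoeff_val b n, fcoeff]
  ring

lemma tsum_mul_eq_zero {b : L1} {c : ℕ → ℂ} {B : ℝ} (hB : ∀ n, ‖c n‖ ≤ B) {F : ℂ → ℂ}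
    (hF : ∀ z, 1 < ‖z‖ → HasSum (fun n => c n / z ^ (n + 1)) (F z)) {K : ℝ}
    (hK : ∀ R : ℝ, 1 < R → ∀ ζ ∈ sphere (0 : ℂ) 1, ‖L1.val b ζ * F (R * ζ)‖ ≤ K)
    (hY : ContinuousOn (fun z => L1.val b z * F z) (closedBall 0 1))
    (hd : DifferentiableOn ℂ F (ball 0 1)) (hout : ∀ z, 1 < ‖z‖ → ContinuousAt F z)
    (hl : ∀ ζ ∈ sphere (0 : ℂ) 1, L1.val b ζ = 0 ∨ ContinuousAt F ζ) :
    ∑' n, b n * c n = 0 := by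
  set R : ℕ → ℝ := fun m => 1 + 1 / ((m : ℝ) + 1) with hRdef
  have hR : ∀ m, 1 < R m := fun m => by
    have : 0 < 1 / ((m : ℝ) + 1) := by positivity
    simp only [hRdef]
    linarith
  have hRl : Tendsto R atTop (nhds 1) := by
    have := (tendsto_one_div_add_atTop_nhds_zero_nat (𝕜 := ℝ)).const_add 1
    simpa only [add_zero] using this
  have hRl' : Tendsto (fun m => (R m : ℂ)) atTop (nhds 1) := by
    exact_mod_cast (continuous_ofReal.tendsto 1).comp hRl
  have hs : Summable fun n => ‖b n‖ * B := b.summable_norm.mul_right B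
  have lim1 : Tendsto (fun m => ∑' n, b n * c n / (R m : ℂ) ^ (n + 1)) atTop
      (nhds (∑' n, b n * c n)) := by
    refine tendsto_tsum_of_dominated_convergence hs (fun n => ?_) (.of_forall fun m n => ?_)
    · have := (tendsto_const_nhds (x := b n * c n)).div (hRl'.pow (n + 1)) (by simp)
      rw [one_pow, div_one] at this
      exact this
    · rw [norm_div, norm_mul, norm_pow, norm_real, Real.norm_of_nonneg (by linarith [hR m])]
      refine (div_le_self (by positivity) (one_le_pow₀ (hR m).le)).trans ?_
      have := hB n
      gcongr
  have hvc := b.continuousOn_val.comp_exp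
  have lim2 : Tendsto (fun m => ∫ θ in (0:ℝ)..(2 * Real.pi),
      L1.val b (exp (θ * I)) * exp (θ * I) * F (R m * exp (θ * I))) atTop
      (nhds (∫ θ in (0:ℝ)..(2 * Real.pi),
        L1.val b (exp (θ * I)) * exp (θ * I) * F (exp (θ * I)))) := by
    refine intervalIntegral.tendsto_integral_filter_of_dominated_convergence (fun _ => K)
      (.of_forall fun m => ?_) (.of_forall fun m => .of_forall fun θ _ => ?_)
      intervalIntegrable_const (.of_forall fun θ _ => ?_)
    · refine Continuous.aestronglyMeasurable ((hvc.mul continuous_exp_mul_I).mul ?_)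
      refine continuous_iff_continuousAt.2 fun θ => ?_
      have h1 : 1 < ‖(R m : ℂ) * exp (θ * I)‖ := by
        rw [norm_mul, norm_exp_ofReal_mul_I, norm_real,
          Real.norm_of_nonneg (by linarith [hR m]), mul_one]
        exact hR m
      exact ContinuousAt.comp (f := fun θ : ℝ => (R m : ℂ) * exp (θ * I)) (hout _ h1)
        (by fun_prop)
    · rw [mul_right_comm, norm_mul, norm_exp_ofReal_mul_I, mul_one]
      exact hK _ (hR m) _ (exp_mem_sphere θ)
    · rcases hl _ (exp_mem_sphere θ) with h | h
      · simp [h]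
      · have h1 : Tendsto (fun m => (R m : ℂ) * exp (θ * I)) atTop (nhds (exp (θ * I))) := by
          simpa using hRl'.mul_const (exp (θ * I))
        exact (h.tendsto.comp h1).const_mul _
  have h0 : ∫ θ in (0:ℝ)..(2 * Real.pi),
      L1.val b (exp (θ * I)) * exp (θ * I) * F (exp (θ * I)) = 0 := by
    have h1 := circleIntegral_eq_zero_of_differentiable_on_off_countable (zero_le_one' ℝ)
      countable_empty hY fun z hz => by
        have hz' := isOpen_ball.mem_nhds hz.1
        exact (b.differentiableOn_val.differentiableAt hz').mul (hd.differentiableAt hz')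
    rw [circleIntegral] at h1
    simp only [deriv_circleMap, circleMap, ofReal_one, one_mul, zero_add, smul_eq_mul] at h1
    have h2 : ∀ θ : ℝ, exp (θ * I) * I * (L1.val b (exp (θ * I)) * F (exp (θ * I)))
      = I * (L1.val b (exp (θ * I)) * exp (θ * I) * F (exp (θ * I))) := fun θ => by ring
    simp only [h2] at h1
    rw [intervalIntegral.integral_const_mul] at h1
    exact (mul_eq_zero.1 h1).resolve_left I_ne_zero
  rw [h0] at lim2
  have lim3 := lim2.const_mul (1 / (2 * Real.pi) : ℂ)
  rw [mul_zero] at lim3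
  refine tendsto_nhds_unique lim1 (lim3.congr fun m => ?_)
  exact (hasSum_dual b hB hF (hR m)).tsum_eq.symm

/-- Weak-star null sequences: bounded and coordinatewise null. -/
lemma tendsto_tsum_mul_of_bounded {x : ℕ → L1} {B : ℝ} (hx : ∀ m, ‖x m‖ ≤ B)
    (h0 : ∀ n, Tendsto (fun m => x m n) atTop (nhds 0)) {c : ℕ → ℂ}
    (hc : Tendsto c atTop (nhds 0)) : Tendsto (fun m => ∑' n, x m n * c n) atTop (nhds 0) := by
  have hB : 0 ≤ B := (norm_nonneg _).trans (hx 0)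
  obtain ⟨D, hD⟩ := hc.norm.bddAbove_range
  have hD' : ∀ n, ‖c n‖ ≤ D := fun n => hD ⟨n, rfl⟩
  have hs : ∀ m, Summable fun n => x m n * c n := fun m =>
    .of_norm_bounded ((x m).summable_norm.mul_right D) fun n => by
      rw [norm_mul]
      exact mul_le_mul_of_nonneg_left (hD' n) (norm_nonneg _)
  rw [Metric.tendsto_atTop]
  intro ε hε
  have hδ : 0 < ε / (2 * (B + 1)) := by positivity
  obtain ⟨N, hN⟩ := Metric.tendsto_atTop.1 hc _ hδ
  have h1 : Tendsto (fun m => ∑ n ∈ Finset.range N, x m n * c n) atTop (nhds 0) := by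
    have := tendsto_finsetSum (Finset.range N) fun n _ => (h0 n).mul_const (c n)
    simpa using this
  obtain ⟨M, hM⟩ := Metric.tendsto_atTop.1 h1 (ε / 2) (by positivity)
  refine ⟨M, fun m hm => ?_⟩
  have h2 := hM m hm
  rw [dist_zero_right] at h2 ⊢
  rw [← (hs m).sum_add_tsum_nat_add N]
  have h3 : ‖∑' n, x m (n + N) * c (n + N)‖ ≤ B * (ε / (2 * (B + 1))) := by
    have hs2 := ((summable_nat_add_iff N).2 (x m).summable_norm)
    refine (tsum_of_norm_bounded (hs2.mul_right (ε / (2 * (B + 1)))).hasSum fun n => ?_).trans ?_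
    · rw [norm_mul]
      have := hN (n + N) (by omega)
      rw [dist_zero_right] at this
      gcongr
    · rw [tsum_mul_right]
      have h4 : ∑' n, ‖x m (n + N)‖ ≤ ‖x m‖ := by
        rw [L1.norm_eq, ← (x m).summable_norm.sum_add_tsum_nat_add N]
        exact le_add_of_nonneg_left (Finset.sum_nonneg fun _ _ => norm_nonneg _)
      have := h4.trans (hx m)
      gcongr
  have h5 : B * (ε / (2 * (B + 1))) ≤ ε / 2 := by
    rw [← mul_div_assoc, div_le_div_iff₀ (by positivity) (by norm_num)]
    nlinarith
  exact (norm_add_le _ _).trans_lt (by linarith)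

end duality

section boundaryUniqueness

lemma norm_ofReal_mul_exp {r : ℝ} (hr : 0 ≤ r) (θ : ℝ) : ‖(r : ℂ) * exp (θ * I)‖ = r := by
  rw [norm_mul, norm_exp_ofReal_mul_I, norm_real, Real.norm_of_nonneg hr, mul_one]

lemma L1.posLog_mul_exp_le_integral (b : L1) (t : ℝ) :
    2 * Real.pi * Real.posLog (‖b 0‖ * Real.exp t) ≤
      ∫ θ in (-Real.pi)..Real.pi, Real.posLog (‖L1.val b (exp (θ * I))‖ * Real.exp t) := by
  have hn : ∀ z : ℂ, ‖L1.val b z * Real.exp t‖ = ‖L1.val b z‖ * Real.exp t := fun z => by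
    rw [norm_mul, norm_real, Real.norm_of_nonneg (Real.exp_pos t).le]
  have h0 : L1.val b 0 = b 0 := by
    have := b.hasSum_val (z := 0) (by simp)
    refine this.unique ?_
    have h2 := hasSum_single (f := fun n => b n * (0 : ℂ) ^ n) 0 (fun n hn => by simp [hn])
    simpa using h2
  set r : ℕ → ℝ := fun n => 1 - 1 / ((n : ℝ) + 2) with hr
  have hr1 : ∀ n, 0 < r n ∧ r n < 1 := fun n => by
    have : 0 < 1 / ((n : ℝ) + 2) := by positivity
    have h2 : 1 / ((n : ℝ) + 2) < 1 := by
      rw [div_lt_one (by positivity)]; linarith [Nat.cast_nonneg (α := ℝ) n]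
    exact ⟨by simp only [hr]; linarith, by simp only [hr]; linarith⟩
  have hrl : Tendsto r atTop (nhds 1) := by
    have h1 : Tendsto (fun n : ℕ => 1 / ((n : ℝ) + 2)) atTop (nhds 0) := by
      have := (tendsto_one_div_add_atTop_nhds_zero_nat (𝕜 := ℝ)).comp (tendsto_add_atTop_nat 1)
      refine this.congr fun n => ?_
      simp only [Function.comp]
      push_cast
      ring
    have := h1.const_sub 1
    rwa [sub_zero] at this
  have hcl : ∀ n (θ : ℝ), (r n : ℂ) * exp (θ * I) ∈ closedBall (0 : ℂ) 1 := fun n θ => by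
    rw [mem_closedBall_zero_iff, norm_ofReal_mul_exp (hr1 n).1.le]; exact (hr1 n).2.le
  have lim : Tendsto (fun n => ∫ θ in (-Real.pi)..Real.pi,
      Real.posLog (‖L1.val b (r n * exp (θ * I))‖ * Real.exp t)) atTop
      (nhds (∫ θ in (-Real.pi)..Real.pi,
        Real.posLog (‖L1.val b (exp (θ * I))‖ * Real.exp t))) := by
    refine intervalIntegral.tendsto_integral_filter_of_dominated_convergence
      (fun _ => Real.posLog (‖b‖ * Real.exp t))
      (.of_forall fun m => ?_) (.of_forall fun m => .of_forall fun θ _ => ?_)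
      intervalIntegrable_const (.of_forall fun θ _ => ?_)
    · refine Continuous.aestronglyMeasurable (Real.continuous_posLog.comp ?_)
      exact (b.continuousOn_val.comp_continuous (by fun_prop) (hcl m)).norm.mul continuous_const
    · rw [Real.norm_of_nonneg Real.posLog_nonneg]
      refine Real.posLog_le_posLog (by positivity) ?_
      have := b.norm_val_le (hcl m θ)
      gcongr
    · have h1 : Tendsto (fun n => (r n : ℂ) * exp (θ * I)) atTop
          (nhdsWithin (exp (θ * I)) (closedBall 0 1)) := by
        refine tendsto_nhdsWithin_iff.2 ⟨?_, .of_forall fun n => hcl n θ⟩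
        have : Tendsto (fun n => (r n : ℂ)) atTop (nhds 1) := by
          exact_mod_cast (continuous_ofReal.tendsto 1).comp hrl
        simpa using this.mul_const (exp (θ * I))
      have h2 := (b.continuousOn_val _ (exp_mem_closedBall θ)).tendsto.comp h1
      exact (Real.continuous_posLog.tendsto _).comp (h2.norm.mul_const _)
  refine ge_of_tendsto' lim fun n => ?_
  have h1 := posLog_norm_le_circleAverage (X := fun z => L1.val b z * Real.exp t) (c := 0) (hr1 n).1
    (by
      have hd : DifferentiableOn ℂ (fun z => L1.val b z * (Real.exp t : ℂ)) (ball 0 1) :=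
        b.differentiableOn_val.mul_const _
      exact (hd.analyticOnNhd isOpen_ball).mono (closedBall_subset_ball (hr1 n).2))
  have h2 := integral_pi_eq_circleAverage (fun z => Real.posLog ‖L1.val b z * Real.exp t‖) (r n)
  simp only [hn, h0] at h1 h2
  rw [h2]
  rw [norm_mul, norm_real, Real.norm_of_nonneg (Real.exp_pos t).le] at h1
  have := Real.pi_pos
  gcongr

lemma L1.ae_val_ne_zero_of_apply_zero {b : L1} (hb : b 0 ≠ 0) :
    ∀ᵐ θ : ℝ ∂(volume.restrict (Ioo (-Real.pi) Real.pi)), L1.val b (exp (θ * I)) ≠ 0 := by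
  set μ := volume.restrict (Ioo (-Real.pi) Real.pi) with hμ
  set Z : Set ℝ := {θ | L1.val b (exp (θ * I)) = 0} with hZ
  have hvc := b.continuousOn_val.comp_exp
  have hZm : MeasurableSet Z := (isClosed_eq hvc continuous_const).measurableSet
  have hpi := Real.pi_pos
  have htot : μ.real univ = 2 * Real.pi := by
    rw [hμ, measureReal_restrict_apply MeasurableSet.univ, univ_inter, Real.volume_real_Ioo_of_le
      (by linarith)]
    ring
  by_contra hcon
  have hm : 0 < μ.real Z := by
    rw [measureReal_def, ENNReal.toReal_pos_iff]
    refine ⟨pos_iff_ne_zero.2 fun h => hcon ?_, measure_lt_top _ _⟩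
    rw [ae_iff]
    simpa only [not_not] using h
  have hMge : (1 : ℝ) ≤ max ‖b‖ 1 := le_max_right _ _
  set M := max ‖b‖ 1 with hM
  have key : ∀ t, 0 ≤ t → 2 * Real.pi * (Real.log ‖b 0‖ + t) ≤
      (2 * Real.pi - μ.real Z) * (Real.log M + t) := fun t ht => by
    have h1 := b.posLog_mul_exp_le_integral t
    have h2 : Real.log ‖b 0‖ + t ≤ Real.posLog (‖b 0‖ * Real.exp t) := by
      have : Real.log (‖b 0‖ * Real.exp t) = Real.log ‖b 0‖ + t := by
        rw [Real.log_mul (norm_ne_zero_iff.2 hb) (Real.exp_pos t).ne', Real.log_exp]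
      rw [← this]
      exact le_max_right _ _
    refine (mul_le_mul_of_nonneg_left h2 (by positivity)).trans (h1.trans ?_)
    rw [intervalIntegral.integral_of_le (by linarith), integral_Ioc_eq_integral_Ioo]
    have h3 : ∫ θ, Zᶜ.indicator (fun _ => Real.log M + t) θ ∂μ =
        (2 * Real.pi - μ.real Z) * (Real.log M + t) := by
      rw [integral_indicator hZm.compl, setIntegral_const, measureReal_compl hZm, htot, smul_eq_mul]
    rw [← h3]
    refine integral_mono_of_nonneg (.of_forall fun θ => Real.posLog_nonneg)
      ((integrable_const _).indicator hZm.compl) (.of_forall fun θ => ?_)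
    by_cases hθ : θ ∈ Z
    · rw [indicator_of_notMem (by simpa using hθ)]
      simp only [show L1.val b (exp (θ * I)) = 0 from hθ]
      simp
    · rw [indicator_of_mem (by simpa using hθ)]
      have h4 : ‖L1.val b (exp (θ * I))‖ * Real.exp t ≤ M * Real.exp t := by
        have := (b.norm_val_le (exp_mem_closedBall θ)).trans (le_max_left ‖b‖ 1)
        gcongr
      refine (Real.posLog_le_posLog (by positivity) h4).trans ?_
      rw [Real.posLog_eq_log, Real.log_mul (by positivity) (Real.exp_pos t).ne', Real.log_exp]
      rw [abs_of_pos (by positivity)]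
      have := Real.one_le_exp ht
      nlinarith
  set K := (2 * Real.pi - μ.real Z) * Real.log M - 2 * Real.pi * Real.log ‖b 0‖ with hK
  have := key ((|K| + 1) / μ.real Z) (by positivity)
  have h5 : μ.real Z * ((|K| + 1) / μ.real Z) = |K| + 1 := by field_simp
  have h6 := le_abs_self K
  nlinarith

lemma L1.exists_shift_pow_eq {b : L1} (hb : b ≠ 0) :
    ∃ k, ∃ b' : L1, b' 0 ≠ 0 ∧ b = (L1.shift ^ k) b' := by
  classical
  have hex : ∃ k, b k ≠ 0 := by
    by_contra h
    push Not at h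
    exact hb (L1.ext' fun n => by simp [h n])
  refine ⟨Nat.find hex, (L1.back ^ (Nat.find hex)) b, ?_, L1.ext' fun n => ?_⟩
  · rw [L1.back_pow_apply, zero_add]; exact Nat.find_spec hex
  · rcases lt_or_ge n (Nat.find hex) with h | h
    · rw [L1.shift_pow_apply_of_lt _ h]
      simpa using Nat.find_min hex h
    · obtain ⟨m, rfl⟩ := Nat.exists_eq_add_of_le' h
      rw [L1.shift_pow_apply_add, L1.back_pow_apply]

/-- The boundary values of a nonzero element of the algebra vanish almost nowhere. -/
lemma L1.ae_val_ne_zero {b : L1} (hb : b ≠ 0) :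
    ∀ᵐ θ : ℝ ∂(volume.restrict (Ioo (-Real.pi) Real.pi)), L1.val b (exp (θ * I)) ≠ 0 := by
  obtain ⟨k, b', h0, rfl⟩ := L1.exists_shift_pow_eq hb
  filter_upwards [L1.ae_val_ne_zero_of_apply_zero h0] with θ hθ
  rw [L1.val_shift_pow _ (exp_mem_closedBall θ)]
  exact mul_ne_zero (pow_ne_zero _ (exp_ne_zero _)) hθ

end boundaryUniqueness

section flatAnnihilation
variable {E : Set ℂ}

lemma tsum_mul_eq_zero_of_differentiable {c : ℕ → ℂ} (hc : Tendsto c atTop (nhds 0))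
    {F : ℂ → ℂ} (hF : ∀ z, 1 < ‖z‖ → HasSum (fun n => c n / z ^ (n + 1)) (F z))
    (hd : Differentiable ℂ F) (a : L1) : ∑' n, a n * c n = 0 := by
  obtain ⟨B, hB⟩ := hc.norm.bddAbove_range
  obtain ⟨C0, hC0, hC⟩ := exists_bound_of_hasSum_outer hc hF
  obtain ⟨K, hK⟩ := (isCompact_closedBall (0 : ℂ) 2).exists_bound_of_continuousOn
    hd.continuous.continuousOn
  refine tsum_mul_eq_zero (fun n => hB ⟨n, rfl⟩) hF (K := ‖a‖ * max K C0) (fun R hR ζ hζ => ?_)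
    (a.continuousOn_val.mul hd.continuous.continuousOn) hd.differentiableOn
    (fun z _ => hd.continuous.continuousAt) (fun ζ _ => .inr hd.continuous.continuousAt)
  have hζ1 : ‖ζ‖ = 1 := by simpa using hζ
  have hn : ‖(R : ℂ) * ζ‖ = R := by
    rw [norm_mul, norm_real, Real.norm_of_nonneg (by linarith), hζ1, mul_one]
  have h2 : ‖F (R * ζ)‖ ≤ max K C0 := by
    rcases le_or_gt R 2 with h | h
    · exact (hK _ (by rw [mem_closedBall_zero_iff, hn]; exact h)).trans (le_max_left _ _)
    · refine ((hC _ (by rw [hn]; exact hR)).trans ?_).trans (le_max_right _ _)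
      rw [hn]
      exact div_le_self hC0 (by linarith)
  rw [norm_mul]
  exact mul_le_mul (a.norm_val_le (sphere_subset_closedBall hζ)) h2 (norm_nonneg _) (norm_nonneg _)

lemma norm_mul_outer_le (hE : IsCarleson E) (hne : E.Nonempty)
    {g F : ℂ → ℂ} {C : ℝ} (hC : 0 ≤ C)
    (hgC : ∀ z ∈ closedBall (0 : ℂ) 1, ‖g z‖ ≤ C * infDist z E ^ 2)
    {C0 : ℝ} (hC0 : 0 ≤ C0) (hF : ∀ z, 1 < ‖z‖ → ‖F z‖ ≤ C0 / (‖z‖ - 1)) {n : ℕ} {M : ℝ}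
    (hM0 : 0 ≤ M) (hM : ∀ z, 0 < barrier E z → ‖multiplier E (weight E n) z * F z‖ ≤ M)
    {R : ℝ} (hR : 1 < R) {ζ : ℂ} (hζ : ζ ∈ sphere (0 : ℂ) 1) :
    ‖g ζ * multiplier E (weight E n) ζ * F (R * ζ)‖ ≤
      multiplierBound E * (C * 200 * C0 + C * 4 * M) := by
  set A := multiplierBound E with hA
  have hA0 : 0 < A := multiplierBound_pos
  have hζ1 : ‖ζ‖ = 1 := by simpa using hζ
  have hζc := sphere_subset_closedBall hζ
  have hgz := hgC ζ hζc
  set d := infDist ζ E with hdd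
  have hd0 : 0 ≤ d := infDist_nonneg
  have hd2 : d ≤ 2 := by
    have := infDist_le_norm_add_one hne hE.2.1 ζ
    rw [hζ1] at this; linarith
  by_cases hζE : ζ ∈ E
  · have : d = 0 := infDist_zero_of_mem hζE
    rw [this] at hgz
    have : g ζ = 0 := norm_le_zero_iff.1 (by simpa using hgz)
    rw [this, zero_mul, zero_mul, norm_zero]
    positivity
  have hbz := barrier_pos_of_mem_closedBall hE.1 hne hζc hζE
  have hdpos : 0 < d := infDist_pos_of_barrier hE.1 hne hE.2.1 hbz
  have hq : ‖multiplier E (weight E n) ζ‖ ≤ A := norm_multiplier_weight_le hE hne n hbz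
  have hn : ‖(R : ℂ) * ζ‖ = R := by
    rw [norm_mul, norm_real, Real.norm_of_nonneg (by linarith), hζ1, mul_one]
  have hFR := hF (R * ζ) (by rw [hn]; exact hR)
  rw [hn] at hFR
  rcases le_or_gt (d ^ 2 / 200) (R - 1) with h | h
  · have h1 : ‖F (R * ζ)‖ ≤ 200 * C0 / d ^ 2 := by
      refine hFR.trans ?_
      rw [div_le_div_iff₀ (by linarith) (by positivity)]
      nlinarith
    calc ‖g ζ * multiplier E (weight E n) ζ * F (R * ζ)‖
        ≤ (C * d ^ 2) * A * (200 * C0 / d ^ 2) := by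
          rw [norm_mul, norm_mul]; gcongr
      _ = A * (C * 200 * C0) := by field_simp
      _ ≤ _ := by
        have : 0 ≤ C * 4 * M := by positivity
        nlinarith
  · set w := (R : ℂ) * ζ with hw
    have hwz : ‖ζ - w‖ = R - 1 := by
      rw [show ζ - w = ((1 - R : ℝ) : ℂ) * ζ by rw [hw]; push_cast; ring, norm_mul, norm_real, hζ1,
        mul_one, Real.norm_eq_abs, abs_of_neg (by linarith)]
      ring
    have hsub : d ≤ infDist w E + (R - 1) := by
      have := infDist_le_infDist_add_dist (s := E) (x := ζ) (y := w)
      rwa [dist_eq_norm, hwz] at this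
    have hdw : 0.9 * d ≤ infDist w E := by nlinarith
    have hbw : 0 < barrier E w := by
      have := barrier_add_ge hne hE.2.1 (z := ζ) (h := w - ζ) (by rw [hζ1]; norm_num)
        (by rw [norm_sub_rev, hwz]; nlinarith)
      rw [add_sub_cancel, norm_sub_rev, hwz, barrier, hζ1] at this
      nlinarith
    have hk : 72 * ‖ζ - w‖ / (infDist ζ E * infDist w E) ≤ 1 := by
      rw [hwz, div_le_one (mul_pos hdpos (by nlinarith))]
      nlinarith
    have h1 : ‖multiplier E (weight E n) ζ‖ ≤ A * ‖multiplier E (weight E n) w‖ :=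
      norm_multiplier_weight_le_mul hE hne n hbz hbw hk
    have h2 := hM w hbw
    rw [norm_mul] at h2
    calc ‖g ζ * multiplier E (weight E n) ζ * F w‖
        ≤ (C * 2 ^ 2) * (A * ‖multiplier E (weight E n) w‖) * ‖F w‖ := by
          rw [norm_mul, norm_mul]
          have : ‖g ζ‖ ≤ C * 2 ^ 2 := hgz.trans (by gcongr)
          gcongr
      _ = A * (C * 4 * (‖multiplier E (weight E n) w‖ * ‖F w‖)) := by ring
      _ ≤ A * (C * 4 * M) := by gcongr
      _ ≤ _ := by
        have : 0 ≤ C * 200 * C0 := by positivity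
        nlinarith

lemma tendsto_coeff_of_mul_multiplier (hE : IsCarleson E) (hne : E.Nonempty)
    (hnull : ∀ᵐ θ : ℝ ∂(volume.restrict (Ioo (-Real.pi) Real.pi)), 0 < infDist (exp (θ * I)) E)
    {a : L1} (ha : ∀ z ∈ E, L1.val a z = 0) {b : ℕ → L1}
    (hb : ∀ m, ∀ z ∈ closedBall (0 : ℂ) 1,
      L1.val (b m) z = L1.val a z * multiplier E (weight E m) z) (k : ℕ) :
    Tendsto (fun m => b m k) atTop (nhds (a k)) := by
  simp only [← L1.fcoeff_val, fcoeff]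
  refine Tendsto.const_mul _ ?_
  have hbar : ∀ θ : ℝ, exp (θ * I) ∉ E → 0 < barrier E (exp (θ * I)) := fun θ h =>
    barrier_pos_of_mem_closedBall hE.1 hne (exp_mem_closedBall θ) h
  refine intervalIntegral.tendsto_integral_filter_of_dominated_convergence
    (fun _ => ‖a‖ * multiplierBound E)
    (.of_forall fun m => ?_) (.of_forall fun m => .of_forall fun θ _ => ?_)
    intervalIntegrable_const (.of_forall fun θ _ => ?_)
  · refine Continuous.aestronglyMeasurable ?_
    exact ((b m).continuousOn_val.comp_exp).mul (by fun_prop)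
  · have h1 : ‖exp (-((k : ℤ) : ℂ) * (θ : ℂ) * I)‖ = 1 := by
      rw [show -((k : ℤ) : ℂ) * (θ : ℂ) * I = ((-(k : ℝ) * θ : ℝ) : ℂ) * I by push_cast; ring,
        norm_exp_ofReal_mul_I]
    rw [norm_mul, h1, mul_one, hb m _ (exp_mem_closedBall θ), norm_mul]
    by_cases hθ : exp (θ * I) ∈ E
    · rw [ha _ hθ, norm_zero, zero_mul]
      have := multiplierBound_pos (E := E)
      positivity
    · exact mul_le_mul (a.norm_val_le (exp_mem_closedBall θ))
        (norm_multiplier_weight_le hE hne m (hbar θ hθ)) (norm_nonneg _) (norm_nonneg _)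
  · refine Tendsto.mul_const _ ?_
    simp only [hb _ _ (exp_mem_closedBall θ)]
    by_cases hθ : exp (θ * I) ∈ E
    · simp only [ha _ hθ, zero_mul]
      exact tendsto_const_nhds
    · simpa using (tendsto_multiplier_weight hE hne hnull (hbar θ hθ)).const_mul
        (L1.val a (exp (θ * I)))

/-- If the analytic function `∑ cₙ z^{-n-1}`, with `c ∈ c₀`, continues across the complement of
a Carleson set `E` to a function of logarithmic growth in the disk, then `c` annihilates the
functions which are flat on `E`. -/
theorem tsum_mul_eq_zero_of_vanishAllDeriv (hE : IsCarleson E) {c : ℕ → ℂ}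
    (hc : Tendsto c atTop (nhds 0)) {F : ℂ → ℂ}
    (hF : ∀ z, 1 < ‖z‖ → HasSum (fun n => c n / z ^ (n + 1)) (F z)) (hL : LogGrowth F)
    (hd : DifferentiableOn ℂ F Eᶜ) {a : L1} {g : ℂ → ℂ} (hg : VanishAllDeriv E g)
    (hga : ∀ z ∈ closedBall (0 : ℂ) 1, g z = L1.val a z) : ∑' n, a n * c n = 0 := by
  rcases E.eq_empty_or_nonempty with rfl | hne
  · exact tsum_mul_eq_zero_of_differentiable hc hF
      (differentiableOn_univ.1 (by simpa using hd)) a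
  have hEs : ∀ z ∈ E, z ∈ closedBall (0 : ℂ) 1 := fun z hz => sphere_subset_closedBall (hE.2.1 hz)
  have ha0 : ∀ z ∈ E, L1.val a z = 0 := fun z hz => by rw [← hga z (hEs z hz), hg.2.2.1 z hz]
  by_cases ha : a = 0
  · simp [ha]
  have hnull : ∀ᵐ θ : ℝ ∂(volume.restrict (Ioo (-Real.pi) Real.pi)),
      0 < infDist (exp (θ * I)) E := by
    filter_upwards [L1.ae_val_ne_zero ha] with θ hθ
    exact (hE.1.notMem_iff_infDist_pos hne).1 fun h => hθ (ha0 _ h)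
  obtain ⟨D, hD⟩ := hc.norm.bddAbove_range
  obtain ⟨C0, hC0, hC⟩ := exists_bound_of_hasSum_outer hc hF
  obtain ⟨C, hC', hgC, -⟩ := hg.exists_bound hE.1 hne hE.2.1
  obtain ⟨B, hB⟩ := exists_L1_mul_multiplier hE hne hg
  choose b hbB hb using hB
  have hb' : ∀ m, ∀ z ∈ closedBall (0 : ℂ) 1,
      L1.val (b m) z = L1.val a z * multiplier E (weight E m) z := fun m z hz => by
    rw [hb m z hz, hga z hz]
  have hca : ∀ z, z ∉ E → ContinuousAt F z := fun z hz =>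
    (hd.differentiableAt (hE.1.isOpen_compl.mem_nhds hz)).continuousAt
  have hbarE : ∀ z, 0 < barrier E z → z ∉ E := fun z hz h => by
    have := infDist_pos_of_barrier hE.1 hne hE.2.1 hz
    rw [infDist_zero_of_mem h] at this
    exact this.false
  have hzero : ∀ m, ∑' n, b m n * c n = 0 := fun m => by
    obtain ⟨M, hM0, hM⟩ := exists_norm_multiplier_mul_le hE hne hnull hC0 hC hL hd m
    refine tsum_mul_eq_zero (fun n => hD ⟨n, rfl⟩) hF
      (K := multiplierBound E * (C * 200 * C0 + C * 4 * M)) (fun R hR ζ hζ => ?_) ?_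
      (hd.mono fun z hz h => ?_) (fun z hz => hca z fun h => ?_) (fun ζ hζ => ?_)
    · rw [hb m ζ (sphere_subset_closedBall hζ)]
      exact norm_mul_outer_le hE hne hC' hgC hC0 hC hM0 hM hR hζ
    · have h1 := continuousOn_mul_of_bounded hE.1 hne hg.1 hg.2.2.1
        (h := fun z => multiplier E (weight E m) z * F z)
        ((differentiableOn_multiplier hE.1 hne hE.2.1
          (integrableOn_weight hE m)).continuousOn.mul
          (hd.continuousOn.mono fun z hz => hbarE z hz)) hM
      refine h1.congr fun z hz => ?_
      simp only [hb m z hz, mul_assoc]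
    · have h1 : ‖z‖ = 1 := by simpa using hE.2.1 h
      rw [mem_ball_zero_iff] at hz
      linarith
    · have h1 : ‖z‖ = 1 := by simpa using hE.2.1 h
      linarith
    · by_cases h : ζ ∈ E
      · left; rw [hb' m ζ (sphere_subset_closedBall hζ), ha0 ζ h, zero_mul]
      · exact .inr (hca ζ h)
  have hsum : ∀ x : L1, Summable fun n => x n * c n := fun x =>
    (x.summable_norm.mul_right D).of_norm_bounded (fun n => by
      rw [norm_mul]; exact mul_le_mul_of_nonneg_left (hD ⟨n, rfl⟩) (norm_nonneg _))
  have lim := tendsto_tsum_mul_of_bounded (x := fun m => a - b m) (B := ‖a‖ + B)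
    (fun m => (norm_sub_le _ _).trans (by gcongr; exact hbB m))
    (fun n => by
      have := (tendsto_coeff_of_mul_multiplier hE hne hnull ha0 hb' n).const_sub (a n)
      simpa only [L1.sub_apply, sub_self] using this) hc
  have heq : ∀ m, ∑' n, (a - b m) n * c n = ∑' n, a n * c n := fun m => by
    simp only [L1.sub_apply, sub_mul]
    rw [(hsum a).tsum_sub (hsum (b m)), hzero m, sub_zero]
  simp only [heq] at lim
  exact tendsto_nhds_unique tendsto_const_nhds lim

end flatAnnihilation

section continuation

/-- An analytic function off a closed subset `h` of the circle whose isolated singularities are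
all removable extends analytically to the complement of a perfect subset of `h`. -/
lemma exists_perfect_extension {h : Set ℂ} (hh : IsClosed h) (hsub : h ⊆ sphere 0 1)
    {F₀ : ℂ → ℂ} (hd : DifferentiableOn ℂ F₀ hᶜ)
    (hrem : ∀ F : ℂ → ℂ, (∀ z, z ∉ h → F z = F₀ z) → ∀ p ∈ h, ∀ κ : ℝ, 0 < κ → κ ≤ 1 →
      DifferentiableOn ℂ F (ball p κ \ {p}) → ∃ G : ℂ → ℂ,
        DifferentiableOn ℂ G (ball p (κ / 2)) ∧ ∀ z ∈ ball p (κ / 2), z ≠ p → G z = F z) :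
    ∃ (F : ℂ → ℂ) (K : Set ℂ), (∀ z, z ∉ h → F z = F₀ z) ∧ K ⊆ h ∧ Perfect K ∧
      DifferentiableOn ℂ F Kᶜ := by
  classical
  set reg : ℂ → Prop := fun z => ∃ r > 0, ∃ G : ℂ → ℂ, DifferentiableOn ℂ G (ball z r) ∧
    ∀ w ∈ ball z r, w ∉ h → G w = F₀ w with hreg
  set K : Set ℂ := {z | z ∈ h ∧ ¬ reg z} with hK
  have hreg' : ∀ z, z ∉ h → reg z := fun z hz => by
    obtain ⟨r, hr, hrb⟩ := Metric.isOpen_iff.1 hh.isOpen_compl z hz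
    exact ⟨r, hr, F₀, hd.mono hrb, fun w _ _ => rfl⟩
  have hKreg : ∀ z, z ∉ K → reg z := fun z hz => by
    by_cases hzh : z ∈ h
    · by_contra hc; exact hz ⟨hzh, hc⟩
    · exact hreg' z hzh
  have hmove : ∀ z, reg z → ∃ r > 0, ball z r ⊆ {w | reg w} := fun z ⟨r, hr, G, hG, hGF⟩ =>
    ⟨r, hr, fun w hw => by
      obtain ⟨s, hs, hsb⟩ := Metric.isOpen_iff.1 isOpen_ball w hw
      exact ⟨s, hs, G, hG.mono hsb, fun v hv hvh => hGF v (hsb hv) hvh⟩⟩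
  have hKc : Kᶜ = {w | reg w} := by
    ext z
    exact ⟨fun hz => hKreg z hz, fun hz hzK => hzK.2 hz⟩
  have hKcl : IsClosed K := by
    rw [← isOpen_compl_iff, hKc, Metric.isOpen_iff]
    exact hmove
  have hdense : Dense hᶜ := by
    rw [← interior_eq_empty_iff_dense_compl, ← subset_empty_iff]
    refine (interior_mono hsub).trans ?_
    rw [interior_sphere _ one_ne_zero]
  choose! r hr G hG hGF using fun z => (show z ∉ K → reg z from hKreg z)
  set F : ℂ → ℂ := fun z => if z ∈ h then G z z else F₀ z with hF
  have hFoff : ∀ z, z ∉ h → F z = F₀ z := fun z hz => by simp only [hF, if_neg hz]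
  have hFG : ∀ z, z ∉ K → ∀ w ∈ ball z (r z), F w = G z w := fun z hz w hw => by
    by_cases hwh : w ∈ h
    · have hwK : w ∉ K := fun hwK => by
        obtain ⟨s, hs, hsb⟩ := Metric.isOpen_iff.1 isOpen_ball w hw
        exact hwK.2 ⟨s, hs, G z, (hG z hz).mono hsb, fun v hv hvh => hGF z hz v (hsb hv) hvh⟩
      simp only [hF, if_pos hwh]
      have hO : ball z (r z) ∩ ball w (r w) ∈ nhds w :=
        inter_mem (isOpen_ball.mem_nhds hw) (ball_mem_nhds _ (hr w hwK))
      have : (nhdsWithin w hᶜ).NeBot := mem_closure_iff_nhdsWithin_neBot.1 (hdense w)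
      have h1 : Tendsto (G w) (nhdsWithin w hᶜ) (nhds (G w w)) :=
        (((hG w hwK).differentiableAt (ball_mem_nhds _ (hr w hwK))).continuousAt).mono_left
          nhdsWithin_le_nhds
      have h2 : Tendsto (G z) (nhdsWithin w hᶜ) (nhds (G z w)) :=
        (((hG z hz).differentiableAt (isOpen_ball.mem_nhds hw)).continuousAt).mono_left
          nhdsWithin_le_nhds
      refine tendsto_nhds_unique h1 (h2.congr' ?_)
      filter_upwards [mem_nhdsWithin_of_mem_nhds hO, self_mem_nhdsWithin] with v hv hvh
      rw [hGF z hz v hv.1 hvh, hGF w hwK v hv.2 hvh]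
    · rw [hFoff w hwh, hGF z hz w hw hwh]
  have hFd : DifferentiableOn ℂ F Kᶜ := fun z hz => by
    have h1 := (hG z hz).differentiableAt (ball_mem_nhds _ (hr z hz))
    refine (h1.congr_of_eventuallyEq ?_).differentiableWithinAt
    filter_upwards [ball_mem_nhds _ (hr z hz)] with w hw
    exact hFG z hz w hw
  refine ⟨F, K, hFoff, fun z hz => hz.1, ⟨hKcl, fun p hp => ?_⟩, hFd⟩
  rw [accPt_iff_nhds]
  by_contra! hcon
  obtain ⟨U, hU, hUK⟩ := hcon
  obtain ⟨s, hs, hsU⟩ := Metric.mem_nhds_iff.1 hU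
  have hs1 : 0 < min s 1 := lt_min hs one_pos
  obtain ⟨G', hG', hGF'⟩ := hrem F hFoff p hp.1 (min s 1) hs1 (min_le_right _ _)
    (hFd.mono fun z hz hzK => hz.2 (hUK z ⟨hsU (ball_subset_ball (min_le_left _ _) hz.1), hzK⟩))
  refine hp.2 ⟨min s 1 / 2, half_pos hs1, G', hG', fun w hw hwh => ?_⟩
  rw [hGF' w hw fun e => hwh (e ▸ hp.1), hFoff w hwh]

end continuation

section innerFunctions

lemma IsInnerFunction.mul {u v : ℂ → ℂ} (hu : IsInnerFunction u) (hv : IsInnerFunction v) :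
    IsInnerFunction (fun z => u z * v z) := by
  refine ⟨hu.1.fun_mul hv.1, fun z hz => ?_, ?_⟩
  · rw [norm_mul]
    exact mul_le_one₀ (hu.2.1 z hz) (norm_nonneg _) (hv.2.1 z hz)
  · filter_upwards [hu.2.2, hv.2.2] with θ h1 h2
    simpa only [norm_mul, one_mul, mul_one] using h1.mul h2

lemma eq_zero_on_ball_of_mul {S k : ℂ → ℂ} (hS : DifferentiableOn ℂ S (ball 0 1))
    (hk : DifferentiableOn ℂ k (ball 0 1)) (h0 : ∃ z ∈ ball (0 : ℂ) 1, S z ≠ 0)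
    (h : ∀ z ∈ ball (0 : ℂ) 1, S z * k z = 0) : ∀ z ∈ ball (0 : ℂ) 1, k z = 0 := by
  refine (AnalyticOnNhd.eq_zero_or_eq_zero_of_mul_eq_zero (hS.analyticOnNhd isOpen_ball)
    (hk.analyticOnNhd isOpen_ball) h (convex_ball _ _).isPreconnected).resolve_left fun h' => ?_
  obtain ⟨z, hz, hz'⟩ := h0
  exact hz' (h' z hz)

/-- The bounded functions obtained by removing the factor `S` from the elements of `N`. -/
def quotientSpace (N : Submodule ℂ L1) (S : ℂ → ℂ) : Submodule ℂ H2 where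
  carrier := {x | (∃ C : ℝ, ∀ z ∈ ball (0 : ℂ) 1, ‖H2.val x z‖ ≤ C) ∧
    ∃ a ∈ N, ∀ z ∈ ball (0 : ℂ) 1, L1.val a z = S z * H2.val x z}
  zero_mem' := by
    have h0 : ∀ z ∈ ball (0 : ℂ) 1, H2.val 0 z = 0 := fun z hz => by
      rw [← H2.valL_apply z hz, map_zero]
    refine ⟨⟨0, fun z hz => by rw [h0 z hz, norm_zero]⟩, 0, N.zero_mem, fun z hz => ?_⟩
    rw [h0 z hz, mul_zero, ← L1.valL_apply z (ball_subset_closedBall hz), map_zero]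
  add_mem' := by
    rintro x y ⟨⟨C, hC⟩, a, ha, hax⟩ ⟨⟨D, hD⟩, b, hb, hby⟩
    have h0 : ∀ z ∈ ball (0 : ℂ) 1, H2.val (x + y) z = H2.val x z + H2.val y z := fun z hz => by
      simp only [← H2.valL_apply z hz, map_add]
    refine ⟨⟨C + D, fun z hz => ?_⟩, a + b, N.add_mem ha hb, fun z hz => ?_⟩
    · rw [h0 z hz]
      exact (norm_add_le _ _).trans (add_le_add (hC z hz) (hD z hz))
    · have : L1.val (a + b) z = L1.val a z + L1.val b z := by
        simp only [← L1.valL_apply z (ball_subset_closedBall hz), map_add]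
      rw [this, h0 z hz, hax z hz, hby z hz, mul_add]
  smul_mem' := by
    rintro r x ⟨⟨C, hC⟩, a, ha, hax⟩
    have h0 : ∀ z ∈ ball (0 : ℂ) 1, H2.val (r • x) z = r * H2.val x z := fun z hz => by
      simp only [← H2.valL_apply z hz, map_smul, smul_eq_mul]
    refine ⟨⟨‖r‖ * C, fun z hz => ?_⟩, r • a, N.smul_mem r ha, fun z hz => ?_⟩
    · rw [h0 z hz, norm_mul]
      exact mul_le_mul_of_nonneg_left (hC z hz) (norm_nonneg _)
    · have : L1.val (r • a) z = r * L1.val a z := by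
        simp only [← L1.valL_apply z (ball_subset_closedBall hz), map_smul, smul_eq_mul]
      rw [this, h0 z hz, hax z hz]
      ring

/-- The resolvent functional continues into the disk, with logarithmic growth. -/
lemma exists_interior_continuation {N : Submodule ℂ L1} (hc : IsClosed (N : Set L1))
    (hT : ∀ a ∈ N, L1.shift a ∈ N) {S : ℂ → ℂ} (hS : DifferentiableOn ℂ S (ball 0 1))
    (hS0 : ∃ z ∈ ball (0 : ℂ) 1, S z ≠ 0)
    (hd : ∀ ε > 0, ∃ x ∈ quotientSpace N S, ‖x - H2.basis 0‖ < ε)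
    {Φ : L1 →L[ℂ] ℂ} (hΦ : ∀ a ∈ N, Φ a = 0) {a : L1} {k : ℂ → ℂ} (hk : k ∈ Hinf)
    (ha : ∀ z ∈ ball (0 : ℂ) 1, L1.val a z = S z * k z) :
    ∃ P : ℂ → ℂ, DifferentiableOn ℂ P (ball 0 1) ∧ LogGrowth P ∧
      ∀ z ∈ ball (0 : ℂ) 1, ∀ g ∈ N,
        P z * L1.val g z = L1.val a z * Φ (L1.dq g z) - L1.val g z * Φ (L1.dq a z) := by
  obtain ⟨hkd, C, hkC⟩ := hk
  have hpair : ∀ (x y : H2) (g g' : L1), g ∈ N → g' ∈ N →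
      (∀ z ∈ ball (0 : ℂ) 1, L1.val g z = S z * H2.val x z) →
      (∀ z ∈ ball (0 : ℂ) 1, L1.val g' z = S z * H2.val y z) → ∀ z ∈ ball (0 : ℂ) 1,
      H2.val x z * Φ (L1.dq g' z) = H2.val y z * Φ (L1.dq g z) := by
    intro x y g g' hg hg' hx hy z hz
    rw [← sub_eq_zero]
    refine eq_zero_on_ball_of_mul hS (k := fun z => H2.val x z * Φ (L1.dq g' z) -
      H2.val y z * Φ (L1.dq g z)) (((H2.differentiableOn_val x).fun_mul
        (L1.differentiableOn_dq Φ g')).sub ((H2.differentiableOn_val y).fun_mul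
        (L1.differentiableOn_dq Φ g))) hS0 (fun z hz => ?_) z hz
    have h1 := congrArg Φ (L1.mul_dq_sub g g' (mem_ball_zero_iff.1 hz))
    rw [map_sub, map_sub, hΦ _ (by rw [L1.mul_comm']; exact L1.mul_mem hc hT hg _),
      hΦ _ (by rw [L1.mul_comm']; exact L1.mul_mem hc hT hg' _), map_smul, map_smul, sub_self,
      hx z hz, hy z hz, smul_eq_mul, smul_eq_mul] at h1
    rw [mul_sub, ← mul_assoc, ← mul_assoc, ← h1]
  have hex : ∀ z ∈ ball (0 : ℂ) 1, ∃ x : H2, ∃ g ∈ N, H2.val x z ≠ 0 ∧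
      ∀ z ∈ ball (0 : ℂ) 1, L1.val g z = S z * H2.val x z := fun z hz => by
    have hz1 : 0 < 1 - ‖z‖ := by linarith [mem_ball_zero_iff.1 hz]
    obtain ⟨x, ⟨-, g, hg, hgx⟩, hx⟩ := hd (1 - ‖z‖) hz1
    refine ⟨x, g, hg, fun h0 => ?_, hgx⟩
    have h1 := H2.norm_val_le (x - H2.basis 0) hz
    rw [← H2.valL_apply z hz, map_sub, H2.valL_apply, H2.valL_apply, h0, H2.val_basis, pow_zero,
      zero_sub, norm_neg, norm_one] at h1
    have h2 : (1 - ‖z‖)⁻¹ * ‖x - H2.basis 0‖ < (1 - ‖z‖)⁻¹ * (1 - ‖z‖) := by gcongr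
    rw [inv_mul_cancel₀ hz1.ne'] at h2
    linarith
  choose! x g hgN hx0 hgx using hex
  set P : ℂ → ℂ := fun z => k z * Φ (L1.dq (g z) z) / H2.val (x z) z - Φ (L1.dq a z) with hP
  have hPx : ∀ z ∈ ball (0 : ℂ) 1, ∀ (y : H2) (g' : L1), g' ∈ N →
      (∀ z ∈ ball (0 : ℂ) 1, L1.val g' z = S z * H2.val y z) →
      P z * H2.val y z = k z * Φ (L1.dq g' z) - H2.val y z * Φ (L1.dq a z) := by
    intro z hz y g' hg' hy
    have h1 := hpair (x z) y (g z) g' (hgN z hz) hg' (hgx z hz) hy z hz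
    have h2 := hx0 z hz
    simp only [hP]
    rw [sub_mul, mul_comm (Φ (L1.dq a z))]
    congr 1
    field_simp
    linear_combination (-k z) * h1
  refine ⟨P, fun z hz => ?_, LogGrowth.of_hardy fun ε hε => ?_, fun z hz g' hg' => ?_⟩
  · have hcx := (H2.differentiableOn_val (x z)).differentiableAt (isOpen_ball.mem_nhds hz)
    have h1 : DifferentiableAt ℂ (fun w => k w * Φ (L1.dq (g z) w) / H2.val (x z) w -
        Φ (L1.dq a w)) z :=
      (((hkd.differentiableAt (isOpen_ball.mem_nhds hz)).fun_mul
        ((L1.differentiableOn_dq Φ (g z)).differentiableAt (isOpen_ball.mem_nhds hz))).fun_div hcx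
          (hx0 z hz)).fun_sub
        ((L1.differentiableOn_dq Φ a).differentiableAt (isOpen_ball.mem_nhds hz))
    refine (h1.congr_of_eventuallyEq ?_).differentiableWithinAt
    filter_upwards [isOpen_ball.mem_nhds hz,
      hcx.continuousAt.eventually_ne (hx0 z hz)] with w hw hw0
    have h2 := hPx w hw (x z) (g z) (hgN z hz) (hgx z hz)
    field_simp
    linear_combination h2
  · obtain ⟨y, ⟨⟨D, hD⟩, g', hg', hy⟩, hyε⟩ := hd ε hε
    refine ⟨y, hyε, C * (‖Φ‖ * ‖g'‖) + D * (‖Φ‖ * ‖a‖), fun z hz => ?_⟩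
    have hz1 : 0 < 1 - ‖z‖ := by linarith [mem_ball_zero_iff.1 hz]
    have hdq : ∀ b, ‖Φ (L1.dq b z)‖ ≤ ‖Φ‖ * (‖b‖ / (1 - ‖z‖)) := fun b =>
      (Φ.le_opNorm _).trans (by gcongr; exact L1.norm_dq_le b (mem_ball_zero_iff.1 hz))
    rw [mul_comm, hPx z hz y g' hg' hy]
    calc _ ≤ C * (‖Φ‖ * (‖g'‖ / (1 - ‖z‖))) + D * (‖Φ‖ * (‖a‖ / (1 - ‖z‖))) := by
          refine (norm_sub_le _ _).trans ?_
          rw [norm_mul, norm_mul]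
          exact add_le_add
            (mul_le_mul (hkC z hz) (hdq g') (norm_nonneg _) ((norm_nonneg _).trans (hkC z hz)))
            (mul_le_mul (hD z hz) (hdq a) (norm_nonneg _) ((norm_nonneg _).trans (hD z hz)))
      _ = _ := by ring
  · have h1 := congrArg Φ (L1.mul_dq_sub g' (g z) (mem_ball_zero_iff.1 hz))
    rw [map_sub, map_sub, hΦ _ (by rw [L1.mul_comm']; exact L1.mul_mem hc hT hg' _),
      hΦ _ (by rw [L1.mul_comm']; exact L1.mul_mem hc hT (hgN z hz) _), map_smul, map_smul,
      sub_self, smul_eq_mul, smul_eq_mul, hgx z hz z hz] at h1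
    have h2 := hx0 z hz
    have h3 := ha z hz
    simp only [hP]
    field_simp
    rw [h3]
    linear_combination (-k z) * h1

/-- A closed invariant subspace whose greatest common inner factor is `S` becomes dense in the
Hardy space after division by `S`. -/
lemma exists_near_one_of_gcd {N : Submodule ℂ L1} (hT : ∀ a ∈ N, L1.shift a ∈ N) {S : ℂ → ℂ}
    (hS : IsInnerFunction S) (hS0 : ∃ z ∈ ball (0 : ℂ) 1, S z ≠ 0)
    (hdiv : ∀ a ∈ N, InnerDivides S (L1.val a))
    (hgcd : ∀ S', IsInnerFunction S' → (∀ a ∈ N, InnerDivides S' (L1.val a)) → InnerDivides S' S)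
    {ε : ℝ} (hε : 0 < ε) : ∃ x ∈ quotientSpace N S, ‖x - H2.basis 0‖ < ε := by
  refine H2.exists_near_one (quotientSpace N S) (fun x hx => hx.1) ?_ (fun u hu hux => ?_) hε
  · rintro x ⟨⟨C, hC⟩, a, ha, hax⟩
    refine ⟨⟨C, fun z hz => ?_⟩, L1.shift a, hT a ha, fun z hz => ?_⟩
    · rw [H2.val_shift x hz, norm_mul]
      have h1 := (mem_ball_zero_iff.1 hz).le
      have h2 := hC z hz
      nlinarith [norm_nonneg (H2.val x z)]
    · rw [H2.val_shift x hz, L1.val_shift a (ball_subset_closedBall hz), hax z hz]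
      ring
  · obtain ⟨k, hk, hSk⟩ := hgcd _ (hS.mul hu) fun a ha => by
      obtain ⟨f, ⟨hfd, C, hfC⟩, haf⟩ := hdiv a ha
      obtain ⟨x, hx, -⟩ := H2.exists_mul hfd hfC (H2.basis 0)
      have hx' : ∀ z ∈ ball (0 : ℂ) 1, H2.val x z = f z := fun z hz => by
        rw [hx z hz, H2.val_basis, pow_zero, mul_one]
      obtain ⟨g, hg, hxg⟩ := hux x ⟨⟨C, fun z hz => by rw [hx' z hz]; exact hfC z hz⟩, a, ha,
        fun z hz => by rw [hx' z hz]; exact haf z hz⟩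
      exact ⟨g, hg, fun z hz => by rw [haf z hz, ← hx' z hz, hxg z hz, mul_assoc]⟩
    refine ⟨k, hk, fun z hz => ?_⟩
    have := eq_zero_on_ball_of_mul hS.1 (k := fun z => 1 - u z * k z)
      ((differentiableOn_const 1).sub (hu.1.fun_mul hk.1)) hS0
      (fun z hz => by have := hSk z hz; linear_combination this) z hz
    linear_combination -this

end innerFunctions

section ideals

lemma mem_APlus_iff {f : ℂ → ℂ} :
    f ∈ APlus ↔ ∃ a : L1, ∀ z ∈ closedBall (0 : ℂ) 1, f z = L1.val a z := by
  constructor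
  · rintro ⟨a, ha, haf⟩
    exact ⟨L1.ofSummable a ha, fun z hz => (haf z hz).unique ((L1.ofSummable a ha).hasSum_val hz)⟩
  · rintro ⟨a, ha⟩
    exact ⟨a, a.summable_norm, fun z hz => by rw [ha z hz]; exact a.hasSum_val hz⟩

lemma taylorCoeff_eq_of_eq_val {f : ℂ → ℂ} {a : L1}
    (h : ∀ z ∈ closedBall (0 : ℂ) 1, f z = L1.val a z) (n : ℕ) : taylorCoeff f n = a n :=
  taylorCoeff_eq_of_hasSum (fun z hz => by
    rw [h z (ball_subset_closedBall hz)]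
    exact a.hasSum_val (ball_subset_closedBall hz)) n

lemma APlusNorm_eq_of_eq_val {f : ℂ → ℂ} {a : L1}
    (h : ∀ z ∈ closedBall (0 : ℂ) 1, f z = L1.val a z) : APlusNorm f = ‖a‖ := by
  simp only [APlusNorm, taylorCoeff_eq_of_eq_val h, L1.norm_eq]

lemma APlusNorm_sub_eq {f g : ℂ → ℂ} {a b : L1}
    (hf : ∀ z ∈ closedBall (0 : ℂ) 1, f z = L1.val a z)
    (hg : ∀ z ∈ closedBall (0 : ℂ) 1, g z = L1.val b z) : APlusNorm (f - g) = ‖a - b‖ := by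
  refine APlusNorm_eq_of_eq_val fun z hz => ?_
  rw [Pi.sub_apply, hf z hz, hg z hz]
  simp only [← L1.valL_apply z hz, map_sub]

lemma L1.val_mem_APlus (a : L1) : L1.val a ∈ APlus := mem_APlus_iff.2 ⟨a, fun _ _ => rfl⟩

lemma IsClosedIdealAPlus.mem_of_eqOn {I : Set (ℂ → ℂ)} (hI : IsClosedIdealAPlus I) {f g : ℂ → ℂ}
    (hg : g ∈ I) (h : ∀ z ∈ closedBall (0 : ℂ) 1, f z = g z) : f ∈ I := by
  obtain ⟨a, ha⟩ := mem_APlus_iff.1 (hI.1 hg)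
  have hf : ∀ z ∈ closedBall (0 : ℂ) 1, f z = L1.val a z := fun z hz => (h z hz).trans (ha z hz)
  refine hI.2.2.2 f (mem_APlus_iff.2 ⟨a, hf⟩) fun ε hε => ⟨g, hg, ?_⟩
  rw [APlusNorm_sub_eq hf ha, sub_self, norm_zero]
  exact hε

/-- The sequence space of a closed ideal. -/
def IsClosedIdealAPlus.coeffSpace {I : Set (ℂ → ℂ)} (hI : IsClosedIdealAPlus I)
    (hne : I.Nonempty) : Submodule ℂ L1 where
  carrier := {a | L1.val a ∈ I}
  zero_mem' := by
    obtain ⟨f, hf⟩ := hne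
    refine hI.mem_of_eqOn (hI.2.2.1 _ (L1.val_mem_APlus 0) f hf) fun z hz => ?_
    rw [Pi.mul_apply, ← L1.valL_apply z hz, map_zero, zero_mul]
  add_mem' := fun {a b} ha hb => by
    refine hI.mem_of_eqOn (hI.2.1 _ ha _ hb) fun z hz => ?_
    simp only [Pi.add_apply, ← L1.valL_apply z hz, map_add]
  smul_mem' := fun r a ha => by
    refine hI.mem_of_eqOn (hI.2.2.1 _ (L1.val_mem_APlus (r • L1.one)) _ ha) fun z hz => ?_
    rw [Pi.mul_apply, ← L1.val_mul _ _ hz, L1.mul_comm', map_smul, L1.mul_one_right]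

variable {I : Set (ℂ → ℂ)} (hI : IsClosedIdealAPlus I) (hne : I.Nonempty)

lemma IsClosedIdealAPlus.isClosed_coeffSpace : IsClosed (hI.coeffSpace hne : Set L1) := by
  refine isClosed_of_closure_subset fun a ha => ?_
  refine hI.2.2.2 _ (L1.val_mem_APlus a) fun ε hε => ?_
  obtain ⟨b, hb, hab⟩ := Metric.mem_closure_iff.1 ha ε hε
  refine ⟨L1.val b, hb, ?_⟩
  rwa [APlusNorm_sub_eq (fun _ _ => rfl) (fun _ _ => rfl), ← dist_eq_norm]

lemma IsClosedIdealAPlus.shift_mem_coeffSpace {a : L1} (ha : a ∈ hI.coeffSpace hne) :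
    L1.shift a ∈ hI.coeffSpace hne := by
  refine hI.mem_of_eqOn (hI.2.2.1 _ (L1.val_mem_APlus (L1.shift L1.one)) _ ha) fun z hz => ?_
  rw [Pi.mul_apply, ← L1.val_mul _ _ hz, L1.mul_comm', L1.mul_shift, L1.mul_one_right]

lemma innerDivides_of_eq_zero {S f : ℂ → ℂ} (h : ∀ z ∈ ball (0 : ℂ) 1, f z = 0) :
    InnerDivides S f :=
  ⟨fun _ => 0, ⟨differentiableOn_const 0, 0, fun z _ => by simp⟩, fun z hz => by simp [h z hz]⟩

lemma IsGcdInner.innerDivides {S : ℂ → ℂ} (h : IsGcdInner I S) {f : ℂ → ℂ} (hf : f ∈ I) :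
    InnerDivides S f := by
  by_cases h0 : ∃ z ∈ ball (0 : ℂ) 1, f z ≠ 0
  · exact h.2.1 f hf h0
  · push Not at h0
    exact innerDivides_of_eq_zero h0

lemma InnerDivides.congr {S f g : ℂ → ℂ} (h : InnerDivides S f)
    (hfg : ∀ z ∈ ball (0 : ℂ) 1, f z = g z) : InnerDivides S g := by
  obtain ⟨k, hk, h⟩ := h
  exact ⟨k, hk, fun z hz => by rw [← hfg z hz, h z hz]⟩

lemma IsClosedIdealAPlus.isClosed_hull_inter {I : Set (ℂ → ℂ)} (hI : IsClosedIdealAPlus I) :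
    IsClosed (hull I ∩ sphere 0 1) := by
  have : hull I ∩ sphere 0 1 = sphere 0 1 ∩ ⋂ f ∈ I, closedBall (0 : ℂ) 1 ∩ f ⁻¹' {0} := by
    ext z
    simp only [hull, mem_inter_iff, mem_iInter₂, mem_preimage, mem_singleton_iff]
    exact ⟨fun ⟨⟨h1, h2⟩, h3⟩ => ⟨h3, fun f hf => ⟨h1, h2 f hf⟩⟩,
      fun ⟨h1, h2⟩ => ⟨⟨sphere_subset_closedBall h1, fun f hf => (h2 f hf).2⟩, h1⟩⟩
  rw [this]
  refine isClosed_sphere.inter (isClosed_biInter fun f hf => ?_)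
  obtain ⟨a, ha⟩ := mem_APlus_iff.1 (hI.1 hf)
  exact (a.continuousOn_val.congr ha).preimage_isClosed_of_isClosed isClosed_closedBall
    isClosed_singleton

/-- A functional which annihilates a closed ideal `I`, evaluated on the shifts of an element
divisible by the inner factor of `I`, gives a sequence whose Cauchy transform continues
analytically, with logarithmic growth in the disk, off a perfect subset of the hull. -/
theorem exists_continuation_off_perfect (hnt : NontrivialIdeal I) {S : ℂ → ℂ}
    (hS : IsGcdInner I S) {Φ : L1 →L[ℂ] ℂ} (hΦ : ∀ a ∈ hI.coeffSpace hne, Φ a = 0) {a : L1}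
    (ha : InnerDivides S (L1.val a))
    (hc : Tendsto (fun n => Φ ((L1.shift ^ n) a)) atTop (nhds 0)) :
    ∃ (F : ℂ → ℂ) (K : Set ℂ), K ⊆ hull I ∩ sphere 0 1 ∧ Perfect K ∧
      DifferentiableOn ℂ F Kᶜ ∧ LogGrowth F ∧
      ∀ z, 1 < ‖z‖ → HasSum (fun n => Φ ((L1.shift ^ n) a) / z ^ (n + 1)) (F z) := by
  classical
  set N := hI.coeffSpace hne with hN
  have hNc : IsClosed (N : Set L1) := hI.isClosed_coeffSpace hne
  have hNT : ∀ a ∈ N, L1.shift a ∈ N := fun a ha => hI.shift_mem_coeffSpace hne ha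
  have hval : ∀ g ∈ I, ∃ b ∈ N, ∀ z ∈ closedBall (0 : ℂ) 1, g z = L1.val b z := fun g hg => by
    obtain ⟨b, hb⟩ := mem_APlus_iff.1 (hI.1 hg)
    exact ⟨b, hI.mem_of_eqOn hg fun z hz => (hb z hz).symm, hb⟩
  have hS0 : ∃ z ∈ ball (0 : ℂ) 1, S z ≠ 0 := by
    obtain ⟨f, hf, z, hz, hfz⟩ := hnt
    obtain ⟨k, -, hk⟩ := hS.innerDivides hf
    refine ⟨z, hz, fun h => hfz ?_⟩
    rw [hk z hz, h, zero_mul]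
  obtain ⟨k, hk, hak⟩ := ha
  obtain ⟨P, hPd, hPL, hP⟩ := exists_interior_continuation hNc hNT hS.1.1 hS0
    (fun ε hε => exists_near_one_of_gcd hNT hS.1 hS0 (fun b hb => hS.innerDivides hb)
      (fun S' hS' h => hS.2.2 S' hS' fun f hf _ => by
        obtain ⟨b, hb, hfb⟩ := hval f hf
        exact (h b hb).congr fun z hz => (hfb z (ball_subset_closedBall hz)).symm) hε) hΦ hk hak
  obtain ⟨U, R, hU, hRd, hUout, hUcirc, hR, hRin⟩ := L1.exists_resolvent N hNc hNT Φ hΦ a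
  set h₀ := hull I ∩ sphere 0 1 with hh₀
  have hsub : h₀ ⊆ sphere 0 1 := inter_subset_right
  have hh₀c : IsClosed h₀ := hI.isClosed_hull_inter
  set F₀ : ℂ → ℂ := fun z => if z ∈ ball (0 : ℂ) 1 then P z else R z with hF₀
  have hF₀in : ∀ z ∈ ball (0 : ℂ) 1, F₀ z = P z := fun z hz => by simp only [hF₀, if_pos hz]
  have hF₀out : ∀ z, z ∉ ball (0 : ℂ) 1 → F₀ z = R z := fun z hz => by
    simp only [hF₀, if_neg hz]
  have hoff : ∀ z, ‖z‖ ≠ 1 → z ∉ h₀ := fun z hz h => hz (by simpa using hsub h)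
  have hd : DifferentiableOn ℂ F₀ h₀ᶜ := fun z hz => by
    refine DifferentiableAt.differentiableWithinAt ?_
    rcases lt_trichotomy ‖z‖ 1 with h | h | h
    · have hzb : z ∈ ball (0 : ℂ) 1 := by simpa using h
      refine (hPd.differentiableAt (isOpen_ball.mem_nhds hzb)).congr_of_eventuallyEq ?_
      filter_upwards [isOpen_ball.mem_nhds hzb] with w hw using hF₀in w hw
    · have hzs : z ∈ sphere (0 : ℂ) 1 := by simpa using h
      have hzc := sphere_subset_closedBall hzs
      obtain ⟨f, hf, hfz⟩ : ∃ f ∈ I, f z ≠ 0 := by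
        by_contra! hcon
        exact hz ⟨⟨hzc, hcon⟩, hzs⟩
      obtain ⟨g, hg, hfg⟩ := hval f hf
      rw [hfg z hzc] at hfz
      have hzU : z ∈ U := hUcirc z h ⟨g, hg, hfz⟩
      refine (hRd.differentiableAt (hU.mem_nhds hzU)).congr_of_eventuallyEq ?_
      have h1 := (g.continuousOn_val z hzc).eventually_ne hfz
      filter_upwards [hU.mem_nhds hzU, eventually_nhdsWithin_iff.1 h1] with w hwU hw0
      by_cases hw : w ∈ ball (0 : ℂ) 1
      · rw [hF₀in w hw]
        refine mul_right_cancel₀ (hw0 (ball_subset_closedBall hw)) ?_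
        rw [hP w hw g hg, hRin w hwU (mem_ball_zero_iff.1 hw) g hg]
      · exact hF₀out w hw
    · refine (hRd.differentiableAt (hU.mem_nhds (hUout z h))).congr_of_eventuallyEq ?_
      filter_upwards [continuous_norm.continuousAt.eventually_const_lt h] with w hw
      exact hF₀out w (by rw [mem_ball_zero_iff]; linarith)
  have hsum : ∀ F : ℂ → ℂ, (∀ z, z ∉ h₀ → F z = F₀ z) → ∀ z, 1 < ‖z‖ →
      HasSum (fun n => Φ ((L1.shift ^ n) a) / z ^ (n + 1)) (F z) := fun F hF z hz => by
    rw [hF z (hoff z hz.ne'), hF₀out z (by rw [mem_ball_zero_iff]; linarith)]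
    exact hR z hz
  have hlog : ∀ F : ℂ → ℂ, (∀ z, z ∉ h₀ → F z = F₀ z) → LogGrowth F := fun F hF ε hε => by
    obtain ⟨C, W, hW, hWi, hWz⟩ := hPL ε hε
    refine ⟨C, W, hW, hWi, ?_⟩
    filter_upwards [hWz] with z hz hzb
    rw [hF z (hoff z (mem_ball_zero_iff.1 hzb).ne), hF₀in z hzb]
    exact hz hzb
  obtain ⟨F, K, hFF₀, hKh, hKp, hFd⟩ := exists_perfect_extension hh₀c hsub hd
    fun F hF p hp κ hκ0 hκ1 hFd => exists_extension_of_isolated hc (hsum F hF) (hlog F hF)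
      (by simpa using hsub hp) hκ0 hκ1 hFd
  exact ⟨F, K, hKh, hKp, hFd, hlog F hFF₀, hsum F hFF₀⟩

end ideals

/-- If `E` is a Carleson set such that `J₀⁺(E)` is weak-star dense in `A⁺`,
then `I = I^A ∩ S_I·H^∞` for every closed ideal `I ≠ {0}` of `A⁺` such that the perfect
part of `h(I) ∩ Γ` is contained in `E`. -/
theorem stmt_8 (E : Set ℂ) (hE : IsCarleson E) (hdense : WStarDense (J0Plus E))
    (I : Set (ℂ → ℂ)) (hI : IsClosedIdealAPlus I) (hne : NontrivialIdeal I)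
    (SI : ℂ → ℂ) (hSI : IsGcdInner I SI)
    (hperf : perfectPart (hull I ∩ Metric.sphere (0 : ℂ) 1) ⊆ E) :
    ∀ f : ℂ → ℂ, f ∈ I ↔ (f ∈ APlus ∧ f ∈ IdealGenW I ∧ InnerDivides SI f) := by
  intro f
  have hIne : I.Nonempty := hne.imp fun f hf => hf.1
  constructor
  · exact fun hf => ⟨hI.1 hf, fun J hJ => hJ.2 hf, hSI.innerDivides hf⟩
  rintro ⟨hfA, hfW, hfS⟩
  obtain ⟨a, ha⟩ := mem_APlus_iff.1 hfA
  by_contra hfI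
  set N := hI.coeffSpace hIne with hN
  have hNc : IsClosed (N : Set L1) := hI.isClosed_coeffSpace hIne
  have hNT : ∀ a ∈ N, L1.shift a ∈ N := fun a ha => hI.shift_mem_coeffSpace hIne ha
  have haN : a ∉ N := fun h => hfI (hI.mem_of_eqOn h ha)
  obtain ⟨Φ, hΦ, hΦa⟩ : ∃ Φ : L1 →L[ℂ] ℂ, (∀ b ∈ N, Φ b = 0) ∧ Φ a ≠ 0 := by
    have h0 : N.mkQL a ≠ 0 := by
      rwa [Submodule.mkQL_apply, Submodule.mkQ_apply, Ne, Submodule.Quotient.mk_eq_zero]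
    obtain ⟨Ψ, hΨ⟩ := SeparatingDual.exists_ne_zero (R := ℂ) h0
    refine ⟨Ψ ∘L N.mkQL, fun b hb => ?_, hΨ⟩
    have : N.mkQL b = 0 := by
      rwa [Submodule.mkQL_apply, Submodule.mkQ_apply, Submodule.Quotient.mk_eq_zero]
    rw [ContinuousLinearMap.comp_apply, this, map_zero]
  set c : ℕ → ℂ := fun n => Φ ((L1.shift ^ n) a) with hc
  have hc0 : Tendsto c atTop (nhds 0) := by
    refine tendsto_shift_of_mem_idealGenW (I := I) (fun g hg => ?_) hfW ha
    obtain ⟨b, hb⟩ := mem_APlus_iff.1 (hI.1 hg)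
    have hbN : b ∈ N := hI.mem_of_eqOn hg fun z hz => (hb z hz).symm
    exact ⟨b, hb, fun n => hΦ _ (L1.shift_pow_mem hNT hbN n)⟩
  obtain ⟨F, K, hKh, hKp, hFd, hFL, hF⟩ := exists_continuation_off_perfect hI hIne hne hSI hΦ
    (hfS.congr fun z hz => ha z (ball_subset_closedBall hz)) hc0
  have hKE : K ⊆ E := fun z hz => hperf (mem_sUnion.2 ⟨K, ⟨hKp, hKh⟩, hz⟩)
  have hflat : ∀ g ∈ APlus, VanishAllDeriv E g → pairing g c = 0 := fun g hg hgE => by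
    obtain ⟨b, hb⟩ := mem_APlus_iff.1 hg
    simp only [pairing, taylorCoeff_eq_of_eq_val hb]
    exact tsum_mul_eq_zero_of_vanishAllDeriv hE hc0 hF hFL
      (hFd.mono (compl_subset_compl.2 hKE)) hgE hb
  obtain ⟨B, hB⟩ := hc0.norm.bddAbove_range
  have hB' : ∀ n, ‖c n‖ ≤ B := fun n => hB ⟨n, rfl⟩
  have hpair_le : ∀ b : L1, ‖∑' n, b n * c n‖ ≤ ‖b‖ * B := fun b => by
    have hsum : HasSum (fun n => ‖b n‖ * B) (‖b‖ * B) := by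
      rw [L1.norm_eq]
      exact b.summable_norm.hasSum.mul_right B
    exact tsum_of_norm_bounded hsum fun n => by
      rw [norm_mul]
      exact mul_le_mul_of_nonneg_left (hB' n) (norm_nonneg _)
  have hzero : ∀ g ∈ J0Plus E, pairing g c = 0 := fun g hg => by
    obtain ⟨b, hb⟩ := mem_APlus_iff.1 hg.1
    have hB0 : 0 ≤ B := (norm_nonneg _).trans (hB' 0)
    refine norm_le_zero_iff.1 (le_of_forall_pos_lt_add fun ε hε => ?_)
    obtain ⟨h, hhA, hhE, hh⟩ := hg.2 (ε / (B + 1)) (by positivity)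
    obtain ⟨b', hb'⟩ := mem_APlus_iff.1 hhA
    have h1 := hflat h hhA hhE
    rw [APlusNorm_sub_eq hb hb'] at hh
    have hs : ∀ x : L1, Summable fun n => x n * c n := fun x =>
      (x.summable_norm.mul_right B).of_norm_bounded fun n => by
        rw [norm_mul]
        exact mul_le_mul_of_nonneg_left (hB' n) (norm_nonneg _)
    have h2 := hpair_le (b - b')
    simp only [L1.sub_apply, sub_mul] at h2
    rw [(hs b).tsum_sub (hs b')] at h2
    simp only [pairing, taylorCoeff_eq_of_eq_val hb, taylorCoeff_eq_of_eq_val hb'] at h1 ⊢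
    rw [h1, sub_zero] at h2
    rw [lt_div_iff₀ (by linarith)] at hh
    nlinarith [norm_nonneg (b - b')]
  have hc00 : c 0 ≠ 0 := hΦa
  obtain ⟨g, hg, hgε⟩ := hdense (L1.val L1.one) L1.one.val_mem_APlus 1 (fun _ => c)
    (fun _ => hc0) ‖c 0‖ (norm_pos_iff.2 hc00)
  have h1 := hgε 0
  rw [hzero g hg, sub_zero] at h1
  have h2 : pairing (L1.val L1.one) c = c 0 := by
    simp only [pairing, L1.taylorCoeff_val]
    rw [tsum_eq_single 0 fun n hn => ?_]
    · have := L1.shift_pow_one 0 0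
      rw [pow_zero, one_apply_eq_self] at this
      rw [this, if_pos rfl, one_mul]
    · have := L1.shift_pow_one 0 n
      rw [pow_zero, one_apply_eq_self, if_neg hn] at this
      rw [this, zero_mul]
  rw [h2] at h1
  exact h1.false
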